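/- Let n ≥ 2 and k ∈ ℤ. The set of gradient homotopy classes of gradient maps f : ℝⁿ → ℝⁿ with compact zero set and Brouwer degree k is a singleton; in particular, any two gradient maps f, g : ℝⁿ → ℝⁿ with compact zero sets and deg f = deg g = k are gradient homotopic, and at least one such map exists. -/

import Mathlib

open Set Metric Filter

noncomputable section

/-- Euclidean space `ℝⁿ`. -/
abbrev Euc (n : ℕ) := EuclideanSpace ℝ (Fin n)

/-- A map `f : ℝⁿ → ℝⁿ` is gradient if it is the gradient of a `C¹` function `φ : ℝⁿ → ℝ`. -/
def IsGradient {n : ℕ} (f : Euc n → Euc n) : Prop :=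
  ∃ φ : Euc n → ℝ, ContDiff ℝ 1 φ ∧ ∀ x, gradient φ x = f x

/-- A map is proper if preimages of compact sets are compact (our maps are continuous anyway). -/
def IsProper {n : ℕ} (f : Euc n → Euc n) : Prop :=
  ∀ K : Set (Euc n), IsCompact K → IsCompact (f ⁻¹' K)

/-- `h : [0,1] × ℝⁿ → ℝⁿ` is a gradient homotopy: it is continuous, each `h t` is a
gradient map, and the zero set `h⁻¹(0)` (within `[0,1] × ℝⁿ`) is compact. -/
def IsGradientHomotopy {n : ℕ} (h : ℝ → Euc n → Euc n) : Prop :=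
  ContinuousOn (fun p : ℝ × Euc n => h p.1 p.2) (Icc 0 1 ×ˢ univ) ∧
  (∀ t ∈ Icc (0:ℝ) 1, IsGradient (h t)) ∧
  IsCompact {p : ℝ × Euc n | p.1 ∈ Icc (0:ℝ) 1 ∧ h p.1 p.2 = 0}

/-- Two maps are gradient homotopic if some gradient homotopy connects them. -/
def GradientHomotopic {n : ℕ} (f g : Euc n → Euc n) : Prop :=
  ∃ h : ℝ → Euc n → Euc n, IsGradientHomotopy h ∧ h 0 = f ∧ h 1 = g

/-- `h : [0,1] × ℝⁿ → ℝⁿ` is a proper gradient homotopy: it is continuous, each `h t` is a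
gradient map, and `h` is proper as a map on `[0,1] × ℝⁿ`. -/
def IsProperGradientHomotopy {n : ℕ} (h : ℝ → Euc n → Euc n) : Prop :=
  ContinuousOn (fun p : ℝ × Euc n => h p.1 p.2) (Icc 0 1 ×ˢ univ) ∧
  (∀ t ∈ Icc (0:ℝ) 1, IsGradient (h t)) ∧
  (∀ K : Set (Euc n), IsCompact K →
    IsCompact {p : ℝ × Euc n | p.1 ∈ Icc (0:ℝ) 1 ∧ h p.1 p.2 ∈ K})

/-- Two maps are proper gradient homotopic if some proper gradient homotopy connects them. -/
def ProperGradientHomotopic {n : ℕ} (f g : Euc n → Euc n) : Prop :=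
  ∃ h : ℝ → Euc n → Euc n, IsProperGradientHomotopy h ∧ h 0 = f ∧ h 1 = g
/-- A Brouwer degree theory on `ℝⁿ`: an integer-valued function `deg f Ω`, defined for
continuous maps nonvanishing on `∂Ω`, satisfying the classical axioms of normalization,
additivity and homotopy invariance, which determine it uniquely. -/
structure DegreeTheory (n : ℕ) where
  deg : (Euc n → Euc n) → Set (Euc n) → ℤ
  normalized : ∀ Ω : Set (Euc n), IsOpen Ω → Bornology.IsBounded Ω → (0 : Euc n) ∈ Ω →
    deg id Ω = 1
  additive : ∀ (f : Euc n → Euc n) (Ω Ω₁ Ω₂ : Set (Euc n)),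
    IsOpen Ω → Bornology.IsBounded Ω → IsOpen Ω₁ → IsOpen Ω₂ →
    Ω₁ ⊆ Ω → Ω₂ ⊆ Ω → Disjoint Ω₁ Ω₂ →
    ContinuousOn f (closure Ω) →
    (∀ x ∈ closure Ω \ (Ω₁ ∪ Ω₂), f x ≠ 0) →
    deg f Ω = deg f Ω₁ + deg f Ω₂
  homotopyInv : ∀ (h : ℝ → Euc n → Euc n) (Ω : Set (Euc n)),
    IsOpen Ω → Bornology.IsBounded Ω →
    ContinuousOn (fun p : ℝ × Euc n => h p.1 p.2) (Icc 0 1 ×ˢ closure Ω) →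
    (∀ t ∈ Icc (0:ℝ) 1, ∀ x ∈ frontier Ω, h t x ≠ 0) →
    deg (h 0) Ω = deg (h 1) Ω

/-- `f` has Brouwer degree `k`: `deg f` computed on any ball containing `f⁻¹(0)` equals `k`. -/
def HasDeg {n : ℕ} (D : DegreeTheory n) (f : Euc n → Euc n) (k : ℤ) : Prop :=
  ∀ R : ℝ, 0 < R → f ⁻¹' {0} ⊆ ball 0 R → D.deg f (ball 0 R) = k

namespace GH
open scoped RealInnerProductSpace Topology

/-- Homotopy through maps satisfying `P`. -/
def Htp {X Y : Type*} [TopologicalSpace X] [TopologicalSpace Y] (P : (X → Y) → Prop)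
    (f g : X → Y) : Prop :=
  ∃ h : ℝ → X → Y, Continuous (fun z : ℝ × X => h z.1 z.2) ∧ (∀ t, P (h t)) ∧ h 0 = f ∧ h 1 = g

section htp
variable {X Y X' Y' : Type*} [TopologicalSpace X] [TopologicalSpace Y]
  [TopologicalSpace X'] [TopologicalSpace Y'] {P : (X → Y) → Prop} {f g k : X → Y}

theorem Htp.refl (hc : Continuous f) (hf : P f) : Htp P f f :=
  ⟨fun _ => f, by fun_prop, fun _ => hf, rfl, rfl⟩

theorem Htp.symm (h : Htp P f g) : Htp P g f := by
  obtain ⟨h, hc, hP, h0, h1⟩ := h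
  refine ⟨fun t => h (1 - t), ?_, fun t => hP _, by simpa using h1, by simpa using h0⟩
  exact hc.comp (f := fun z : ℝ × X => (1 - z.1, z.2)) (by fun_prop)

theorem Htp.trans (h : Htp P f g) (h' : Htp P g k) : Htp P f k := by
  obtain ⟨h, hc, hP, h0, h1⟩ := h
  obtain ⟨h', hc', hP', h0', h1'⟩ := h'
  refine ⟨fun t x => if t ≤ 1/2 then h (2 * t) x else h' (2 * t - 1) x, ?_, ?_, ?_, ?_⟩
  · refine Continuous.if_le ?_ ?_ ?_ continuous_const ?_
    · exact hc.comp (f := fun z : ℝ × X => (2 * z.1, z.2)) (by fun_prop)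
    · exact hc'.comp (f := fun z : ℝ × X => (2 * z.1 - 1, z.2)) (by fun_prop)
    · fun_prop
    · rintro ⟨t, x⟩ ht
      simp only at ht ⊢
      subst ht
      norm_num
      rw [h1, h0']
  · intro t
    by_cases ht : t ≤ 1/2
    · have := hP (2 * t)
      simp only [ht, if_true]
      exact this
    · have := hP' (2 * t - 1)
      simp only [ht, if_false]
      exact this
  · funext x; simp [h0]
  · funext x; norm_num [h1']

theorem Htp.of_Icc (h : ℝ → X → Y) (hc : ContinuousOn (fun z : ℝ × X => h z.1 z.2) (Icc 0 1 ×ˢ univ))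
    (hP : ∀ t ∈ Icc (0:ℝ) 1, P (h t)) (h0 : h 0 = f) (h1 : h 1 = g) : Htp P f g := by
  have hm : ∀ t : ℝ, max 0 (min 1 t) ∈ Icc (0:ℝ) 1 := fun t => ⟨le_max_left _ _, by simp⟩
  refine ⟨fun t => h (max 0 (min 1 t)), ?_, fun t => hP _ (hm t), by simpa using h0, by simpa using h1⟩
  exact hc.comp_continuous (f := fun z : ℝ × X => (max 0 (min 1 z.1), z.2)) (by fun_prop)
    (fun z => ⟨hm _, mem_univ _⟩)

theorem Htp.of_cont (h : ℝ → X → Y) (hc : Continuous (fun z : ℝ × X => h z.1 z.2))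
    (hP : ∀ t ∈ Icc (0:ℝ) 1, P (h t)) (h0 : h 0 = f) (h1 : h 1 = g) : Htp P f g :=
  Htp.of_Icc h hc.continuousOn hP h0 h1

theorem Htp.map {Q : (X' → Y') → Prop} (T : (X → Y) → (X' → Y'))
    (hT : ∀ h : ℝ → X → Y, Continuous (fun z : ℝ × X => h z.1 z.2) → (∀ t, P (h t)) →
      Continuous (fun z : ℝ × X' => T (h z.1) z.2))
    (hP : ∀ f, P f → Q (T f)) (h : Htp P f g) : Htp Q (T f) (T g) := by
  obtain ⟨h, hc, hP', h0, h1⟩ := h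
  exact ⟨fun t => T (h t), hT h hc hP', fun t => hP _ (hP' t), by simp only [h0], by simp only [h1]⟩

theorem Htp.mono {Q : (X → Y) → Prop} (hPQ : ∀ f, P f → Q f) (h : Htp P f g) : Htp Q f g := by
  obtain ⟨h, hc, hP', h0, h1⟩ := h
  exact ⟨h, hc, fun t => hPQ _ (hP' t), h0, h1⟩

theorem Htp.cont (h : Htp P f g) : Continuous f ∧ Continuous g := by
  obtain ⟨h, hc, hP', rfl, rfl⟩ := h
  exact ⟨hc.comp (f := fun x => (0, x)) (by fun_prop), hc.comp (f := fun x => (1, x)) (by fun_prop)⟩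

theorem Htp.prop (h : Htp P f g) : P f ∧ P g := by
  obtain ⟨h, hc, hP', rfl, rfl⟩ := h
  exact ⟨hP' _, hP' _⟩
end htp

section grad
variable {n : ℕ} {f g : Euc n → Euc n}

theorem isGradient_iff : IsGradient f ↔
    Continuous f ∧ ∃ φ : Euc n → ℝ, ∀ x, HasGradientAt φ (f x) x := by
  constructor
  · rintro ⟨φ, hφ, h⟩
    have hd : Differentiable ℝ φ := hφ.differentiable (by simp)
    refine ⟨?_, φ, fun x => ?_⟩
    · have : f = fun x => gradient φ x := by funext x; rw [h]
      rw [this]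
      unfold gradient
      exact (LinearIsometryEquiv.continuous _).comp (hφ.continuous_fderiv (by simp))
    · rw [← h]; exact (hd x).hasGradientAt
  · rintro ⟨hc, φ, hφ⟩
    refine ⟨φ, ?_, fun x => (hφ x).gradient⟩
    rw [contDiff_one_iff_fderiv]
    refine ⟨fun x => (hφ x).differentiableAt, ?_⟩
    have : fderiv ℝ φ = fun x => (InnerProductSpace.toDual ℝ (Euc n)) (f x) := by
      funext x; exact (hφ x).hasFDerivAt.fderiv
    rw [this]
    exact (LinearIsometryEquiv.continuous _).comp hc

theorem _root_.IsGradient.continuous (hf : IsGradient f) : Continuous f := (isGradient_iff.1 hf).1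

theorem _root_.IsGradient.add (hf : IsGradient f) (hg : IsGradient g) : IsGradient (fun x => f x + g x) := by
  rw [isGradient_iff] at *
  obtain ⟨hc, φ, hφ⟩ := hf
  obtain ⟨hc', φ', hφ'⟩ := hg
  refine ⟨by fun_prop, fun x => φ x + φ' x, fun x => ?_⟩
  have := (hφ x).hasFDerivAt.add (hφ' x).hasFDerivAt
  rw [← map_add] at this
  exact hasGradientAt_iff_hasFDerivAt.2 this

theorem _root_.IsGradient.smul (c : ℝ) (hf : IsGradient f) : IsGradient (fun x => c • f x) := by
  rw [isGradient_iff] at *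
  obtain ⟨hc, φ, hφ⟩ := hf
  refine ⟨by fun_prop, fun x => c * φ x, fun x => ?_⟩
  have := (hφ x).hasFDerivAt.const_mul c
  rw [hasGradientAt_iff_hasFDerivAt]
  rw [map_smulₛₗ]
  simpa using this

theorem isGradient_of_contDiff {φ : Euc n → ℝ} (h : ContDiff ℝ 1 φ) : IsGradient (gradient φ) :=
  ⟨φ, h, fun _ => rfl⟩

/-- nonvanishing on the unit sphere gradient fields -/
def PG (f : Euc n → Euc n) : Prop := IsGradient f ∧ ∀ x, ‖x‖ = 1 → f x ≠ 0

/-- gradient fields with zeros in the ball of radius `R` -/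
def PZ (R : ℝ) (f : Euc n → Euc n) : Prop := IsGradient f ∧ ∀ x, f x = 0 → ‖x‖ ≤ R

theorem Htp.gradientHomotopic {R : ℝ} (h : Htp (PZ R) f g) : GradientHomotopic f g := by
  obtain ⟨h, hc, hP, h0, h1⟩ := h
  refine ⟨h, ⟨hc.continuousOn, fun t _ => (hP t).1, ?_⟩, h0, h1⟩
  refine IsCompact.of_isClosed_subset (isCompact_Icc (a := (0:ℝ)) (b := 1) |>.prod
    (isCompact_closedBall (0 : Euc n) R)) ?_ ?_
  · exact (isClosed_Icc.preimage continuous_fst).inter (isClosed_eq hc continuous_const)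
  · rintro ⟨t, x⟩ ⟨ht, hx⟩
    exact ⟨ht, by simpa using (hP t).2 x hx⟩

theorem Htp.linear (hf : IsGradient f) (hg : IsGradient g)
    (h : ∀ t ∈ Icc (0:ℝ) 1, ∀ x, ‖x‖ = 1 → (1 - t) • f x + t • g x ≠ 0) : Htp PG f g := by
  have hfc := hf.continuous
  have hgc := hg.continuous
  refine Htp.of_cont (fun t x => (1 - t) • f x + t • g x) (by fun_prop)
    (fun t ht => ⟨(hf.smul _).add (hg.smul _), h t ht⟩) (by simp) (by simp)

theorem Htp.of_eqOn (hf : PG f) (hg : IsGradient g) (h : ∀ x, ‖x‖ = 1 → f x = g x) :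
    Htp PG f g := by
  refine Htp.linear hf.1 hg fun t _ x hx => ?_
  rw [← h x hx, ← add_smul]
  simpa using hf.2 x hx

end grad
end GH

namespace GH
open scoped RealInnerProductSpace Topology

section rad
variable {n : ℕ} {f g : Euc n → Euc n}

/-- the radial scaling factor -/
def rs (τ : ℝ) (x : Euc n) : ℝ := (√(1 + τ * ‖x‖ ^ 2))⁻¹

/-- reparametrised gradient field -/
def RR (c τ : ℝ) (f : Euc n → Euc n) (x : Euc n) : Euc n :=
  c • (rs τ x • f ((c * rs τ x) • x) - (τ * rs τ x ^ 3 * ⟪x, f ((c * rs τ x) • x)⟫) • x)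

theorem rs_pos {τ : ℝ} (hτ : 0 ≤ τ) (x : Euc n) : 0 < rs τ x := by
  unfold rs; positivity

theorem rs_sq {τ : ℝ} (hτ : 0 ≤ τ) (x : Euc n) : rs τ x ^ 2 * (1 + τ * ‖x‖ ^ 2) = 1 := by
  unfold rs
  have : 0 < 1 + τ * ‖x‖ ^ 2 := by positivity
  rw [inv_pow, Real.sq_sqrt this.le, inv_mul_cancel₀ this.ne']

theorem rs_cont : ContinuousOn (fun z : ℝ × Euc n => rs z.1 z.2) (Icc 0 1 ×ˢ univ) := by
  unfold rs
  refine ContinuousOn.inv₀ (by fun_prop) ?_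
  rintro ⟨t, x⟩ ⟨⟨ht, _⟩, _⟩
  simp only at ht ⊢
  positivity

theorem rs_hasFDerivAt {τ : ℝ} (hτ : 0 ≤ τ) (x : Euc n) :
    HasFDerivAt (rs τ : Euc n → ℝ) ((-(τ * rs τ x ^ 3)) • innerSL ℝ x) x := by
  have hp : 0 < 1 + τ * ‖x‖ ^ 2 := by positivity
  have h1 : HasFDerivAt (fun x : Euc n => 1 + τ * ‖x‖ ^ 2) (τ • (2 • innerSL ℝ x)) x := by
    exact ((hasStrictFDerivAt_norm_sq x).hasFDerivAt.const_mul τ).const_add 1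
  have h2 := (hasDerivAt_inv (x := √(1 + τ * ‖x‖ ^ 2)) (by positivity)).comp_hasFDerivAt x (h1.sqrt hp.ne')
  refine h2.congr_fderiv ?_
  ext v
  simp [rs]
  have : √(1 + τ * ‖x‖ ^ 2) ≠ 0 := by positivity
  field_simp

theorem RR_isGradient (hf : IsGradient f) (c : ℝ) {τ : ℝ} (hτ : 0 ≤ τ) : IsGradient (RR c τ f) := by
  have hfc := hf.continuous
  obtain ⟨_, φ, hφ⟩ := isGradient_iff.1 hf
  have hsc : Continuous (rs τ : Euc n → ℝ) :=
    continuous_iff_continuousAt.2 fun x => (rs_hasFDerivAt hτ x).continuousAt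
  rw [isGradient_iff]
  refine ⟨by unfold RR; fun_prop, fun x => φ ((c * rs τ x) • x), fun x => ?_⟩
  have h1 : HasFDerivAt (fun x : Euc n => (c * rs τ x) • x) _ x :=
    ((rs_hasFDerivAt hτ x).const_mul c).smul (hasFDerivAt_id x)
  have h2 := HasFDerivAt.comp (g := φ) (f := fun x : Euc n => (c * rs τ x) • x) x (hφ _).hasFDerivAt h1
  rw [hasGradientAt_iff_hasFDerivAt]
  refine h2.congr_fderiv ?_
  ext v
  simp [RR, inner_smul_right, real_inner_comm]
  ring

theorem RR_eq_zero {c τ : ℝ} (hc : 0 < c) (hτ : 0 ≤ τ) {x : Euc n} (h : RR c τ f x = 0) :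
    f ((c * rs τ x) • x) = 0 := by
  unfold RR at h
  set F := f ((c * rs τ x) • x)
  have hs := rs_pos hτ x
  have hs2 := rs_sq hτ x
  set s := rs τ x
  rw [smul_eq_zero_iff_right hc.ne', sub_eq_zero] at h
  have h1 : ⟪x, F⟫ = 0 := by
    have := congrArg (fun y => ⟪x, y⟫) h
    simp only [inner_smul_right, real_inner_self_eq_norm_sq] at this
    have h3 : ⟪x, F⟫ * s ^ 3 = 0 := by linear_combination this + s * ⟪x, F⟫ * hs2
    rcases mul_eq_zero.1 h3 with h | h
    · exact h
    · exact absurd h (by positivity)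
  rw [h1] at h
  simpa [hs.ne'] using h

theorem RR_cont {h : ℝ → Euc n → Euc n} (hc : Continuous (fun z : ℝ × Euc n => h z.1 z.2))
    {c τ : ℝ → ℝ} (hcc : Continuous c) (hτ : Continuous τ) (hτ' : ∀ t ∈ Icc (0:ℝ) 1, τ t ∈ Icc (0:ℝ) 1) :
    ContinuousOn (fun z : ℝ × Euc n => RR (c z.1) (τ z.1) (h z.1) z.2) (Icc 0 1 ×ˢ univ) := by
  have hs : ContinuousOn (fun z : ℝ × Euc n => rs (τ z.1) z.2) (Icc 0 1 ×ˢ univ) :=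
    rs_cont.comp (f := fun z : ℝ × Euc n => (τ z.1, z.2)) (by fun_prop)
      (fun z hz => ⟨hτ' _ hz.1, mem_univ _⟩)
  have hF : ContinuousOn (fun z : ℝ × Euc n => h z.1 ((c z.1 * rs (τ z.1) z.2) • z.2))
      (Icc 0 1 ×ˢ univ) :=
    hc.comp_continuousOn (f := fun z : ℝ × Euc n => (z.1, (c z.1 * rs (τ z.1) z.2) • z.2))
      (by fun_prop)
  unfold RR
  have hI := ContinuousOn.inner (𝕜 := ℝ) (continuous_snd (X := ℝ) (Y := Euc n)).continuousOn hF
  fun_prop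

/-- the standard compression of the plane to the open ball -/
def rho (f : Euc n → Euc n) : Euc n → Euc n := RR 1 1 f

theorem rho_zero_bound {f : Euc n → Euc n} {r : ℝ} (h0 : 0 ≤ r) (h1 : r < 1)
    (hr : ∀ x, ‖x‖ < 1 → f x = 0 → ‖x‖ ≤ r) {x : Euc n} (hx : rho f x = 0) :
    ‖x‖ ≤ 1 / (1 - r ^ 2) := by
  have h2 := RR_eq_zero one_pos zero_le_one hx
  have hs := rs_pos zero_le_one x
  have hs2 := rs_sq zero_le_one x
  set s := rs 1 x
  have hn : ‖(1 * s) • x‖ = s * ‖x‖ := by rw [norm_smul, one_mul, Real.norm_of_nonneg hs.le]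
  have h3 : (s * ‖x‖) ^ 2 < 1 := by nlinarith [pow_pos hs 2]
  have h4 := hr _ (by rw [hn]; nlinarith [mul_nonneg hs.le (norm_nonneg x)]) h2
  rw [hn] at h4
  have h5 : (s * ‖x‖) ^ 2 ≤ r ^ 2 := by gcongr
  have h6 : s ^ 2 * ‖x‖ ^ 2 ≤ r ^ 2 * (s ^ 2 * (1 + 1 * ‖x‖ ^ 2)) := by rw [hs2]; linarith
  have h7 : ‖x‖ ^ 2 ≤ r ^ 2 * (1 + ‖x‖ ^ 2) := by
    have := pow_pos hs 2
    have : s ^ 2 * ‖x‖ ^ 2 ≤ s ^ 2 * (r ^ 2 * (1 + ‖x‖ ^ 2)) := by linarith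
    exact le_of_mul_le_mul_left this (by positivity)
  have h8 : 0 < 1 - r ^ 2 := by nlinarith
  rw [le_div_iff₀ h8]
  have h9 : ‖x‖ ^ 2 * (1 - r^2) ≤ 1 := by nlinarith
  have h10 : (‖x‖ * (1 - r^2)) ^ 2 ≤ 1 := by
    have : (‖x‖ * (1 - r^2)) ^ 2 = ‖x‖ ^ 2 * (1 - r^2) * (1 - r^2) := by ring
    rw [this]
    nlinarith [mul_nonneg (sq_nonneg ‖x‖) h8.le, sq_nonneg r]
  nlinarith

theorem compact_bound {h : ℝ → Euc n → Euc n} (hc : Continuous (fun z : ℝ × Euc n => h z.1 z.2))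
    (hS : ∀ t ∈ Icc (0:ℝ) 1, ∀ x, ‖x‖ = 1 → h t x ≠ 0) :
    ∃ r, 0 ≤ r ∧ r < 1 ∧ ∀ t ∈ Icc (0:ℝ) 1, ∀ x, ‖x‖ < 1 → h t x = 0 → ‖x‖ ≤ r := by
  let K : Set (ℝ × Euc n) := (Icc (0:ℝ) 1 ×ˢ closedBall (0 : Euc n) 1) ∩ {z | h z.1 z.2 = 0}
  have hK : IsCompact K :=
    (isCompact_Icc.prod (isCompact_closedBall _ _)).inter_right (isClosed_eq hc continuous_const)
  rcases K.eq_empty_or_nonempty with he | hne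
  · refine ⟨0, le_rfl, one_pos, fun t ht x hx h0 => ?_⟩
    have : (t, x) ∈ K := ⟨⟨ht, by simpa using hx.le⟩, h0⟩
    rw [he] at this; exact this.elim
  · obtain ⟨z, hz, hmax⟩ := hK.exists_isMaxOn hne (f := fun z => ‖z.2‖) (by fun_prop)
    refine ⟨‖z.2‖, norm_nonneg _, ?_, fun t ht x hx h0 => hmax (a := (t, x)) ⟨⟨ht, by simpa using hx.le⟩, h0⟩⟩
    have h1 : ‖z.2‖ ≤ 1 := by simpa using hz.1.2
    exact lt_of_le_of_ne h1 fun h => hS _ hz.1.1 _ h hz.2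

theorem htp_rho (h : Htp PG f g) : ∃ R, Htp (PZ R) (rho f) (rho g) := by
  obtain ⟨h, hc, hP, rfl, rfl⟩ := h
  obtain ⟨r, h0, h1, hr⟩ := compact_bound hc (fun t _ => (hP t).2)
  refine ⟨1 / (1 - r ^ 2), Htp.of_Icc (fun t => GH.rho (h t))
    (RR_cont (c := fun _ => 1) (τ := fun _ => 1) hc continuous_const continuous_const (by simp)) ?_ rfl rfl⟩
  intro t ht
  exact ⟨RR_isGradient (hP t).1 _ zero_le_one, fun x hx => rho_zero_bound h0 h1 (hr t ht) hx⟩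

theorem scale_isGradient (hf : IsGradient f) (R : ℝ) : IsGradient (fun x => R • f (R • x)) := by
  have := RR_isGradient hf R (le_refl 0)
  have h : RR R 0 f = fun x => R • f (R • x) := by
    funext x; simp [RR, rs]
  rwa [h] at this

theorem htp_scale (hf : IsGradient f) {R0 R : ℝ} (h0 : 0 ≤ R0) (h1 : R0 < R) (hR : 1 ≤ R)
    (hz : ∀ x, f x = 0 → ‖x‖ ≤ R0) : ∃ M, Htp (PZ M) f (rho (fun x => R • f (R • x))) := by
  set μ := min 1 (R ^ 2 - R0 ^ 2) with hμ
  have hμ0 : 0 < μ := lt_min one_pos (by nlinarith)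
  refine ⟨√(R0 ^ 2 / μ), Htp.of_Icc (fun t => RR (√(1 + t * (R ^ 2 - 1))) t f) ?_ ?_ ?_ ?_⟩
  · have := hf.continuous
    exact RR_cont (h := fun _ => f) (c := fun t => √(1 + t * (R ^ 2 - 1))) (τ := fun t => t) (by fun_prop) (by fun_prop) continuous_id (fun t ht => ht)
  · intro t ht
    refine ⟨RR_isGradient hf _ ht.1, fun x hx => ?_⟩
    have hc : 0 < 1 + t * (R ^ 2 - 1) := by
      have : 0 ≤ t * (R ^ 2 - 1) := mul_nonneg ht.1 (by nlinarith)
      linarith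
    have h2 := hz _ (RR_eq_zero (Real.sqrt_pos.2 hc) ht.1 hx)
    have hs := rs_pos ht.1 x
    have hs2 := rs_sq ht.1 x
    set s := rs t x
    rw [norm_smul, Real.norm_of_nonneg (by positivity)] at h2
    have h5 : (√(1 + t * (R ^ 2 - 1)) * s * ‖x‖) ^ 2 ≤ R0 ^ 2 := by gcongr
    rw [mul_pow, mul_pow, Real.sq_sqrt hc.le] at h5
    have h6 : s ^ 2 * ((1 + t * (R ^ 2 - 1)) * ‖x‖ ^ 2) ≤ s ^ 2 * (R0 ^ 2 * (1 + t * ‖x‖ ^ 2)) := by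
      have : s ^ 2 * (R0 ^ 2 * (1 + t * ‖x‖ ^ 2)) = R0 ^ 2 * (s ^ 2 * (1 + t * ‖x‖ ^ 2)) := by ring
      rw [this, hs2]; linarith
    have h7 := le_of_mul_le_mul_left h6 (by positivity)
    apply Real.le_sqrt_of_sq_le
    rw [le_div_iff₀ hμ0]
    have h8 : μ ≤ 1 - t + t * (R ^ 2 - R0 ^ 2) := by
      have a1 : μ ≤ 1 := min_le_left _ _
      have a2 : μ ≤ R ^ 2 - R0 ^ 2 := min_le_right _ _
      nlinarith [ht.1, ht.2, mul_le_mul_of_nonneg_left a2 ht.1, mul_le_mul_of_nonneg_left a1 (sub_nonneg.2 ht.2)]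
    have := mul_le_mul_of_nonneg_left h8 (sq_nonneg ‖x‖)
    nlinarith
  · funext x; simp [RR, rs]
  · funext x
    have : √(R ^ 2) = R := Real.sqrt_sq (by linarith)
    simp only [RR, rho, this, inner_smul_right, one_mul, add_sub_cancel]
    rw [mul_comm R (rs 1 x), mul_smul (rs 1 x) R x, smul_comm (rs 1 x) R x]
    module
end rad
end GH

namespace GH
open scoped RealInnerProductSpace Topology

section deg
variable {n : ℕ} (D : DegreeTheory n) {f g : Euc n → Euc n} {Ω Ω' : Set (Euc n)}

theorem deg_empty : D.deg f ∅ = 0 := by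
  have := D.additive f ∅ ∅ ∅ isOpen_empty Bornology.isBounded_empty isOpen_empty isOpen_empty
    le_rfl le_rfl (by simp) (by simp) (by simp)
  omega

theorem deg_excise (hΩ : IsOpen Ω) (hb : Bornology.IsBounded Ω) (hΩ' : IsOpen Ω') (hs : Ω' ⊆ Ω)
    (hf : ContinuousOn f (closure Ω)) (hz : ∀ x ∈ closure Ω, x ∉ Ω' → f x ≠ 0) :
    D.deg f Ω = D.deg f Ω' := by
  have := D.additive f Ω Ω' ∅ hΩ hb hΩ' isOpen_empty hs (empty_subset _) (by simp) hf
    (fun x hx => hz x hx.1 (by simpa using hx.2))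
  rw [this, deg_empty, add_zero]

theorem deg_eq_zero (hΩ : IsOpen Ω) (hb : Bornology.IsBounded Ω)
    (hf : ContinuousOn f (closure Ω)) (hz : ∀ x ∈ closure Ω, f x ≠ 0) :
    D.deg f Ω = 0 := by
  rw [deg_excise D hΩ hb isOpen_empty (empty_subset _) hf (fun x hx _ => hz x hx), deg_empty]

theorem deg_congr (hΩ : IsOpen Ω) (hb : Bornology.IsBounded Ω)
    (hf : ContinuousOn f (closure Ω)) (hz : ∀ x ∈ frontier Ω, f x ≠ 0)
    (hfg : ∀ x ∈ closure Ω, f x = g x) : D.deg f Ω = D.deg g Ω := by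
  have key : ∀ t : ℝ, ∀ x ∈ closure Ω, (if t = 0 then f else g) x = f x := by
    intro t x hx
    split_ifs
    · rfl
    · exact (hfg x hx).symm
  have := D.homotopyInv (fun t => if t = 0 then f else g) Ω hΩ hb
    ((hf.comp (f := Prod.snd) (s := Icc (0:ℝ) 1 ×ˢ closure Ω) (by fun_prop) (fun z hz => hz.2)).congr
      (fun z hz => key _ _ hz.2))
    (fun t _ x hx => by rw [key t x (frontier_subset_closure hx)]; exact hz x hx)
  simpa using this

theorem deg_htp_ball {h : ℝ → Euc n → Euc n} {R : ℝ} (hR : 0 < R)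
    (hc : Continuous (fun z : ℝ × Euc n => h z.1 z.2))
    (hz : ∀ t ∈ Icc (0:ℝ) 1, ∀ x, ‖x‖ = R → h t x ≠ 0) :
    D.deg (h 0) (ball 0 R) = D.deg (h 1) (ball 0 R) := by
  refine D.homotopyInv h _ isOpen_ball isBounded_ball hc.continuousOn fun t ht x hx => hz t ht x ?_
  rw [frontier_ball _ hR.ne'] at hx
  simpa using hx

theorem deg_excise_ball {R r : ℝ} (hR : 0 < R) (hr : r ≤ R) (hf : Continuous f)
    (hz : ∀ x, ‖x‖ ≤ R → r ≤ ‖x‖ → f x ≠ 0) : D.deg f (ball 0 R) = D.deg f (ball 0 r) := by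
  refine deg_excise D isOpen_ball isBounded_ball isOpen_ball (ball_subset_ball hr) hf.continuousOn ?_
  intro x hx hx'
  rw [closure_ball _ hR.ne'] at hx
  exact hz x (by simpa using hx) (by simpa using hx')

theorem deg_congr_ball {R : ℝ} (hR : 0 < R) (hf : Continuous f)
    (hz : ∀ x, ‖x‖ = R → f x ≠ 0)
    (hfg : ∀ x, ‖x‖ ≤ R → f x = g x) : D.deg f (ball 0 R) = D.deg g (ball 0 R) := by
  refine deg_congr D isOpen_ball isBounded_ball hf.continuousOn ?_ ?_
  · intro x hx
    rw [frontier_ball _ hR.ne'] at hx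
    exact hz x (by simpa using hx)
  · intro x hx
    rw [closure_ball _ hR.ne'] at hx
    exact hfg x (by simpa using hx)

theorem deg_scale (hf : Continuous f) {R0 R : ℝ} (h1 : R0 < R) (hR : 1 ≤ R)
    (hz : ∀ x, f x = 0 → ‖x‖ ≤ R0) :
    D.deg f (ball 0 R) = D.deg (fun x => R • f (R • x)) (ball 0 1) := by
  have hs : ∀ t ∈ Icc (0:ℝ) 1, 1 ≤ 1 + t * (R - 1) := fun t ht => by
    have := mul_nonneg ht.1 (sub_nonneg.2 hR); linarith
  have h2 := deg_htp_ball D (h := fun t x => (1 + t * (R - 1)) • f ((1 + t * (R - 1)) • x))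
    (R := R) (by linarith) (by fun_prop) (by
      intro t ht x hx h0
      have h3 := hs t ht
      rw [smul_eq_zero_iff_right (by linarith)] at h0
      have := hz _ h0
      rw [norm_smul, Real.norm_of_nonneg (by linarith), hx] at this
      nlinarith)
  simp at h2
  rw [h2]
  refine deg_excise_ball D (by linarith) hR (by fun_prop) ?_
  intro x hx hx' h0
  rw [smul_eq_zero_iff_right (by linarith)] at h0
  have := hz _ h0
  rw [norm_smul, Real.norm_of_nonneg (by linarith)] at this
  nlinarith

/-- radial clamp to the unit ball -/
def clampB (x : Euc n) : Euc n := (max 1 ‖x‖)⁻¹ • x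

theorem clampB_cont : Continuous (clampB : Euc n → Euc n) := by
  unfold clampB
  have h : Continuous (fun x : Euc n => max 1 ‖x‖) := by fun_prop
  exact Continuous.smul (h.inv₀ fun x => by positivity) continuous_id

theorem clampB_eq {x : Euc n} (h : ‖x‖ ≤ 1) : clampB x = x := by simp [clampB, h]

theorem clampB_norm {x : Euc n} (h : 1 ≤ ‖x‖) : ‖clampB x‖ = 1 := by
  have : ‖x‖ ≠ 0 := by linarith
  simp [clampB, h, norm_smul, this]

theorem hasDeg_rho {h : Euc n → Euc n} (hh : PG h) : HasDeg D (rho h) (D.deg h (ball 0 1)) := by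
  intro M hM hzM
  have hcont := hh.1.continuous
  have hsc : Continuous (rs 1 : Euc n → ℝ) :=
    continuous_iff_continuousAt.2 fun x => (rs_hasFDerivAt zero_le_one x).continuousAt
  -- `c`
  set c : ℝ := (√(1 + M ^ 2))⁻¹ with hcdef
  have hc0 : 0 < c := by positivity
  have hc2 : c ^ 2 * (1 + M ^ 2) = 1 := by
    rw [hcdef, inv_pow, Real.sq_sqrt (by positivity), inv_mul_cancel₀ (by positivity)]
  have hc1 : c < 1 := by nlinarith [pow_pos hM 2, pow_pos hc0 2]
  have hcM : c * M < 1 := by nlinarith [mul_pos hc0 hM, pow_pos hc0 2]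
  have hrsM : ∀ x : Euc n, ‖x‖ = M → rs 1 x = c := by
    intro x hx; simp [rs, hx, hcdef]
  have hsx : ∀ x : Euc n, ‖rs 1 x • x‖ < 1 := by
    intro x
    rw [norm_smul, Real.norm_of_nonneg (rs_pos zero_le_one x).le]
    have := rs_sq zero_le_one x
    have := rs_pos zero_le_one x
    nlinarith [mul_nonneg this.le (norm_nonneg x), pow_pos this 2]
  have hrz : ∀ x : Euc n, h (rs 1 x • x) = 0 → ‖x‖ < M := by
    intro x hx
    have : rho h x = 0 := by simp [rho, RR, hx]
    simpa using hzM this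
  have hz : ∀ y : Euc n, ‖y‖ < 1 → h y = 0 → ‖y‖ < c * M := by
    intro y hy h0
    have hp : 0 < 1 - ‖y‖ ^ 2 := by nlinarith [norm_nonneg y]
    set a := (√(1 - ‖y‖ ^ 2))⁻¹ with ha
    have ha0 : 0 < a := by positivity
    have ha2 : a ^ 2 * (1 - ‖y‖ ^ 2) = 1 := by
      rw [ha, inv_pow, Real.sq_sqrt hp.le, inv_mul_cancel₀ hp.ne']
    have hna : ‖a • y‖ = a * ‖y‖ := by rw [norm_smul, Real.norm_of_nonneg ha0.le]
    have hrs : rs 1 (a • y) * a = 1 := by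
      have h1 := rs_sq zero_le_one (a • y)
      have h2 := rs_pos zero_le_one (a • y)
      rw [hna] at h1
      have : (rs 1 (a • y) * a) ^ 2 = 1 := by nlinarith
      nlinarith [mul_pos h2 ha0]
    have h3 := hrz (a • y) (by rw [smul_smul, hrs, one_smul]; exact h0)
    rw [hna] at h3
    have h4 : (a * ‖y‖) ^ 2 < M ^ 2 := by
      have : 0 ≤ a * ‖y‖ := by positivity
      nlinarith
    have h5 : ‖y‖ ^ 2 < (c * M) ^ 2 := by
      have e1 : ‖y‖ ^ 2 = (a * ‖y‖) ^ 2 * (1 - ‖y‖^2) := by nlinarith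
      have e2 : ‖y‖ ^ 2 * (1 + M ^ 2) < M ^ 2 := by nlinarith
      have e3 : c ^ 2 * (‖y‖ ^ 2 * (1 + M ^ 2)) < c ^ 2 * M ^ 2 := by gcongr
      nlinarith
    exact lt_of_pow_lt_pow_left₀ 2 (by positivity) h5
  -- the modified field
  set h' : Euc n → Euc n := fun x => h (clampB x) with hh'
  have hcont' : Continuous h' := hcont.comp clampB_cont
  have hz' : ∀ y : Euc n, c * M ≤ ‖y‖ → h' y ≠ 0 := by
    intro y hy h0
    rcases lt_or_ge ‖y‖ 1 with h1 | h1
    · rw [hh'] at h0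
      simp only [clampB_eq h1.le] at h0
      linarith [hz y h1 h0]
    · exact hh.2 _ (clampB_norm h1) h0
  have A := deg_htp_ball D (R := M) hM
    (h := fun t x => ((1 - t) * rs 1 x + t) • h (rs 1 x • x) -
      ((1 - t) * rs 1 x ^ 3 * ⟪x, h (rs 1 x • x)⟫) • x) (by fun_prop) (by
      intro t ht x hx h0
      have hs := rs_pos zero_le_one x
      have hs2 := rs_sq zero_le_one x
      have hs1 : rs 1 x < 1 := by rw [hrsM x hx]; exact hc1
      have hF : h (rs 1 x • x) ≠ 0 := fun h0 => by linarith [hrz x h0]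
      set s := rs 1 x
      set F := h (s • x)
      rw [sub_eq_zero] at h0
      have ha : s ≤ (1 - t) * s + t := by nlinarith [ht.1, ht.2]
      set a := (1 - t) * s + t
      have hI : ⟪x, F⟫ = 0 := by
        have := congrArg (fun y => ⟪x, y⟫) h0
        simp only [inner_smul_right, real_inner_self_eq_norm_sq] at this
        have h3 : ⟪x, F⟫ * (a - (1 - t) * (s ^ 3 * ‖x‖ ^ 2)) = 0 := by linear_combination this
        rcases mul_eq_zero.1 h3 with h | h
        · exact h
        · exfalso
          have : s ^ 3 * ‖x‖ ^ 2 < s := by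
            have : s ^ 3 * ‖x‖ ^ 2 = s * (1 - s ^ 2) := by linear_combination s * hs2
            rw [this]; nlinarith [pow_pos hs 2, pow_pos hs 3]
          have h5 : 0 ≤ s ^ 3 * ‖x‖ ^ 2 := by positivity
          nlinarith [ht.1, ht.2]
      rw [hI] at h0
      have : a ≠ 0 := by linarith
      simp [this] at h0
      exact hF h0)
  have hA0 : (fun x => ((1 - (0:ℝ)) * rs 1 x + 0) • h (rs 1 x • x) -
      ((1 - (0:ℝ)) * rs 1 x ^ 3 * ⟪x, h (rs 1 x • x)⟫) • x) = rho h := by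
    funext x; simp [rho, RR]
  have hA1 : (fun x => ((1 - (1:ℝ)) * rs 1 x + 1) • h (rs 1 x • x) -
      ((1 - (1:ℝ)) * rs 1 x ^ 3 * ⟪x, h (rs 1 x • x)⟫) • x) =
      fun x => h' (((1 - 0) * rs 1 x + 0 * c) • x) := by
    funext x; simp [hh', clampB_eq (hsx x).le]
  have B := deg_htp_ball D (R := M) hM
    (h := fun t x => h' (((1 - t) * rs 1 x + t * c) • x)) (by fun_prop) (by
      intro t ht x hx
      rw [hrsM x hx]
      apply hz'
      rw [← add_mul, sub_add_cancel, one_mul, norm_smul, hx, Real.norm_of_nonneg hc0.le])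
  have C := deg_htp_ball D (R := M) hM
    (h := fun t x => h' (((1 - t) * c + t) • x)) (by fun_prop) (by
      intro t ht x hx
      apply hz'
      rw [norm_smul, hx, Real.norm_of_nonneg (by nlinarith [ht.1, ht.2])]
      have : c ≤ (1 - t) * c + t := by nlinarith [ht.1, ht.2]
      gcongr)
  simp only [hA0, hA1] at A
  rw [A, B]
  simp only [sub_self, zero_mul, one_mul, zero_add, sub_zero, add_zero, one_smul] at C ⊢
  rw [C]
  have hcM0 : 0 < c * M := by positivity
  rw [deg_excise_ball D hM (by nlinarith : c * M ≤ M) hcont' (fun x _ hx => hz' x hx),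
    deg_excise_ball D one_pos hcM.le hcont (fun x hx1 hx h0 => by
      rcases hx1.lt_or_eq with h1 | h1
      · linarith [hz x h1 h0]
      · exact hh.2 x h1 h0)]
  refine deg_congr_ball D hcM0 hcont' (fun x hx => hz' x hx.ge) fun x hx => ?_
  simp [hh', clampB_eq (by linarith : ‖x‖ ≤ 1)]

theorem deg_PG (h : Htp PG f g) : D.deg f (ball 0 1) = D.deg g (ball 0 1) := by
  obtain ⟨h, hc, hP, rfl, rfl⟩ := h
  exact deg_htp_ball D one_pos hc fun t _ => (hP t).2
end deg
end GH

namespace GH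
open scoped RealInnerProductSpace Topology

section chart
variable {m : ℕ}

/-- forget the last coordinate -/
def pr : Euc (m + 1) →L[ℝ] Euc m :=
  LinearMap.toContinuousLinearMap
    { toFun := fun x => WithLp.toLp 2 (fun i => x (Fin.castSucc i))
      map_add' := fun x y => by ext i; simp
      map_smul' := fun c x => by ext i; simp }

/-- embed as a hyperplane -/
def em : Euc m →L[ℝ] Euc (m + 1) :=
  LinearMap.toContinuousLinearMap
    { toFun := fun y => WithLp.toLp 2 (Fin.snoc (α := fun _ => ℝ) (fun i => y i) 0)
      map_add' := fun x y => by
        ext i; refine Fin.lastCases ?_ (fun j => ?_) i <;> simp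
      map_smul' := fun c x => by
        ext i; refine Fin.lastCases ?_ (fun j => ?_) i <;> simp }

/-- last coordinate -/
def ht : Euc (m + 1) →L[ℝ] ℝ := EuclideanSpace.proj (Fin.last m)

/-- last basis vector -/
def ee : Euc (m + 1) := EuclideanSpace.single (Fin.last m) 1

@[simp] theorem pr_apply (x : Euc (m + 1)) (i : Fin m) : pr x i = x (Fin.castSucc i) := rfl
@[simp] theorem em_castSucc (y : Euc m) (i : Fin m) : em y (Fin.castSucc i) = y i := by
  simp [em]
@[simp] theorem em_last (y : Euc m) : em y (Fin.last m) = 0 := by simp [em]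
theorem ht_apply (x : Euc (m + 1)) : ht x = x (Fin.last m) := rfl
@[simp] theorem ht_em (y : Euc m) : ht (em y) = 0 := by simp [ht_apply]
@[simp] theorem pr_em (y : Euc m) : pr (em y) = y := by ext i; simp
@[simp] theorem ht_ee : ht (ee : Euc (m + 1)) = 1 := by simp [ht_apply, ee]
@[simp] theorem pr_ee : pr (ee : Euc (m + 1)) = 0 := by
  ext i; simp [ee, Fin.castSucc_ne_last]

theorem inner_em (y : Euc m) (x : Euc (m + 1)) : ⟪em y, x⟫ = ⟪y, pr x⟫ := by
  simp [PiLp.inner_apply, Fin.sum_univ_castSucc]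

theorem inner_ee (x : Euc (m + 1)) : ⟪ee, x⟫ = ht x := by
  simp [ee, ht_apply, EuclideanSpace.inner_single_left]

theorem decomp (x : Euc (m + 1)) : x = em (pr x) + ht x • ee := by
  ext i
  refine Fin.lastCases ?_ (fun j => ?_) i
  · simp [ee, ht_apply]
  · simp [ee, Fin.castSucc_ne_last]

theorem norm_decomp (x : Euc (m + 1)) : ‖x‖ ^ 2 = ‖pr x‖ ^ 2 + ht x ^ 2 := by
  rw [EuclideanSpace.norm_sq_eq, EuclideanSpace.norm_sq_eq, Fin.sum_univ_castSucc]
  simp [ht_apply]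

@[simp] theorem norm_ee : ‖(ee : Euc (m + 1))‖ = 1 := by simp [ee]
@[simp] theorem norm_em (y : Euc m) : ‖em y‖ = ‖y‖ := by
  have := norm_decomp (em y)
  simp at this
  exact this

theorem ht_le (x : Euc (m + 1)) : ht x ≤ ‖x‖ := by
  have := norm_decomp x
  nlinarith [norm_nonneg x, sq_nonneg ‖pr x‖]

/-- stereographic projection (0-homogeneous) -/
def st (x : Euc (m + 1)) : Euc m := (‖x‖ - ht x)⁻¹ • pr x

/-- inverse stereographic projection -/
def sg (y : Euc m) : Euc (m + 1) := (‖y‖ ^ 2 + 1)⁻¹ • ((2:ℝ) • em y + (‖y‖ ^ 2 - 1) • ee)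

theorem st_norm {x : Euc (m + 1)} (hx : ht x < ‖x‖) : ‖st x‖ ^ 2 * (‖x‖ - ht x) = ‖x‖ + ht x := by
  have h := norm_decomp x
  have h0 : ‖x‖ - ht x ≠ 0 := by linarith
  rw [st, norm_smul, mul_pow, norm_inv, inv_pow, Real.norm_eq_abs, sq_abs]
  field_simp
  linear_combination -h

theorem ht_sg (y : Euc m) : ht (sg y) = (‖y‖ ^ 2 - 1) / (‖y‖ ^ 2 + 1) := by
  simp [sg]; ring

theorem pr_sg (y : Euc m) : pr (sg y) = (2 / (‖y‖ ^ 2 + 1)) • y := by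
  simp [sg, smul_smul]; ring_nf

theorem norm_sg (y : Euc m) : ‖sg y‖ = 1 := by
  have h := norm_decomp (sg y)
  rw [ht_sg, pr_sg, norm_smul, Real.norm_of_nonneg (by positivity)] at h
  have h2 : ‖sg y‖ ^ 2 = 1 := by
    rw [h]; field_simp; ring
  nlinarith [norm_nonneg (sg y)]

theorem sg_U (y : Euc m) : ht (sg y) < ‖sg y‖ := by
  rw [norm_sg, ht_sg, div_lt_one (by positivity)]; linarith

theorem st_sg (y : Euc m) : st (sg y) = y := by
  have : (1 - (‖y‖ ^ 2 - 1) / (‖y‖ ^ 2 + 1))⁻¹ * (2 / (‖y‖ ^ 2 + 1)) = 1 := by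
    have h : ‖y‖ ^ 2 + 1 ≠ 0 := by positivity
    rw [one_sub_div h, show ‖y‖ ^ 2 + 1 - (‖y‖ ^ 2 - 1) = 2 by ring]
    field_simp
  rw [st, norm_sg, ht_sg, pr_sg, smul_smul, this, one_smul]

theorem sg_st {x : Euc (m + 1)} (hx : ht x < ‖x‖) : sg (st x) = ‖x‖⁻¹ • x := by
  have h1 := st_norm hx
  have hd : ‖x‖ - ht x ≠ 0 := by linarith
  have h0 : 0 < ‖x‖ := by
    rcases (norm_nonneg x).eq_or_lt with h | h
    · rw [norm_eq_zero.1 h.symm] at hx; simp at hx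
    · exact h
  have h2 : ‖st x‖ ^ 2 = (‖x‖ + ht x) / (‖x‖ - ht x) := by rw [eq_div_iff hd]; exact h1
  have h3 : ‖st x‖ ^ 2 + 1 = 2 * ‖x‖ / (‖x‖ - ht x) := by rw [h2]; field_simp; ring
  have h4 : ‖st x‖ ^ 2 - 1 = 2 * ht x / (‖x‖ - ht x) := by rw [h2]; field_simp; ring
  have h5 : ‖x‖⁻¹ • x = ‖x‖⁻¹ • em (pr x) + (‖x‖⁻¹ * ht x) • (ee : Euc (m + 1)) := by
    rw [mul_smul, ← smul_add, ← decomp]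
  rw [sg, h3, h4, h5, st, map_smul, smul_add, smul_smul, smul_smul, smul_smul]
  have hx0 := h0.ne'
  congr 2 <;> field_simp

/-- transpose of the derivative of `st` -/
def AA (x : Euc (m + 1)) (p : Euc m) : Euc (m + 1) :=
  (‖x‖ - ht x)⁻¹ • em p - (((‖x‖ - ht x)⁻¹) ^ 2 * ⟪pr x, p⟫) • (‖x‖⁻¹ • x - ee)

theorem U_ne {x : Euc (m + 1)} (hx : ht x < ‖x‖) : x ≠ 0 := by
  rintro rfl; simp at hx

theorem isOpen_U : IsOpen {x : Euc (m + 1) | ht x < ‖x‖} :=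
  isOpen_lt (by fun_prop) (by fun_prop)

theorem st_contDiffAt {x : Euc (m + 1)} (hx : ht x < ‖x‖) {k : ℕ∞} : ContDiffAt ℝ k st x := by
  have h0 := U_ne hx
  unfold st
  have h1 : ContDiffAt ℝ k (fun x : Euc (m + 1) => ‖x‖ - ht x) x :=
    (contDiffAt_norm ℝ h0).sub ht.contDiff.contDiffAt
  have hd : ‖x‖ - ht x ≠ 0 := by linarith
  exact ContDiffAt.smul (h1.inv hd) pr.contDiff.contDiffAt

theorem st_hasFDerivAt {x : Euc (m + 1)} (hx : ht x < ‖x‖) :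
    HasFDerivAt st ((‖x‖ - ht x)⁻¹ • (pr : Euc (m+1) →L[ℝ] Euc m) +
      ((-((‖x‖ - ht x)⁻¹) ^ 2) • (‖x‖⁻¹ • innerSL ℝ x - ht)).smulRight (pr x)) x := by
  have h0 := U_ne hx
  have hn : HasFDerivAt (fun x : Euc (m + 1) => ‖x‖) (‖x‖⁻¹ • innerSL ℝ x) x := by
    have h1 := (hasStrictFDerivAt_norm_sq x).hasFDerivAt.sqrt (by positivity)
    have h2 : (fun y : Euc (m + 1) => √(‖y‖ ^ 2)) = fun y => ‖y‖ := by
      funext y; exact Real.sqrt_sq (norm_nonneg y)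
    rw [h2] at h1
    refine h1.congr_fderiv ?_
    ext v
    simp
    field_simp
  have h1 := (hasDerivAt_inv (x := ‖x‖ - ht x) (by linarith)).comp_hasFDerivAt x (hn.sub ht.hasFDerivAt)
  have h2 := h1.smul pr.hasFDerivAt
  refine h2.congr_fderiv ?_
  ext v
  simp

theorem comp_st_gradient {x : Euc (m + 1)} (hx : ht x < ‖x‖) {g : Euc m → ℝ} {p : Euc m}
    (hg : HasGradientAt g p (st x)) : HasGradientAt (fun x => g (st x)) (AA x p) x := by
  have h := hg.hasFDerivAt.comp x (st_hasFDerivAt hx)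
  rw [hasGradientAt_iff_hasFDerivAt]
  refine h.congr_fderiv ?_
  ext v
  simp only [AA, map_add, map_sub, map_smul, ContinuousLinearMap.comp_apply,
    ContinuousLinearMap.add_apply, ContinuousLinearMap.sub_apply, ContinuousLinearMap.smul_apply,
    ContinuousLinearMap.smulRight_apply, InnerProductSpace.toDual_apply_apply, innerSL_apply_apply,
    inner_em, inner_ee, smul_eq_mul, real_inner_comm p]
  ring

theorem inner_AA {x : Euc (m + 1)} (hx : ht x < ‖x‖) (p : Euc m) : ⟪AA x p, x⟫ = 0 := by
  have h0 : ‖x‖ ≠ 0 := by simpa using U_ne hx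
  have hd : ‖x‖ - ht x ≠ 0 := by linarith
  rw [AA, inner_sub_left, inner_smul_left, inner_smul_left, inner_sub_left, inner_smul_left, inner_em,
    inner_ee, real_inner_self_eq_norm_sq, real_inner_comm p]
  simp
  field_simp
  ring

theorem AA_inj {x : Euc (m + 1)} (hx : ht x < ‖x‖) {p : Euc m} (h : AA x p = 0) : p = 0 := by
  have h0 : ‖x‖ ≠ 0 := by simpa using U_ne hx
  have hd : ‖x‖ - ht x ≠ 0 := by linarith
  have h1 := congrArg ht h
  have h2 := congrArg pr h
  simp [AA] at h1 h2
  have h3 : ⟪pr x, p⟫ = 0 := by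
    rcases h1 with (h1 | h1) | h1
    · exact absurd h1 hd
    · exact h1
    · exfalso; field_simp at h1; exact hd (by linarith)
  rw [h3] at h2
  simpa [hd] using h2

theorem AA_zero (x : Euc (m + 1)) : AA x (0 : Euc m) = 0 := by simp [AA]

theorem AA_contOn : ContinuousOn (fun z : Euc (m + 1) × Euc m => AA z.1 z.2) {z | ht z.1 < ‖z.1‖} := by
  have h1 : ContinuousOn (fun z : Euc (m + 1) × Euc m => (‖z.1‖ - ht z.1)⁻¹) {z | ht z.1 < ‖z.1‖} :=
    ContinuousOn.inv₀ (by fun_prop) fun z hz => by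
      have : ht z.1 < ‖z.1‖ := hz
      linarith
  have h2 : ContinuousOn (fun z : Euc (m + 1) × Euc m => ‖z.1‖⁻¹) {z | ht z.1 < ‖z.1‖} :=
    ContinuousOn.inv₀ (by fun_prop) fun z hz => by simpa using U_ne hz
  unfold AA
  have h3 : ContinuousOn (fun z : Euc (m + 1) × Euc m => ⟪pr z.1, z.2⟫) {z | ht z.1 < ‖z.1‖} := by
    fun_prop
  fun_prop

/-- the field on the sphere attached to formal data in the chart -/
def YY (v : Euc m → Euc m × ℝ) (x : Euc (m + 1)) : Euc (m + 1) :=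
  if ht x < ‖x‖ then AA x (v (st x)).1 + (v (st x)).2 • x else x

/-- formal data: nonvanishing, trivial far away -/
def PF (R : ℝ) (v : Euc m → Euc m × ℝ) : Prop :=
  Continuous v ∧ (∀ y, v y ≠ 0) ∧ ∀ y, R ≤ ‖y‖ → v y = (0, 1)

theorem YY_ne {v : Euc m → Euc m × ℝ} (hv : ∀ y, v y ≠ 0) {x : Euc (m + 1)} (hx : x ≠ 0) :
    YY v x ≠ 0 := by
  unfold YY
  split_ifs with h
  · intro h0
    have h1 := congrArg (fun y => ⟪y, x⟫) h0
    simp only [inner_add_left, inner_AA h, inner_smul_left, real_inner_self_eq_norm_sq,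
      inner_zero_left] at h1
    have h2 : (v (st x)).2 = 0 := by simpa [hx] using h1
    rw [h2, zero_smul, add_zero] at h0
    exact hv (st x) (Prod.ext (AA_inj h h0) h2)
  · exact hx

theorem YY_far {v : Euc m → Euc m × ℝ} {R : ℝ} (hv : ∀ y, R ≤ ‖y‖ → v y = (0, 1))
    {x : Euc (m + 1)} (hx : R ^ 2 * (‖x‖ - ht x) < ‖x‖ + ht x) : YY v x = x := by
  unfold YY
  split_ifs with h
  · have h1 := st_norm h
    have h2 : R ^ 2 < ‖st x‖ ^ 2 := by
      rw [← h1] at hx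
      exact lt_of_mul_lt_mul_right hx (by linarith)
    have h3 : R ≤ ‖st x‖ := by
      by_contra h4
      push Not at h4
      have := norm_nonneg (st x)
      nlinarith
    rw [hv _ h3]
    simp [AA_zero]
  · rfl

theorem isOpen_V (R : ℝ) : IsOpen {x : Euc (m + 1) | R ^ 2 * (‖x‖ - ht x) < ‖x‖ + ht x} :=
  isOpen_lt (by fun_prop) (by fun_prop)

theorem cover {x : Euc (m + 1)} (hx : x ≠ 0) (hU : ¬ ht x < ‖x‖) (R : ℝ) :
    R ^ 2 * (‖x‖ - ht x) < ‖x‖ + ht x := by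
  have h1 : ht x = ‖x‖ := le_antisymm (ht_le x) (not_lt.1 hU)
  have : 0 < ‖x‖ := by positivity
  rw [h1, sub_self, mul_zero]; linarith

theorem YY_contAt {X : Type*} [TopologicalSpace X] {v : X → Euc m → Euc m × ℝ} {R : ℝ}
    (hc : Continuous (fun z : X × Euc m => v z.1 z.2)) (hv : ∀ t y, R ≤ ‖y‖ → v t y = (0, 1))
    (t : X) {x : Euc (m + 1)} (hx : x ≠ 0) :
    ContinuousAt (fun z : X × Euc (m + 1) => YY (v z.1) z.2) (t, x) := by
  by_cases hU : ht x < ‖x‖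
  · have hev : ∀ᶠ z : X × Euc (m + 1) in 𝓝 (t, x), ht z.2 < ‖z.2‖ :=
      (isOpen_U.preimage continuous_snd).mem_nhds hU
    have hst : ContinuousAt (fun z : X × Euc (m + 1) => st z.2) (t, x) :=
      ContinuousAt.comp (g := st) (x := (t, x)) (f := fun z : X × Euc (m + 1) => z.2)
        (st_contDiffAt hU (k := 0)).continuousAt continuous_snd.continuousAt
    have hvc : ContinuousAt (fun z : X × Euc (m + 1) => v z.1 (st z.2)) (t, x) :=
      ContinuousAt.comp (f := fun z : X × Euc (m + 1) => (z.1, st z.2)) hc.continuousAt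
        (continuous_fst.continuousAt.prodMk hst)
    have hA : ContinuousAt (fun z : X × Euc (m + 1) => AA z.2 (v z.1 (st z.2)).1) (t, x) := by
      have h1 := (AA_contOn (m := m)).continuousAt (x := (x, (v t (st x)).1))
        ((isOpen_U.preimage continuous_fst).mem_nhds hU)
      exact ContinuousAt.comp (f := fun z : X × Euc (m + 1) => (z.2, (v z.1 (st z.2)).1)) h1
        (continuous_snd.continuousAt.prodMk hvc.fst)
    refine (hA.add (hvc.snd.smul continuous_snd.continuousAt)).congr ?_
    filter_upwards [hev] with z hz
    simp [YY, hz]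
  · have hV := cover hx hU R
    have hev : ∀ᶠ z : X × Euc (m + 1) in 𝓝 (t, x), R ^ 2 * (‖z.2‖ - ht z.2) < ‖z.2‖ + ht z.2 :=
      ((isOpen_V R).preimage continuous_snd).mem_nhds hV
    refine (continuous_snd.continuousAt (x := (t, x))).congr ?_
    filter_upwards [hev] with z hz
    exact (YY_far (hv _) hz).symm

end chart
end GH

namespace GH
open scoped RealInnerProductSpace Topology

section pull
variable {m : ℕ}

theorem slice_contDiff {n : ℕ} {Φ : ℝ × Euc n → ℝ} (h : ContDiff ℝ 1 Φ) (t : ℝ) :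
    ContDiff ℝ 1 (fun x => Φ (t, x)) :=
  h.comp (contDiff_const.prodMk contDiff_id)

theorem slice_gradient_cont {n : ℕ} {Φ : ℝ × Euc n → ℝ} (h : ContDiff ℝ 1 Φ) :
    Continuous (fun z : ℝ × Euc n => gradient (fun x => Φ (z.1, x)) z.2) := by
  have h1 : ∀ z : ℝ × Euc n, fderiv ℝ (fun x => Φ (z.1, x)) z.2 =
      (fderiv ℝ Φ z).comp (ContinuousLinearMap.inr ℝ ℝ (Euc n)) := by
    rintro ⟨t, x⟩
    have h2 := (h.differentiable (by simp) (t, x)).hasFDerivAt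
    exact (h2.comp x (hasFDerivAt_prodMk_right t x)).fderiv
  unfold gradient
  simp only [h1]
  refine (LinearIsometryEquiv.continuous _).comp ?_
  have := h.continuous_fderiv (by simp)
  fun_prop

/-- cutoff at the origin -/
def eta (x : Euc (m + 1)) : ℝ := Real.smoothTransition (4 * ‖x‖ ^ 2 - 1)

theorem eta_contDiff : ContDiff ℝ 1 (eta : Euc (m + 1) → ℝ) :=
  Real.smoothTransition.contDiff.comp
    ((contDiff_const.mul (contDiff_norm_sq ℝ)).sub contDiff_const)

theorem eta_zero {x : Euc (m + 1)} (h : 4 * ‖x‖ ^ 2 < 1) : eta x = 0 :=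
  Real.smoothTransition.zero_of_nonpos (by linarith)

theorem eta_one {x : Euc (m + 1)} (h : 1 ≤ 2 * ‖x‖ ^ 2) : eta x = 1 :=
  Real.smoothTransition.one_of_one_le (by linarith)

/-- pull back a function on the chart -/
def pb (G : ℝ × Euc m → ℝ) (z : ℝ × Euc (m + 1)) : ℝ :=
  if ht z.2 < ‖z.2‖ then eta z.2 * G (z.1, st z.2) else 0

theorem pb_far {G : ℝ × Euc m → ℝ} {R : ℝ} (hG : ∀ t y, R ≤ ‖y‖ → G (t, y) = 0)
    {t : ℝ} {x : Euc (m + 1)} (hx : R ^ 2 * (‖x‖ - ht x) < ‖x‖ + ht x) : pb G (t, x) = 0 := by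
  unfold pb
  split_ifs with h
  · have h1 := st_norm h
    have h2 : R ^ 2 < ‖st x‖ ^ 2 := by
      rw [← h1] at hx
      exact lt_of_mul_lt_mul_right hx (by linarith)
    have h3 : R ≤ ‖st x‖ := by
      by_contra h4
      push Not at h4
      have := norm_nonneg (st x)
      nlinarith
    rw [hG _ _ h3, mul_zero]
  · rfl

theorem pb_contDiff {G : ℝ × Euc m → ℝ} {R : ℝ} (hc : ContDiff ℝ 1 G)
    (hG : ∀ t y, R ≤ ‖y‖ → G (t, y) = 0) : ContDiff ℝ 1 (pb G) := by
  rw [contDiff_iff_contDiffAt]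
  rintro ⟨t, x⟩
  by_cases h0 : 4 * ‖x‖ ^ 2 < 1
  · have hev : ∀ᶠ z : ℝ × Euc (m + 1) in 𝓝 (t, x), 4 * ‖z.2‖ ^ 2 < 1 :=
      (isOpen_lt (by fun_prop) (by fun_prop)).mem_nhds h0
    refine (contDiffAt_const (c := (0:ℝ))).congr_of_eventuallyEq ?_
    filter_upwards [hev] with z hz
    simp [pb, eta_zero hz]
  by_cases hU : ht x < ‖x‖
  · have hev : ∀ᶠ z : ℝ × Euc (m + 1) in 𝓝 (t, x), ht z.2 < ‖z.2‖ :=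
      (isOpen_U.preimage continuous_snd).mem_nhds hU
    have hst : ContDiffAt ℝ 1 (fun z : ℝ × Euc (m + 1) => st z.2) (t, x) :=
      ContDiffAt.comp (g := st) (t, x) (f := fun z : ℝ × Euc (m + 1) => z.2)
        (st_contDiffAt hU (k := 1)) contDiffAt_snd
    have h1 : ContDiffAt ℝ 1 (fun z : ℝ × Euc (m + 1) => eta z.2 * G (z.1, st z.2)) (t, x) := by
      refine ContDiffAt.mul (eta_contDiff.contDiffAt.comp (t, x) contDiffAt_snd) ?_
      exact ContDiffAt.comp (t, x) (g := G) (f := fun z : ℝ × Euc (m + 1) => (z.1, st z.2))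
        hc.contDiffAt (contDiffAt_fst.prodMk hst)
    refine h1.congr_of_eventuallyEq ?_
    filter_upwards [hev] with z hz
    simp [pb, hz]
  · have hx : x ≠ 0 := by
      rintro rfl; simp at h0
    have hV := cover hx hU R
    have hev : ∀ᶠ z : ℝ × Euc (m + 1) in 𝓝 (t, x), R ^ 2 * (‖z.2‖ - ht z.2) < ‖z.2‖ + ht z.2 :=
      ((isOpen_V R).preimage continuous_snd).mem_nhds hV
    refine (contDiffAt_const (c := (0:ℝ))).congr_of_eventuallyEq ?_
    filter_upwards [hev] with z hz
    exact pb_far hG (t := z.1) hz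

theorem pb_gradient {G : ℝ × Euc m → ℝ} {R : ℝ} (hc : ContDiff ℝ 1 G)
    (hG : ∀ t y, R ≤ ‖y‖ → G (t, y) = 0) (t : ℝ) {x : Euc (m + 1)} (hx : ‖x‖ = 1) :
    HasGradientAt (fun x => pb G (t, x))
      (if ht x < ‖x‖ then AA x (gradient (fun y => G (t, y)) (st x)) else 0) x := by
  by_cases hU : ht x < ‖x‖
  · rw [if_pos hU]
    have h1 : HasGradientAt (fun y => G (t, y)) (gradient (fun y => G (t, y)) (st x)) (st x) :=
      ((slice_contDiff hc t).differentiable (by simp) _).hasGradientAt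
    refine (comp_st_gradient hU h1).congr_of_eventuallyEq ?_
    have e1 : ∀ᶠ z : Euc (m + 1) in 𝓝 x, ht z < ‖z‖ := isOpen_U.mem_nhds hU
    have e2 : ∀ᶠ z : Euc (m + 1) in 𝓝 x, 1 < 2 * ‖z‖ ^ 2 :=
      (isOpen_lt (by fun_prop) (by fun_prop)).mem_nhds (by simp [hx])
    filter_upwards [e1, e2] with z h1 h2
    simp [pb, h1, eta_one h2.le]
  · rw [if_neg hU]
    have hV := cover (by rintro rfl; simp at hx) hU R
    have hev : ∀ᶠ z : Euc (m + 1) in 𝓝 x, R ^ 2 * (‖z‖ - ht z) < ‖z‖ + ht z :=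
      (isOpen_V R).mem_nhds hV
    have h0 : HasGradientAt (fun _ : Euc (m + 1) => (0:ℝ)) 0 x := hasGradientAt_const x 0
    refine h0.congr_of_eventuallyEq ?_
    filter_upwards [hev] with z hz
    exact pb_far hG (t := t) hz

theorem pb_one {G : ℝ × Euc m → ℝ} (t : ℝ) {x : Euc (m + 1)} (hx : ‖x‖ = 1) :
    pb G (t, x) = if ht x < ‖x‖ then G (t, st x) else 0 := by
  simp [pb, eta_one (by rw [hx]; norm_num : 1 ≤ 2 * ‖x‖ ^ 2)]

/-- genuine data gives gradient fields -/
theorem exists_field {u w : ℝ × Euc m → ℝ} {R : ℝ} (hu : ContDiff ℝ 1 u) (hw : ContDiff ℝ 1 w)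
    (hu0 : ∀ t y, R ≤ ‖y‖ → u (t, y) = 0) (hw1 : ∀ t y, R ≤ ‖y‖ → w (t, y) = 1) :
    ∃ F : ℝ → Euc (m + 1) → Euc (m + 1), Continuous (fun z : ℝ × Euc (m + 1) => F z.1 z.2) ∧
      (∀ t, IsGradient (F t)) ∧ ∀ t x, ‖x‖ = 1 →
        F t x = YY (fun y => (gradient (fun y => u (t, y)) y, w (t, y))) x := by
  have hw' : ContDiff ℝ 1 (fun z => w z - 1) := hw.sub contDiff_const
  have hw0 : ∀ t y, R ≤ ‖y‖ → (fun z => w z - 1) (t, y) = 0 := fun t y h => by simp [hw1 t y h]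
  set N : Euc (m + 1) → ℝ := fun x => (‖x‖ ^ 2 - 1) / 2 with hN
  have hNc : ContDiff ℝ 1 N := ((contDiff_norm_sq ℝ).sub contDiff_const).div_const _
  have hNg : ∀ x, HasFDerivAt N (innerSL ℝ x) x := fun x => by
    have := ((hasStrictFDerivAt_norm_sq x).hasFDerivAt.sub_const 1).mul_const (2:ℝ)⁻¹
    refine (this.congr_fderiv ?_)
    ext v; simp
  set Φ : ℝ × Euc (m + 1) → ℝ := fun z => pb u z + N z.2 * pb (fun z => w z - 1) z + N z.2 with hΦ
  have hΦc : ContDiff ℝ 1 Φ := by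
    have hN2 : ContDiff ℝ 1 (fun z : ℝ × Euc (m + 1) => N z.2) := hNc.comp contDiff_snd
    exact ((pb_contDiff hu hu0).add (hN2.mul (pb_contDiff hw' hw0))).add hN2
  refine ⟨fun t => gradient (fun x => Φ (t, x)), slice_gradient_cont hΦc,
    fun t => isGradient_of_contDiff (slice_contDiff hΦc t), fun t x hx => ?_⟩
  have h1 := (pb_gradient hu hu0 t hx).hasFDerivAt
  have h2 := (pb_gradient hw' hw0 t hx).hasFDerivAt
  have hN0 : N x = 0 := by simp [hN, hx]
  have h3 := (h1.add ((hNg x).mul h2)).add (hNg x)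
  apply HasGradientAt.gradient
  rw [hasGradientAt_iff_hasFDerivAt]
  refine h3.congr_fderiv ?_
  ext v
  simp only [hN0, pb_one t hx, YY]
  split_ifs with hU <;> simp [AA, add_smul]
  ring

theorem YY_of_far {v : Euc m → Euc m × ℝ} {R : ℝ} (hv : PF R v) {x : Euc (m + 1)} (hx : ‖x‖ = 1) :
    YY v x ≠ 0 := YY_ne hv.2.1 (by rintro rfl; simp at hx)

end pull
end GH

namespace GH
open scoped RealInnerProductSpace Topology

section CI
variable {m : ℕ}

/-- spatial partial derivative -/
def dj (i : Fin m) (f : ℝ × Euc m → ℝ) (z : ℝ × Euc m) : ℝ :=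
  fderiv ℝ f z (0, EuclideanSpace.single i 1)

theorem dj_cont (i : Fin m) {f : ℝ × Euc m → ℝ} (hf : ContDiff ℝ 1 f) : Continuous (dj i f) := by
  unfold dj
  have := hf.continuous_fderiv (by simp)
  fun_prop

theorem gradient_apply (i : Fin m) {f : ℝ × Euc m → ℝ} (hf : ContDiff ℝ 1 f) (t : ℝ) (y : Euc m) :
    gradient (fun y => f (t, y)) y i = dj i f (t, y) := by
  have h2 := (hf.differentiable (by simp) (t, y)).hasFDerivAt
  have h3 := (h2.comp y (hasFDerivAt_prodMk_right t y)).fderiv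
  have h4 : ⟪gradient (fun y => f (t, y)) y, EuclideanSpace.single i (1:ℝ)⟫ =
      fderiv ℝ (fun y => f (t, y)) y (EuclideanSpace.single i 1) := by
    rw [gradient, InnerProductSpace.toDual_symm_apply]
  rw [EuclideanSpace.inner_single_right] at h4
  simp at h4
  rw [h4, dj]
  change fderiv ℝ (f ∘ fun y => (t, y)) y _ = _
  rw [h3]
  simp

theorem dj_bound (i : Fin m) {f : ℝ × Euc m → ℝ} {R : ℝ} (hf : ContDiff ℝ 1 f)
    (h0 : ∀ t y, R ≤ ‖y‖ → f (t, y) = 0) :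
    ∃ C, 0 ≤ C ∧ ∀ z : ℝ × Euc m, z.1 ∈ Icc (0:ℝ) 1 → |dj i f z| ≤ C := by
  have hK : IsCompact (Icc (0:ℝ) 1 ×ˢ closedBall (0 : Euc m) R) :=
    isCompact_Icc.prod (isCompact_closedBall _ _)
  obtain ⟨C, hC⟩ := hK.exists_bound_of_continuousOn (dj_cont i hf).continuousOn
  refine ⟨max C 0, le_max_right _ _, ?_⟩
  rintro ⟨t, y⟩ hz
  by_cases hy : ‖y‖ ≤ R
  · exact (hC (t, y) ⟨hz, by simpa using hy⟩).trans (le_max_left _ _)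
  · push Not at hy
    have hev : ∀ᶠ z : ℝ × Euc m in 𝓝 (t, y), R < ‖z.2‖ :=
      (isOpen_lt (by fun_prop) (by fun_prop)).mem_nhds hy
    have h1 : f =ᶠ[𝓝 (t, y)] fun _ => 0 := by
      filter_upwards [hev] with z hz
      exact h0 z.1 z.2 hz.le
    have : dj i f (t, y) = 0 := by
      rw [dj, h1.fderiv_eq]; simp
    rw [this]; simp

theorem coord_hasFDerivAt (j : Fin m) (z : ℝ × Euc m) (N : ℝ) :
    HasFDerivAt (fun z : ℝ × Euc m => N * z.2 j)
      (N • (EuclideanSpace.proj j : Euc m →L[ℝ] ℝ).comp (ContinuousLinearMap.snd ℝ ℝ (Euc m))) z :=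
  ((EuclideanSpace.proj j : Euc m →L[ℝ] ℝ).comp
    (ContinuousLinearMap.snd ℝ ℝ (Euc m))).hasFDerivAt.const_mul N

theorem coord_contDiff (j : Fin m) (N : ℝ) : ContDiff ℝ 1 (fun z : ℝ × Euc m => N * z.2 j) :=
  contDiff_const.mul ((EuclideanSpace.proj j : Euc m →L[ℝ] ℝ).contDiff.comp contDiff_snd)

/-- derivative of the corrugation -/
theorem corr_deriv {u f g : ℝ × Euc m → ℝ} (hu : ContDiff ℝ 1 u) (hf : ContDiff ℝ 1 f)
    (hg : ContDiff ℝ 1 g) {N : ℝ} (hN : N ≠ 0) (i j : Fin m) (z : ℝ × Euc m) :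
    dj i (fun z => u z + N⁻¹ * (f z * Real.sin (2 * N * z.2 j) - g z * Real.cos (N * z.2 j))) z =
      dj i u z + N⁻¹ * (dj i f z * Real.sin (2 * N * z.2 j) - dj i g z * Real.cos (N * z.2 j)) +
      (if i = j then 2 * f z * Real.cos (2 * N * z.2 j) + g z * Real.sin (N * z.2 j) else 0) := by
  have h1 := (hu.differentiable (by simp) z).hasFDerivAt
  have h2 := (hf.differentiable (by simp) z).hasFDerivAt
  have h3 := (hg.differentiable (by simp) z).hasFDerivAt
  have h4 := (coord_hasFDerivAt j z (2 * N)).sin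
  have h5 := (coord_hasFDerivAt j z N).cos
  have h6 := h1.add (((h2.mul h4).sub (h3.mul h5)).const_mul N⁻¹)
  rw [dj]
  erw [h6.fderiv]
  simp only [dj, add_apply, sub_apply, smul_apply, ContinuousLinearMap.comp_apply,
    ContinuousLinearMap.coe_snd', EuclideanSpace.coe_proj, smul_eq_mul]
  by_cases hij : i = j
  · subst hij
    simp
    field_simp
    ring
  · have hji : ¬ j = i := fun h => hij h.symm
    simp [hij, hji, hN]
    ring

theorem CI_step {u q p A : ℝ × Euc m → ℝ} (hu : ContDiff ℝ 1 u) (hp : ContDiff ℝ 1 p)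
    (hq : ContDiff ℝ 1 q) (hA : ContDiff ℝ 1 A) {R : ℝ} (hAR : ∀ t y, R ≤ ‖y‖ → A (t, y) = 0)
    (hA2 : ∀ z, |A z| ≤ 3 / 2) (j : Fin m) {δ : ℝ} (hδ : 0 < δ) :
    ∃ u' p' q' : ℝ × Euc m → ℝ, ContDiff ℝ 1 u' ∧ ContDiff ℝ 1 p' ∧ ContDiff ℝ 1 q' ∧
      (∀ z, A z = 0 → u' z = u z ∧ p' z = p z ∧ q' z = q z) ∧
      (∀ i, i ≠ j → ∀ z : ℝ × Euc m, z.1 ∈ Icc (0:ℝ) 1 → |dj i u' z - dj i u z| ≤ δ) ∧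
      (∀ z : ℝ × Euc m, z.1 ∈ Icc (0:ℝ) 1 →
        |dj j u' z - p' z| ≤ |dj j u z - (1 - A z ^ 2 / 2) * p z| + δ) ∧
      (∀ z c, |p' z| < c / 6 → |q' z| < c / 6 → |p z| < c ∧ |q z| < c) := by
  set f : ℝ × Euc m → ℝ := fun z => A z ^ 2 / 4 * p z with hf
  set g : ℝ × Euc m → ℝ := fun z => A z * q z with hg
  have hfc : ContDiff ℝ 1 f := ((hA.pow 2).div_const 4).mul hp
  have hgc : ContDiff ℝ 1 g := hA.mul hq
  have hb : ∀ i : Fin m, ∃ C, 0 ≤ C ∧ ∀ z : ℝ × Euc m, z.1 ∈ Icc (0:ℝ) 1 →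
      |dj i f z| + |dj i g z| ≤ C := by
    intro i
    obtain ⟨C1, h1, hC1⟩ := dj_bound i hfc (R := R) (fun t y h => by simp [hf, hAR t y h])
    obtain ⟨C2, h2, hC2⟩ := dj_bound i hgc (R := R) (fun t y h => by simp [hg, hAR t y h])
    exact ⟨C1 + C2, by positivity, fun z hz => add_le_add (hC1 z hz) (hC2 z hz)⟩
  choose C hC0 hC using hb
  set N : ℝ := (∑ i, C i + 1) / δ with hNdef
  have hS : 0 ≤ ∑ i, C i := Finset.sum_nonneg fun i _ => hC0 i
  have hN : 0 < N := by positivity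
  have herr : ∀ i : Fin m, ∀ z : ℝ × Euc m, z.1 ∈ Icc (0:ℝ) 1 →
      |N⁻¹ * (dj i f z * Real.sin (2 * N * z.2 j) - dj i g z * Real.cos (N * z.2 j))| ≤ δ := by
    intro i z hz
    rw [abs_mul, abs_of_pos (inv_pos.2 hN), inv_mul_le_iff₀ hN]
    have h1 : N * δ = ∑ i, C i + 1 := by rw [hNdef]; field_simp
    have h2 : C i ≤ ∑ i, C i := Finset.single_le_sum (fun i _ => hC0 i) (Finset.mem_univ i)
    have h3 := hC i z hz
    have h4 : |dj i f z * Real.sin (2 * N * z.2 j)| ≤ |dj i f z| := by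
      rw [abs_mul]; exact mul_le_of_le_one_right (abs_nonneg _) (Real.abs_sin_le_one _)
    have h5 : |dj i g z * Real.cos (N * z.2 j)| ≤ |dj i g z| := by
      rw [abs_mul]; exact mul_le_of_le_one_right (abs_nonneg _) (Real.abs_cos_le_one _)
    have h6 := abs_sub (dj i f z * Real.sin (2 * N * z.2 j)) (dj i g z * Real.cos (N * z.2 j))
    linarith
  have hsin : ContDiff ℝ 1 (fun z : ℝ × Euc m => Real.sin (N * z.2 j)) := (coord_contDiff j N).sin
  have hcos : ContDiff ℝ 1 (fun z : ℝ × Euc m => Real.cos (N * z.2 j)) := (coord_contDiff j N).cos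
  have hsin2 : ContDiff ℝ 1 (fun z : ℝ × Euc m => Real.sin (2 * N * z.2 j)) :=
    (coord_contDiff j (2 * N)).sin
  refine ⟨fun z => u z + N⁻¹ * (f z * Real.sin (2 * N * z.2 j) - g z * Real.cos (N * z.2 j)),
    fun z => (1 - A z ^ 2 * Real.sin (N * z.2 j) ^ 2) * p z + A z * Real.sin (N * z.2 j) * q z,
    fun z => q z - A z * Real.sin (N * z.2 j) * p z, ?_, ?_, ?_, ?_, ?_, ?_, ?_⟩
  · exact hu.add (contDiff_const.mul ((hfc.mul hsin2).sub (hgc.mul hcos)))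
  · exact ((contDiff_const.sub ((hA.pow 2).mul (hsin.pow 2))).mul hp).add ((hA.mul hsin).mul hq)
  · exact hq.sub ((hA.mul hsin).mul hp)
  · intro z hz
    simp [hf, hg, hz]
  · intro i hij z hz
    rw [corr_deriv hu hfc hgc hN.ne', if_neg hij]
    have := herr i z hz
    convert this using 2
    ring
  · intro z hz
    rw [corr_deriv hu hfc hgc hN.ne', if_pos rfl]
    have h1 := herr j z hz
    have h2 : Real.cos (2 * N * z.2 j) = 1 - 2 * Real.sin (N * z.2 j) ^ 2 := by
      rw [mul_assoc, Real.cos_two_mul, Real.cos_sq']; ring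
    refine (le_of_eq ?_).trans ((abs_add_le _ _).trans (add_le_add_right h1 _))
    congr 1
    rw [h2]
    simp only [hf, hg]
    ring
  · intro z c h1 h2
    set s := Real.sin (N * z.2 j)
    have hs : |s| ≤ 1 := Real.abs_sin_le_one _
    have hAs : |A z * s| ≤ 3 / 2 := by
      rw [abs_mul]; nlinarith [hA2 z, abs_nonneg (A z), abs_nonneg s]
    have hc : 0 < c := by linarith [(abs_nonneg _).trans_lt h1]
    set b := A z * s with hbdef
    have e1 : (1 - A z ^ 2 * s ^ 2) * p z + b * q z = p z + b * (q z - b * p z) := by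
      rw [hbdef]; ring
    have h1' : |p z + b * (q z - b * p z)| < c / 6 := by rw [← e1]; exact h1
    set Q := q z - b * p z with hQ
    have h3 : |b * Q| ≤ 3 / 2 * (c / 6) := by
      rw [abs_mul]; exact mul_le_mul hAs h2.le (abs_nonneg _) (by norm_num)
    have h4 : |p z| < 5 / 12 * c := by
      have : p z = (p z + b * Q) - b * Q := by ring
      rw [this]
      refine (abs_sub _ _).trans_lt ?_
      linarith
    have h5 : |b * p z| ≤ 3 / 2 * (5 / 12 * c) := by
      rw [abs_mul]; exact mul_le_mul hAs h4.le (abs_nonneg _) (by norm_num)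
    refine ⟨by linarith, ?_⟩
    have : q z = Q + b * p z := by rw [hQ]; ring
    rw [this]
    refine (abs_add_le _ _).trans_lt ?_
    linarith

theorem CI_iter {u q A : ℝ × Euc m → ℝ} {p : Fin m → ℝ × Euc m → ℝ} (hu : ContDiff ℝ 1 u)
    (hp : ∀ i, ContDiff ℝ 1 (p i))
    (hq : ContDiff ℝ 1 q) (hA : ContDiff ℝ 1 A) {R : ℝ} (hAR : ∀ t y, R ≤ ‖y‖ → A (t, y) = 0)
    (hA2 : ∀ z, |A z| ≤ 3 / 2) {δ : ℝ} (hδ : 0 < δ) (k : ℕ) (hk : k ≤ m) :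
    ∃ (u' q' : ℝ × Euc m → ℝ) (p' : Fin m → ℝ × Euc m → ℝ), ContDiff ℝ 1 u' ∧
      (∀ i, ContDiff ℝ 1 (p' i)) ∧ ContDiff ℝ 1 q' ∧
      (∀ z, A z = 0 → u' z = u z ∧ (∀ i, p' i z = p i z) ∧ q' z = q z) ∧
      (∀ i : Fin m, k ≤ i → p' i = p i ∧
        ∀ z : ℝ × Euc m, z.1 ∈ Icc (0:ℝ) 1 → |dj i u' z - dj i u z| ≤ k * δ) ∧
      (∀ i : Fin m, (i : ℕ) < k → ∀ z : ℝ × Euc m, z.1 ∈ Icc (0:ℝ) 1 →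
        |dj i u' z - p' i z| ≤ |dj i u z - (1 - A z ^ 2 / 2) * p i z| + k * δ) ∧
      (∀ z c, (∀ i, |p' i z| < c / 6 ^ k) → |q' z| < c / 6 ^ k → (∀ i, |p i z| < c) ∧ |q z| < c) := by
  induction k with
  | zero =>
    refine ⟨u, q, p, hu, hp, hq, by simp, by simp, by simp, ?_⟩
    intro z c h1 h2
    simp at h1 h2
    exact ⟨h1, h2⟩
  | succ k ih =>
    obtain ⟨u1, q1, p1, hu1, hp1, hq1, h0, hge, hlt, hLB⟩ := ih (by omega)
    set j : Fin m := ⟨k, by omega⟩ with hj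
    obtain ⟨u', pj, q', hu', hpj, hq', h0', hne, hje, hLB'⟩ :=
      CI_step hu1 (hp1 j) hq1 hA hAR hA2 j hδ
    have hpj1 : p1 j = p j := (hge j (by simp [hj])).1
    refine ⟨u', q', Function.update p1 j pj, hu', ?_, hq', ?_, ?_, ?_, ?_⟩
    · intro i
      by_cases hi : i = j
      · subst hi; simpa using hpj
      · simpa [hi] using hp1 i
    · intro z hz
      obtain ⟨a1, a2, a3⟩ := h0 z hz
      obtain ⟨b1, b2, b3⟩ := h0' z hz
      refine ⟨b1.trans a1, fun i => ?_, b3.trans a3⟩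
      by_cases hi : i = j
      · subst hi; simpa using b2.trans (a2 _)
      · simpa [hi] using a2 i
    · intro i hi
      have hij : i ≠ j := by
        rintro rfl
        simp [hj] at hi
      obtain ⟨a1, a2⟩ := hge i (by omega)
      refine ⟨by simpa [hij] using a1, fun z hz => ?_⟩
      have e1 := hne i hij z hz
      have e2 := a2 z hz
      push_cast
      calc |dj i u' z - dj i u z| ≤ |dj i u' z - dj i u1 z| + |dj i u1 z - dj i u z| := abs_sub_le _ _ _
        _ ≤ _ := by linarith
    · intro i hi z hz
      push_cast
      by_cases hij : i = j
      · subst hij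
        have e1 := hje z hz
        have e2 := (hge j (by simp [hj])).2 z hz
        rw [hpj1] at e1
        simp only [Function.update_self]
        have e3 : |dj j u1 z - (1 - A z ^ 2 / 2) * p j z| ≤ |dj j u1 z - dj j u z| +
          |dj j u z - (1 - A z ^ 2 / 2) * p j z| := abs_sub_le _ _ _
        linarith
      · have hik : (i : ℕ) < k := by
          have : (i : ℕ) ≠ k := fun h => hij (Fin.ext h)
          omega
        have e1 := hne i hij z hz
        have e2 := hlt i hik z hz
        simp only [Function.update_of_ne hij]
        calc |dj i u' z - p1 i z| ≤ |dj i u' z - dj i u1 z| + |dj i u1 z - p1 i z| := abs_sub_le _ _ _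
          _ ≤ _ := by linarith
    · intro z c h1 h2
      have hpow : c / 6 ^ (k + 1) = c / 6 ^ k / 6 := by rw [pow_succ, div_div]
      rw [hpow] at h1 h2
      have e1 := h1 j
      simp only [Function.update_self] at e1
      obtain ⟨f1, f2⟩ := hLB' z (c / 6 ^ k) e1 h2
      have hc : 0 ≤ c / 6 ^ k := (abs_nonneg _).trans f1.le
      refine hLB z c (fun i => ?_) f2
      by_cases hi : i = j
      · subst hi; exact f1
      · have := h1 i
        simp only [Function.update_of_ne hi] at this
        linarith

end CI
end GH

namespace GH
open scoped RealInnerProductSpace Topology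

section CI2
variable {m : ℕ}

theorem htp_YY_linear {f g : Euc (m + 1) → Euc (m + 1)} {v v' : Euc m → Euc m × ℝ}
    (hf : IsGradient f) (hg : IsGradient g) (hfv : ∀ x, ‖x‖ = 1 → f x = YY v x)
    (hgv : ∀ x, ‖x‖ = 1 → g x = YY v' x)
    (h : ∀ t ∈ Icc (0:ℝ) 1, ∀ y, (1 - t) • v y + t • v' y ≠ 0) : Htp PG f g := by
  refine Htp.linear hf hg fun t ht x hx => ?_
  have h1 : (1 - t) • f x + t • g x = YY (fun y => (1 - t) • v y + t • v' y) x := by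
    rw [hfv x hx, hgv x hx]
    unfold YY
    split_ifs with hU
    · simp only [AA, Prod.fst_add, Prod.smul_fst, Prod.snd_add, Prod.smul_snd, map_add, map_smul,
        inner_add_right, inner_smul_right, smul_eq_mul]
      module
    · module
  rw [h1]
  exact YY_ne (h t ht) (by rintro rfl; simp at hx)

theorem exists_smooth {v : ℝ × Euc m → Euc m × ℝ} (hv : Continuous v) {R : ℝ}
    (hR : ∀ t y, R ≤ ‖y‖ → v (t, y) = (0, 1)) {ε : ℝ} (hε : 0 < ε) :
    ∃ (p : Fin m → ℝ × Euc m → ℝ) (q : ℝ × Euc m → ℝ), (∀ i, ContDiff ℝ 1 (p i)) ∧ ContDiff ℝ 1 q ∧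
      (∀ i z, |p i z - (v z).1 i| < ε) ∧ (∀ z, |q z - (v z).2| < ε) ∧
      ∀ t y, R ≤ ‖y‖ → (∀ i, p i (t, y) = 0) ∧ q (t, y) = 1 := by
  obtain ⟨g, hg, hgd, hgs⟩ := Continuous.exists_contDiff_approx (E := ℝ × Euc m) (F := Euc m × ℝ) 1
    (f := fun z => v z - (0, 1)) (ε := fun _ => ε) (by fun_prop) continuous_const (fun _ => hε)
  have h1 : ∀ z, ‖g z - (v z - (0, 1))‖ < ε := fun z => by
    have := hgd z; rwa [dist_eq_norm] at this
  have hg' : ContDiff ℝ 1 g := by exact_mod_cast hg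
  have hg1 : ContDiff ℝ 1 (fun z => (g z).1) := hg'.fst
  have hg2 : ContDiff ℝ 1 (fun z => (g z).2) := hg'.snd
  refine ⟨fun i z => (g z).1 i, fun z => (g z).2 + 1, fun i => ?_, ?_, ?_, ?_, ?_⟩
  · exact ContDiff.comp (g := (EuclideanSpace.proj i : Euc m →L[ℝ] ℝ)) (f := fun z => (g z).1)
      (ContinuousLinearMap.contDiff _) hg1
  · exact hg2.add contDiff_const
  · intro i z
    have h2 : ‖(g z).1 - (v z).1‖ < ε := by
      have h2 := (norm_fst_le (g z - (v z - (0, 1)))).trans_lt (h1 z)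
      simpa only [Prod.fst_sub, sub_zero] using h2
    have h3 := (PiLp.norm_apply_le ((g z).1 - (v z).1) i).trans_lt h2
    simpa only [PiLp.sub_apply, Real.norm_eq_abs] using h3
  · intro z
    have h2 := (norm_snd_le (g z - (v z - (0, 1)))).trans_lt (h1 z)
    simp only [Prod.snd_sub, Real.norm_eq_abs] at h2
    have h3 : (g z).2 + 1 - (v z).2 = (g z).2 - ((v z).2 - 1) := by ring
    rw [h3]; exact h2
  · intro t y hy
    have : g (t, y) = 0 := by
      by_contra h0
      exact hgs h0 (by simp [hR t y hy])
    simp [this]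

theorem exists_lower {v : ℝ × Euc m → Euc m × ℝ} (hv : Continuous v) {R : ℝ}
    (hR : ∀ t y, R ≤ ‖y‖ → v (t, y) = (0, 1)) (h0 : ∀ z, v z ≠ 0) :
    ∃ c, 0 < c ∧ ∀ z : ℝ × Euc m, z.1 ∈ Icc (0:ℝ) 1 → ¬ ((∀ i, |(v z).1 i| < c) ∧ |(v z).2| < c) := by
  have hK : IsCompact (Icc (0:ℝ) 1 ×ˢ closedBall (0 : Euc m) R) :=
    isCompact_Icc.prod (isCompact_closedBall _ _)
  have hκc : Continuous (fun z => ‖((WithLp.ofLp (v z).1 : Fin m → ℝ), (v z).2)‖) := by fun_prop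
  have hκ0 : ∀ z, 0 < ‖((WithLp.ofLp (v z).1 : Fin m → ℝ), (v z).2)‖ := by
    intro z
    rw [norm_pos_iff]
    intro h
    apply h0 z
    rw [Prod.ext_iff] at h ⊢
    refine ⟨?_, h.2⟩
    ext i
    exact congrFun h.1 i
  obtain ⟨c, hc, hcK⟩ : ∃ c, 0 < c ∧ ∀ z ∈ Icc (0:ℝ) 1 ×ˢ closedBall (0 : Euc m) R,
      c ≤ ‖((WithLp.ofLp (v z).1 : Fin m → ℝ), (v z).2)‖ := by
    rcases (Icc (0:ℝ) 1 ×ˢ closedBall (0 : Euc m) R).eq_empty_or_nonempty with he | hne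
    · exact ⟨1, one_pos, by simp [he]⟩
    · obtain ⟨z, hz, hm⟩ := hK.exists_isMinOn hne hκc.continuousOn
      exact ⟨_, hκ0 z, fun z' hz' => hm hz'⟩
  refine ⟨min c 1, lt_min hc one_pos, ?_⟩
  rintro ⟨t, y⟩ ht ⟨h1, h2⟩
  by_cases hy : R ≤ ‖y‖
  · rw [hR t y hy] at h2
    simp at h2
  · push Not at hy
    have := hcK (t, y) ⟨ht, by simpa using hy.le⟩
    rw [Prod.norm_def] at this
    rcases le_max_iff.1 this with h | h
    · have h3 : ‖(WithLp.ofLp (v (t, y)).1 : Fin m → ℝ)‖ < c := by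
        rw [pi_norm_lt_iff hc]
        intro i
        exact (h1 i).trans_le (min_le_left _ _)
      simp only at h
      linarith
    · have := h2.trans_le (min_le_left _ _)
      simp only [Real.norm_eq_abs] at h
      linarith

/-- packaged convex integration -/
theorem CI_main {u q : ℝ × Euc m → ℝ} {p : Fin m → ℝ × Euc m → ℝ} (hu : ContDiff ℝ 1 u)
    (hp : ∀ i, ContDiff ℝ 1 (p i)) (hq : ContDiff ℝ 1 q) {R : ℝ} (hR : 0 < R)
    (hu0 : ∀ t y, R ≤ ‖y‖ → u (t, y) = 0)
    (hpq : ∀ t y, R ≤ ‖y‖ → (∀ i, p i (t, y) = 0) ∧ q (t, y) = 1)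
    {b : ℝ → ℝ} (hb : ContDiff ℝ 1 b) (hb0 : ∀ t, b t ∈ Icc (0:ℝ) 1) {δ : ℝ} (hδ : 0 < δ) :
    ∃ (u' q' : ℝ × Euc m → ℝ) (p' : Fin m → ℝ × Euc m → ℝ), ContDiff ℝ 1 u' ∧
      (∀ i, ContDiff ℝ 1 (p' i)) ∧ ContDiff ℝ 1 q' ∧
      (∀ t y, R + 1 ≤ ‖y‖ → u' (t, y) = 0 ∧ (∀ i, p' i (t, y) = 0) ∧ q' (t, y) = 1) ∧
      (∀ t y, b t = 0 → u' (t, y) = u (t, y) ∧ (∀ i, p' i (t, y) = p i (t, y)) ∧ q' (t, y) = q (t, y)) ∧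
      (∀ t ∈ Icc (0:ℝ) 1, ∀ y (i : Fin m),
        |dj i u' (t, y) - p' i (t, y)| ≤ |dj i u (t, y) - (1 - b t ^ 2) * p i (t, y)| + δ) ∧
      (∀ z c, (∀ i, |p' i z| < c / 6 ^ m) → |q' z| < c / 6 ^ m → (∀ i, |p i z| < c) ∧ |q z| < c) := by
  let χ : ContDiffBump (0 : Euc m) := ⟨R, R + 1, hR, by linarith⟩
  set A : ℝ × Euc m → ℝ := fun z => √2 * b z.1 * χ z.2 with hA
  have hAc : ContDiff ℝ 1 A :=
    (contDiff_const.mul (hb.comp contDiff_fst)).mul (χ.contDiff.comp contDiff_snd)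
  have hχ0 : ∀ y, R + 1 ≤ ‖y‖ → χ y = 0 := fun y hy => χ.zero_of_le_dist (by simpa using hy)
  have hχ1 : ∀ y, ‖y‖ ≤ R → χ y = 1 := fun y hy => χ.one_of_mem_closedBall (by simpa using hy)
  have hs2 : √2 ≤ 3 / 2 := by
    rw [Real.sqrt_le_left (by norm_num)]; norm_num
  have hA0 : ∀ t y, R + 1 ≤ ‖y‖ → A (t, y) = 0 := fun t y hy => by simp [hA, hχ0 y hy]
  have hA2 : ∀ z, |A z| ≤ 3 / 2 := by
    intro z
    have h1 := hb0 z.1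
    have h2 : 0 ≤ χ z.2 := χ.nonneg
    have h3 : χ z.2 ≤ 1 := χ.le_one
    have h4 : 0 ≤ b z.1 * χ z.2 := mul_nonneg h1.1 h2
    have h5 : b z.1 * χ z.2 ≤ 1 := mul_le_one₀ h1.2 h2 h3
    have : A z = √2 * (b z.1 * χ z.2) := by simp [hA, mul_assoc]
    rw [this, abs_of_nonneg (by positivity)]
    nlinarith [Real.sqrt_nonneg 2]
  obtain ⟨u', q', p', hu', hp', hq', h0, -, hlt, hLB⟩ :=
    CI_iter hu hp hq hAc hA0 hA2 (δ := δ / (m + 1)) (by positivity) m le_rfl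
  refine ⟨u', q', p', hu', hp', hq', ?_, ?_, ?_, hLB⟩
  · intro t y hy
    obtain ⟨a1, a2, a3⟩ := h0 (t, y) (hA0 t y hy)
    obtain ⟨b2, b3⟩ := hpq t y (by linarith)
    refine ⟨a1.trans (hu0 t y (by linarith)), fun i => (a2 i).trans (b2 i), a3.trans b3⟩
  · intro t y hb
    exact h0 (t, y) (by simp [hA, hb])
  · intro t ht y i
    refine (hlt i i.2 (t, y) ht).trans (add_le_add (le_of_eq ?_) ?_)
    · congr 2
      by_cases hy : ‖y‖ ≤ R
      · simp only [hA, hχ1 y hy, mul_one, mul_pow, Real.sq_sqrt (show (0:ℝ) ≤ 2 by norm_num)]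
        ring
      · rw [(hpq t y (by linarith)).1 i]; simp
    · rw [mul_div_assoc']
      rw [div_le_iff₀ (by positivity)]
      nlinarith

/-- bundle components -/
def mkv (p : Fin m → ℝ × Euc m → ℝ) (q : ℝ × Euc m → ℝ) (t : ℝ) (y : Euc m) : Euc m × ℝ :=
  (WithLp.toLp 2 (fun i => p i (t, y)), q (t, y))

theorem mkv_cont {p : Fin m → ℝ × Euc m → ℝ} {q : ℝ × Euc m → ℝ} (hp : ∀ i, Continuous (p i))
    (hq : Continuous q) : Continuous (fun z : ℝ × Euc m => mkv p q z.1 z.2) := by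
  unfold mkv
  refine Continuous.prodMk ?_ hq
  exact (PiLp.continuous_toLp 2 _).comp (continuous_pi fun i => hp i)

theorem CI_inj {u₀ u₁ w₀ w₁ : Euc m → ℝ} {R : ℝ} (hR : 0 < R) (hu₀ : ContDiff ℝ 1 u₀)
    (hu₁ : ContDiff ℝ 1 u₁) (h₀ : ∀ y, R ≤ ‖y‖ → u₀ y = 0) (h₁ : ∀ y, R ≤ ‖y‖ → u₁ y = 0)
    (hH : Htp (PF R) (fun y => (gradient u₀ y, w₀ y)) (fun y => (gradient u₁ y, w₁ y)))
    {f₀ f₁ : Euc (m + 1) → Euc (m + 1)} (hf₀ : IsGradient f₀) (hf₁ : IsGradient f₁)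
    (hfv₀ : ∀ x, ‖x‖ = 1 → f₀ x = YY (fun y => (gradient u₀ y, w₀ y)) x)
    (hfv₁ : ∀ x, ‖x‖ = 1 → f₁ x = YY (fun y => (gradient u₁ y, w₁ y)) x) : Htp PG f₀ f₁ := by
  obtain ⟨h, hc, hP, hh0, hh1⟩ := hH
  set θ : ℝ → ℝ := fun t => max 0 (min 1 (3 * t - 1)) with hθ
  have hθ0 : ∀ t ≤ 1 / 3, θ t = 0 := fun t ht => by
    have : min 1 (3 * t - 1) ≤ 0 := (min_le_right _ _).trans (by linarith)
    simp only [hθ]; exact max_eq_left this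
  have hθ1 : ∀ t, 2 / 3 ≤ t → θ t = 1 := fun t ht => by
    have : min 1 (3 * t - 1) = 1 := min_eq_left (by linarith)
    simp [hθ, this]
  set v : ℝ × Euc m → Euc m × ℝ := fun z => h (θ z.1) z.2 with hv
  have hvc : Continuous v := hc.comp (f := fun z : ℝ × Euc m => (θ z.1, z.2)) (by fun_prop)
  have hvR : ∀ t y, R ≤ ‖y‖ → v (t, y) = (0, 1) := fun t y hy => (hP _).2.2 y hy
  have hvn : ∀ z, v z ≠ 0 := fun z => (hP _).2.1 _
  obtain ⟨c, hc0, hlow⟩ := exists_lower hvc hvR hvn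
  set ε := c / 4 / 6 ^ m with hε
  have h6 : (1:ℝ) ≤ 6 ^ m := one_le_pow₀ (by norm_num)
  have hε0 : 0 < ε := by positivity
  have hε1 : ε ≤ c / 4 := div_le_self (by positivity) h6
  obtain ⟨p, q, hp, hq, hpv, hqv, hpqR⟩ := exists_smooth hvc hvR hε0
  set b₀ : ℝ → ℝ := fun t => Real.smoothTransition (3 * t) with hb₀
  set b₁ : ℝ → ℝ := fun t => Real.smoothTransition (3 * (1 - t)) with hb₁
  have hb₀c : ContDiff ℝ 1 b₀ := Real.smoothTransition.contDiff.comp (by fun_prop)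
  have hb₁c : ContDiff ℝ 1 b₁ := Real.smoothTransition.contDiff.comp (by fun_prop)
  have hb₀1 : ∀ t, 1 / 3 ≤ t → b₀ t = 1 := fun t ht =>
    Real.smoothTransition.one_of_one_le (by linarith)
  have hb₁1 : ∀ t, t ≤ 2 / 3 → b₁ t = 1 := fun t ht =>
    Real.smoothTransition.one_of_one_le (by linarith)
  have hb₀I : ∀ t, b₀ t ∈ Icc (0:ℝ) 1 := fun t =>
    ⟨Real.smoothTransition.nonneg _, Real.smoothTransition.le_one _⟩
  have hb₁I : ∀ t, b₁ t ∈ Icc (0:ℝ) 1 := fun t =>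
    ⟨Real.smoothTransition.nonneg _, Real.smoothTransition.le_one _⟩
  set B : ℝ × Euc m → ℝ := fun z => (1 - b₀ z.1 ^ 2) * u₀ z.2 + (1 - b₁ z.1 ^ 2) * u₁ z.2 with hB
  have hBc : ContDiff ℝ 1 B :=
    ((contDiff_const.sub ((hb₀c.comp contDiff_fst).pow 2)).mul (hu₀.comp contDiff_snd)).add
      ((contDiff_const.sub ((hb₁c.comp contDiff_fst).pow 2)).mul (hu₁.comp contDiff_snd))
  have hBd : ∀ t y i, dj i B (t, y) = (1 - b₀ t ^ 2) * gradient u₀ y i + (1 - b₁ t ^ 2) * gradient u₁ y i := by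
    intro t y i
    rw [← gradient_apply i hBc]
    have g0 : HasFDerivAt u₀ _ y := (hu₀.differentiable (by simp) y).hasGradientAt.hasFDerivAt
    have g1 : HasFDerivAt u₁ _ y := (hu₁.differentiable (by simp) y).hasGradientAt.hasFDerivAt
    have g2 := (g0.const_mul (1 - b₀ t ^ 2)).add (g1.const_mul (1 - b₁ t ^ 2))
    have g3 : HasGradientAt (fun y => B (t, y))
        ((1 - b₀ t ^ 2) • gradient u₀ y + (1 - b₁ t ^ 2) • gradient u₁ y) y := by
      rw [hasGradientAt_iff_hasFDerivAt]
      refine g2.congr_fderiv ?_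
      ext w; simp
    rw [g3.gradient]
    simp
  obtain ⟨u', q', p', hu', hp', hq', hfar, hends, herr, hLB⟩ :=
    CI_main (b := fun t => b₀ t * b₁ t) hBc hp hq hR
      (fun t y hy => by simp [hB, h₀ y hy, h₁ y hy]) hpqR (hb₀c.mul hb₁c)
      (fun t => ⟨mul_nonneg (hb₀I t).1 (hb₁I t).1, mul_le_one₀ (hb₀I t).2 (hb₁I t).1 (hb₁I t).2⟩) hε0
  have hin : ∀ t y i, |dj i B (t, y) - (1 - (b₀ t * b₁ t) ^ 2) * p i (t, y)| ≤ ε := by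
    intro t y i
    rw [hBd]
    rcases le_or_gt t (1/3) with h1 | h1
    · rw [hb₁1 t (by linarith)]
      have e1 : (v (t, y)).1 = gradient u₀ y := by simp [hv, hθ0 t h1, hh0]
      have e2 := hpv i (t, y)
      rw [e1] at e2
      have e3 : (1 - b₀ t ^ 2) * gradient u₀ y i + (1 - 1 ^ 2) * gradient u₁ y i -
        (1 - (b₀ t * 1) ^ 2) * p i (t, y) = -((1 - b₀ t ^ 2) * (p i (t, y) - gradient u₀ y i)) := by ring
      have e4 := hb₀I t
      rw [e3, abs_neg, abs_mul, abs_of_nonneg (by nlinarith [e4.1, e4.2])]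
      nlinarith [abs_nonneg (p i (t, y) - gradient u₀ y i), e4.1, sq_nonneg (b₀ t)]
    · rw [hb₀1 t h1.le]
      rcases le_or_gt (2/3) t with h2 | h2
      · have e1 : (v (t, y)).1 = gradient u₁ y := by simp [hv, hθ1 t h2, hh1]
        have e2 := hpv i (t, y)
        rw [e1] at e2
        have e3 : (1 - 1 ^ 2) * gradient u₀ y i + (1 - b₁ t ^ 2) * gradient u₁ y i -
          (1 - (1 * b₁ t) ^ 2) * p i (t, y) = -((1 - b₁ t ^ 2) * (p i (t, y) - gradient u₁ y i)) := by ring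
        have e4 := hb₁I t
        rw [e3, abs_neg, abs_mul, abs_of_nonneg (by nlinarith [e4.1, e4.2])]
        nlinarith [abs_nonneg (p i (t, y) - gradient u₁ y i), e4.1, sq_nonneg (b₁ t)]
      · rw [hb₁1 t h2.le]
        simp [hε0.le]
  obtain ⟨F, hFc, hFg, hFY⟩ := exists_field (R := R + 1) hu' hq'
    (fun t y hy => (hfar t y hy).1) (fun t y hy => (hfar t y hy).2.2)
  have hnon : ∀ t ∈ Icc (0:ℝ) 1, ∀ y, (gradient (fun y => u' (t, y)) y, q' (t, y)) ≠ 0 := by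
    intro t ht y h0
    rw [Prod.ext_iff] at h0
    have e1 : ∀ i, dj i u' (t, y) = 0 := fun i => by
      have h01 : gradient (fun y => u' (t, y)) y = 0 := h0.1
      rw [← gradient_apply i hu', h01]; simp
    have hq0 : q' (t, y) = 0 := h0.2
    have h2 : c / 2 / 6 ^ m = 2 * ε := by rw [hε]; ring
    have hlt2 : 2 * ε < c * (3 / 4) / 6 ^ m := by
      have : c * (3 / 4) / 6 ^ m = 3 * ε := by rw [hε]; ring
      linarith
    have e2 := hLB (t, y) (c * (3 / 4)) (fun i => by
      have := herr t ht y i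
      rw [e1 i, zero_sub, abs_neg] at this
      have := hin t y i
      simp only at *
      linarith) (by rw [hq0, abs_zero]; positivity)
    refine hlow (t, y) ht ⟨fun i => ?_, ?_⟩
    · have a1 := e2.1 i
      have a2 := hpv i (t, y)
      rw [abs_lt] at *
      constructor <;> linarith [a1.1, a1.2, a2.1, a2.2]
    · have a1 := e2.2
      have a2 := hqv (t, y)
      rw [abs_lt] at *
      constructor <;> linarith [a1.1, a1.2, a2.1, a2.2]
  have hF01 : Htp PG (F 0) (F 1) := Htp.of_cont F hFc (fun t ht => ⟨hFg t, fun x hx => by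
    rw [hFY t x hx]
    exact YY_ne (hnon t ht) (by rintro rfl; simp at hx)⟩) rfl rfl
  -- the two ends
  have hend : ∀ (t : ℝ) (ht : t ∈ Icc (0:ℝ) 1) (u w : Euc m → ℝ),
      (∀ y, u' (t, y) = u y) → (∀ y, q' (t, y) = q (t, y)) → (∀ y, v (t, y) = (gradient u y, w y)) →
      ∀ f : Euc (m + 1) → Euc (m + 1), IsGradient f →
        (∀ x, ‖x‖ = 1 → f x = YY (fun y => (gradient u y, w y)) x) → Htp PG f (F t) := by
    intro t ht u w hu hq hvt f hf hfY
    refine htp_YY_linear hf (hFg t) hfY (hFY t) fun s hs y h0 => ?_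
    have e0 : (fun y => u' (t, y)) = u := funext hu
    rw [e0] at h0
    rw [Prod.ext_iff] at h0
    simp only [Prod.smul_mk, Prod.mk_add_mk, Prod.fst_zero, Prod.snd_zero, ← add_smul,
      sub_add_cancel, one_smul, smul_eq_mul] at h0
    refine hlow (t, y) ht ⟨fun i => ?_, ?_⟩
    · rw [hvt y, h0.1]; simpa using hc0
    · have a2 := hqv (t, y)
      rw [hvt y, ← hq y] at a2
      rw [hvt y]
      simp only at a2 ⊢
      have : w y = - (s * (q' (t, y) - w y)) := by linarith [h0.2]
      rw [this, abs_neg, abs_mul, abs_of_nonneg hs.1]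
      nlinarith [abs_nonneg (q' (t, y) - w y), hs.2]
  have hb0 : b₀ 0 = 0 := Real.smoothTransition.zero_of_nonpos (by simp)
  have hb1 : b₁ 1 = 0 := Real.smoothTransition.zero_of_nonpos (by simp)
  have hb0' : b₁ 0 = 1 := hb₁1 0 (by norm_num)
  have hb1' : b₀ 1 = 1 := hb₀1 1 (by norm_num)
  have E0 := hend 0 (by simp) u₀ w₀ (fun y => by
      rw [(hends 0 y (by simp [hb0])).1]; simp [hB, hb0, hb0'])
    (fun y => (hends 0 y (by simp [hb0])).2.2) (fun y => by simp [hv, hθ0 0 (by norm_num), hh0]) f₀ hf₀ hfv₀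
  have E1 := hend 1 (by simp) u₁ w₁ (fun y => by
      rw [(hends 1 y (by simp [hb1])).1]; simp [hB, hb1, hb1'])
    (fun y => (hends 1 y (by simp [hb1])).2.2) (fun y => by simp [hv, hθ1 1 (by norm_num), hh1]) f₁ hf₁ hfv₁
  exact (E0.trans hF01).trans E1.symm

/-- a `C¹` function vanishing off a ball has vanishing derivative there, boundary included -/
theorem dj_far {u : ℝ × Euc m → ℝ} (hu : ContDiff ℝ 1 u) {R : ℝ} (hR : 0 < R)
    (h0 : ∀ t y, R ≤ ‖y‖ → u (t, y) = 0) (i : Fin m) (t : ℝ) (y : Euc m) (hy : R ≤ ‖y‖) :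
    dj i u (t, y) = 0 := by
  have hcl : IsClosed {s : ℝ | dj i u (t, s • y) = 0} :=
    isClosed_eq ((dj_cont i hu).comp (by fun_prop)) continuous_const
  have hsub : Ioi (1:ℝ) ⊆ {s : ℝ | dj i u (t, s • y) = 0} := by
    intro s hs
    have hs1 : (1:ℝ) < s := hs
    have hlt : R < ‖s • y‖ := by
      rw [norm_smul, Real.norm_of_nonneg (by linarith)]; nlinarith
    have hev : ∀ᶠ z : ℝ × Euc m in 𝓝 (t, s • y), R < ‖z.2‖ :=
      (isOpen_lt (by fun_prop) (by fun_prop)).mem_nhds hlt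
    have h1 : u =ᶠ[𝓝 (t, s • y)] fun _ => 0 := by
      filter_upwards [hev] with z hz
      exact h0 z.1 z.2 hz.le
    change dj i u (t, s • y) = 0
    rw [dj, h1.fderiv_eq]; simp
  have h2 := closure_minimal hsub hcl
  rw [closure_Ioi] at h2
  have := h2 (mem_Ici.2 le_rfl)
  simpa using this

theorem PF.mono {R R' : ℝ} (h : R ≤ R') {v : Euc m → Euc m × ℝ} (hv : PF R v) : PF R' v :=
  ⟨hv.1, hv.2.1, fun y hy => hv.2.2 y (h.trans hy)⟩

theorem CI_surj {R : ℝ} (hR : 0 < R) {v : Euc m → Euc m × ℝ} (hv : PF R v) :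
    ∃ (u w : Euc m → ℝ), ContDiff ℝ 1 u ∧ ContDiff ℝ 1 w ∧ (∀ y, R + 1 ≤ ‖y‖ → u y = 0) ∧
      (∀ y, R + 1 ≤ ‖y‖ → w y = 1) ∧ Htp (PF (R + 1)) v (fun y => (gradient u y, w y)) := by
  set V : ℝ × Euc m → Euc m × ℝ := fun z => v z.2 with hV
  have hvc := hv.1
  have hVc : Continuous V := by fun_prop
  have hVR : ∀ t y, R ≤ ‖y‖ → V (t, y) = (0, 1) := fun t y hy => hv.2.2 y hy
  obtain ⟨c, hc0, hlow⟩ := exists_lower hVc hVR (fun z => hv.2.1 _)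
  set ε := c / 4 / 6 ^ m with hε
  have h6 : (1:ℝ) ≤ 6 ^ m := one_le_pow₀ (by norm_num)
  have hε0 : 0 < ε := by positivity
  have hε1 : ε ≤ c / 4 := div_le_self (by positivity) h6
  obtain ⟨p, q, hp, hq, hpv, hqv, hpqR⟩ := exists_smooth hVc hVR hε0
  set b : ℝ → ℝ := Real.smoothTransition with hb
  obtain ⟨u', q', p', hu', hp', hq', hfar, hends, herr, hLB⟩ :=
    CI_main (u := fun _ => 0) (b := b) contDiff_const hp hq hR
      (fun t y hy => rfl) hpqR Real.smoothTransition.contDiff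
      (fun t => ⟨Real.smoothTransition.nonneg _, Real.smoothTransition.le_one _⟩) hε0
  have hpqlow : ∀ z : ℝ × Euc m, z.1 ∈ Icc (0:ℝ) 1 → ¬ ((∀ i, |p i z| < c * (3/4)) ∧ |q z| < c * (3/4)) := by
    rintro z hz ⟨a1, a2⟩
    refine hlow z hz ⟨fun i => ?_, ?_⟩
    · have a3 := hpv i z
      have a4 := a1 i
      rw [abs_lt] at *
      constructor <;> linarith [a3.1, a3.2, a4.1, a4.2]
    · have a3 := hqv z
      rw [abs_lt] at *
      constructor <;> linarith [a3.1, a3.2, a2.1, a2.2]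
  have S1 : Htp (PF (R + 1)) v (mkv p q 0) := by
    refine Htp.of_cont (fun t y => (1 - t) • v y + t • mkv p q 0 y) ?_ ?_ (by simp) (by simp)
    · have : Continuous (mkv p q 0) :=
        (mkv_cont (fun i => (hp i).continuous) hq.continuous).comp (f := fun y => ((0:ℝ), y)) (by fun_prop)
      fun_prop
    · intro t ht
      refine ⟨?_, ?_, ?_⟩
      · have : Continuous (mkv p q 0) :=
          (mkv_cont (fun i => (hp i).continuous) hq.continuous).comp (f := fun y => ((0:ℝ), y)) (by fun_prop)
        fun_prop
      · intro y h0
        rw [Prod.ext_iff] at h0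
        simp only [mkv, Prod.fst_add, Prod.smul_fst, Prod.snd_add, Prod.smul_snd, Prod.fst_zero,
          Prod.snd_zero, smul_eq_mul] at h0
        refine hlow (0, y) (by simp) ⟨fun i => ?_, ?_⟩
        · have a1 := hpv i (0, y)
          have a2 := congrArg (fun x : Euc m => x i) h0.1
          simp at a2
          simp only [hV] at a1 ⊢
          have : (v y).1 i = - (t * (p i (0, y) - (v y).1 i)) := by linarith
          rw [this, abs_neg, abs_mul, abs_of_nonneg ht.1]
          nlinarith [abs_nonneg (p i (0, y) - (v y).1 i), ht.2]
        · have a1 := hqv (0, y)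
          simp only [hV] at a1 ⊢
          have : (v y).2 = - (t * (q (0, y) - (v y).2)) := by linarith [h0.2]
          rw [this, abs_neg, abs_mul, abs_of_nonneg ht.1]
          nlinarith [abs_nonneg (q (0, y) - (v y).2), ht.2]
      · intro y hy
        obtain ⟨a1, a2⟩ := hpqR 0 y (by linarith)
        beta_reduce
        rw [hv.2.2 y (by linarith)]
        ext i <;> simp [mkv, a1, a2]
  have hm0 : mkv p' q' 0 = mkv p q 0 := by
    funext y
    obtain ⟨-, a1, a2⟩ := hends 0 y (Real.smoothTransition.zero_of_nonpos le_rfl)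
    simp [mkv, a1, a2]
  have hmc := mkv_cont (fun i => (hp' i).continuous) hq'.continuous
  have hlow' : ∀ z : ℝ × Euc m, z.1 ∈ Icc (0:ℝ) 1 → ¬ ((∀ i, |p' i z| < c * (3/4) / 6 ^ m) ∧ |q' z| < c * (3/4) / 6 ^ m) := by
    rintro z hz ⟨a1, a2⟩
    exact hpqlow z hz (hLB z _ a1 a2)
  have hpos : 0 < c * (3/4) / 6 ^ m := by positivity
  have S2 : Htp (PF (R + 1)) (mkv p' q' 0) (mkv p' q' 1) := by
    refine Htp.of_cont (mkv p' q') hmc (fun t ht => ⟨?_, ?_, ?_⟩) rfl rfl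
    · exact hmc.comp (f := fun y => (t, y)) (by fun_prop)
    · intro y h0
      rw [Prod.ext_iff] at h0
      refine hlow' (t, y) ht ⟨fun i => ?_, ?_⟩
      · have a2 := congrArg (fun x : Euc m => x i) h0.1
        simp [mkv] at a2
        rw [a2]; simpa using hpos
      · have a2 := h0.2
        simp [mkv] at a2
        rw [a2]; simpa using hpos
    · intro y hy
      obtain ⟨-, a1, a2⟩ := hfar t y hy
      ext i <;> simp [mkv, a1, a2]
  have hb1 : b 1 = 1 := Real.smoothTransition.one_of_one_le le_rfl
  have hgc : Continuous (gradient (fun y => u' (1, y))) :=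
    (slice_gradient_cont hu').comp (f := fun y => ((1:ℝ), y)) (by fun_prop)
  have S3 : Htp (PF (R + 1)) (mkv p' q' 1) (fun y => (gradient (fun y => u' (1, y)) y, q' (1, y))) := by
    have hc1 : Continuous (mkv p' q' 1) := hmc.comp (f := fun y => ((1:ℝ), y)) (by fun_prop)
    have hq1 : Continuous (fun y => q' (1, y)) := hq'.continuous.comp (by fun_prop)
    refine Htp.of_cont (fun t y => (1 - t) • mkv p' q' 1 y + t • (gradient (fun y => u' (1, y)) y, q' (1, y)))
      (by fun_prop) ?_ (by simp) (by simp)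
    intro t ht
    refine ⟨by fun_prop, ?_, ?_⟩
    · intro y h0
      rw [Prod.ext_iff] at h0
      simp only [mkv, Prod.fst_add, Prod.smul_fst, Prod.snd_add, Prod.smul_snd, Prod.fst_zero,
        Prod.snd_zero, smul_eq_mul] at h0
      refine hlow' (1, y) (by simp) ⟨fun i => ?_, ?_⟩
      · have a1 := herr 1 (by simp) y i
        have a2 := congrArg (fun x : Euc m => x i) h0.1
        have a3 : dj i (fun _ => (0:ℝ)) ((1:ℝ), y) = 0 := by simp [dj]
        simp only [PiLp.add_apply, PiLp.smul_apply, smul_eq_mul, PiLp.zero_apply] at a2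
        rw [gradient_apply i hu'] at a2
        rw [hb1, a3] at a1
        simp only [one_pow, sub_self, zero_mul, abs_zero, zero_add] at a1
        have : p' i (1, y) = - (t * (dj i u' (1, y) - p' i (1, y))) := by linarith
        rw [this, abs_neg, abs_mul, abs_of_nonneg ht.1]
        have : c * (3 / 4) / 6 ^ m = 3 * ε := by rw [hε]; ring
        nlinarith [abs_nonneg (dj i u' (1, y) - p' i (1, y)), ht.2]
      · have : q' (1, y) = 0 := by linarith [h0.2]
        rw [this]; simpa using hpos
    · intro y hy
      obtain ⟨-, a1, a2⟩ := hfar 1 y hy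
      have hg0 : gradient (fun y => u' (1, y)) y = 0 := by
        ext i
        rw [gradient_apply i hu']
        exact dj_far hu' (R := R + 1) (by linarith) (fun t y hy => (hfar t y hy).1) i 1 y hy
      beta_reduce
      rw [hg0]
      ext i <;> simp [mkv, a1, a2]
  refine ⟨fun y => u' (1, y), fun y => q' (1, y), slice_contDiff hu' 1, slice_contDiff hq' 1,
    fun y hy => (hfar 1 y hy).1, fun y hy => (hfar 1 y hy).2.2, ?_⟩
  rw [← hm0] at S1
  exact (S1.trans S2).trans S3

end CI2
end GH

namespace GH
open scoped RealInnerProductSpace Topology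

section pole
variable {m : ℕ}

theorem sphere_min {n : ℕ} {f : Euc n → Euc n} (hf : PG f) : ∃ c, 0 < c ∧ ∀ x, ‖x‖ = 1 → c ≤ ‖f x‖ := by
  rcases (sphere (0 : Euc n) 1).eq_empty_or_nonempty with h | h
  · refine ⟨1, one_pos, fun x hx => ?_⟩
    have : x ∈ sphere (0 : Euc n) 1 := by simpa using hx
    simp [h] at this
  · obtain ⟨x₀, hx₀, hm⟩ := (isCompact_sphere (0 : Euc n) 1).exists_isMinOn h
      (f := fun x => ‖f x‖) hf.1.continuous.norm.continuousOn
    refine ⟨‖f x₀‖, by simpa using hf.2 x₀ (by simpa using hx₀), fun x hx => hm (by simpa using hx)⟩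

theorem PG.tangent {f : Euc (m + 2) → Euc (m + 2)} (hf : PG f) :
    ∃ f', Htp PG f f' ∧ pr (f' ee) ≠ 0 := by
  obtain ⟨c, hc, hmin⟩ := sphere_min hf
  by_cases h0 : pr (f ee) = 0
  · set a : Euc (m + 2) := em ((c / 2) • EuclideanSpace.single 0 1) with ha
    have hna : ‖a‖ = c / 2 := by
      rw [ha, norm_em, norm_smul]; simp; linarith
    have hg : IsGradient (fun x => f x + a) := by
      refine hf.1.add (g := fun _ => a) ?_
      rw [isGradient_iff]
      refine ⟨continuous_const, fun x => ⟪a, x⟫, fun x => ?_⟩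
      rw [hasGradientAt_iff_hasFDerivAt]
      exact (innerSL ℝ a).hasFDerivAt
    refine ⟨_, Htp.linear hf.1 hg fun t ht x hx h => ?_, ?_⟩
    · have h1 : f x = - (t • a) := by
        rw [eq_neg_iff_add_eq_zero, ← h]; module
      have h2 := hmin x hx
      rw [h1, norm_neg, norm_smul, hna, Real.norm_of_nonneg ht.1] at h2
      nlinarith [ht.2]
    · simp only [map_add, h0, ha, pr_em, zero_add]
      simp [hc.ne']
  · exact ⟨f, Htp.refl hf.1.continuous hf, h0⟩

theorem PG.pos {f : Euc (m + 1) → Euc (m + 1)} (hf : PG f) (h0 : pr (f ee) ≠ 0) :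
    ∃ f', Htp PG f f' ∧ 0 < ht (f' ee) := by
  have hfc := hf.1.continuous
  have hopen : IsOpen {x : Euc (m + 1) | f x - ⟪f x, x⟫ • x ≠ 0} :=
    isOpen_ne_fun (by fun_prop) (by fun_prop)
  have hee : (ee : Euc (m + 1)) ∈ {x : Euc (m + 1) | f x - ⟪f x, x⟫ • x ≠ 0} := by
    intro h
    apply h0
    have := congrArg pr h
    simpa using this
  obtain ⟨δ, hδ, hsub⟩ := Metric.isOpen_iff.1 hopen _ hee
  let β : ContDiffBump (ee : Euc (m + 1)) := ⟨δ / 2, δ, by linarith, by linarith⟩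
  set M : ℝ := 1 + |ht (f ee)| with hM
  have hβc : ContDiff ℝ 1 (fun x => β x) := β.contDiff
  obtain ⟨hc, φ, hφ⟩ := isGradient_iff.1 hf.1
  have hψ : ContDiff ℝ 1 (fun x : Euc (m + 1) => M * (β x * ((‖x‖ ^ 2 - 1) / 2))) :=
    contDiff_const.mul (hβc.mul (((contDiff_norm_sq ℝ).sub contDiff_const).div_const 2))
  have hval : ∀ x : Euc (m + 1), ‖x‖ = 1 →
      gradient (fun x : Euc (m + 1) => M * (β x * ((‖x‖ ^ 2 - 1) / 2))) x = (M * β x) • x := by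
    intro x hx
    apply HasGradientAt.gradient
    rw [hasGradientAt_iff_hasFDerivAt]
    have h1 : HasFDerivAt (fun x : Euc (m + 1) => ‖x‖ ^ 2) (2 • innerSL ℝ x) x :=
      (hasStrictFDerivAt_norm_sq x).hasFDerivAt
    have h2 := ((((hβc.differentiable (by simp)) x).hasFDerivAt).mul
      ((h1.sub_const 1).mul_const (2⁻¹ : ℝ))).const_mul M
    simp only [div_eq_mul_inv]
    refine h2.congr_fderiv ?_
    ext z
    simp [hx, inner_smul_left]
    ring
  refine ⟨_, Htp.linear hf.1 (hf.1.add (isGradient_of_contDiff hψ)) fun t ht x hx h => ?_, ?_⟩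
  · rw [hval x hx] at h
    have h1 : f x + (t * (M * β x)) • x = 0 := by rw [← h]; module
    by_cases hb : β x = 0
    · rw [hb] at h1; simp at h1; exact hf.2 x hx h1
    · have hx2 : x ∈ ball (ee : Euc (m + 1)) δ := by
        have : x ∈ Function.support β := hb
        rwa [β.support_eq] at this
      apply hsub hx2
      have h2 : f x = -((t * (M * β x)) • x) := eq_neg_of_add_eq_zero_left h1
      rw [h2, inner_neg_left, inner_smul_left, real_inner_self_eq_norm_sq, hx]
      simp
  · have hb : β (ee : Euc (m + 1)) = 1 := β.one_of_mem_closedBall (by simp [β]; linarith)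
    beta_reduce
    rw [hval _ norm_ee, hb]
    simp [hM]
    linarith [neg_abs_le (ht (f ee))]

/-- retraction-like map, identity on the sphere with no radial derivative -/
def rr (x : Euc (m + 1)) : Euc (m + 1) := ((3 - ‖x‖ ^ 2) / 2) • x

theorem rr_contDiff : ContDiff ℝ 1 (rr : Euc (m + 1) → Euc (m + 1)) :=
  ((contDiff_const.sub (contDiff_norm_sq ℝ)).div_const 2).smul contDiff_id

theorem rr_S {x : Euc (m + 1)} (hx : ‖x‖ = 1) : rr x = x := by
  simp [rr, hx]; norm_num

theorem rr_fderiv {x : Euc (m + 1)} (hx : ‖x‖ = 1) : fderiv ℝ rr x x = 0 := by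
  have h1 : HasFDerivAt (fun x : Euc (m + 1) => ‖x‖ ^ 2) (2 • innerSL ℝ x) x :=
    (hasStrictFDerivAt_norm_sq x).hasFDerivAt
  have h2 := ((h1.const_sub 3).mul_const (2⁻¹ : ℝ)).smul (hasFDerivAt_id x)
  have : rr = fun x : Euc (m + 1) => ((3 - ‖x‖ ^ 2) * 2⁻¹) • id x := by
    funext x; simp [rr, div_eq_mul_inv]
  have h3 : rr = ((fun y : Euc (m + 1) => (3 - ‖y‖ ^ 2) * (2⁻¹ : ℝ)) • (id : Euc (m + 1) → Euc (m + 1))) := this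
  rw [h3, h2.fderiv]
  simp [hx]
  module

theorem PG.normalize {f : Euc (m + 1) → Euc (m + 1)} (hf : PG f) (h0 : 0 < ht (f ee)) :
    ∃ (φ : Euc (m + 1) → ℝ) (δ : ℝ), 0 < δ ∧ ContDiff ℝ 1 φ ∧ Htp PG f (gradient φ) ∧
      ∀ x ∈ ball (ee : Euc (m + 1)) δ, ‖x‖ = 1 → φ x = 0 ∧ gradient φ x = x := by
  obtain ⟨φ₀, hφ₀, hfφ₀⟩ := hf.1
  have hfc := hf.1.continuous
  set φ : Euc (m + 1) → ℝ := fun x => φ₀ x - φ₀ ee with hφd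
  have hφ : ContDiff ℝ 1 φ := hφ₀.sub contDiff_const
  have hfφ : ∀ x, HasGradientAt φ (f x) x := fun x => by
    rw [hasGradientAt_iff_hasFDerivAt]
    have : HasGradientAt φ₀ (f x) x := by
      rw [← hfφ₀ x]; exact ((hφ₀.differentiable (by simp)) x).hasGradientAt
    exact (this.hasFDerivAt).sub_const _
  have hopen : IsOpen {x : Euc (m + 1) | 0 < ⟪f x, x⟫} :=
    isOpen_lt (by fun_prop) (by fun_prop)
  have hee : (ee : Euc (m + 1)) ∈ {x : Euc (m + 1) | 0 < ⟪f x, x⟫} := by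
    change 0 < ⟪f ee, ee⟫
    rw [real_inner_comm, inner_ee]; exact h0
  obtain ⟨δ, hδ, hsub⟩ := Metric.isOpen_iff.1 hopen _ hee
  let β : ContDiffBump (ee : Euc (m + 1)) := ⟨δ / 2, δ, by linarith, by linarith⟩
  have hβc : ContDiff ℝ 1 (fun x => β x) := β.contDiff
  set κ : Euc (m + 1) → ℝ := fun x => β (rr x) with hκ
  have hκc : ContDiff ℝ 1 κ := hβc.comp rr_contDiff
  set N : Euc (m + 1) → ℝ := fun x => (‖x‖ ^ 2 - 1) / 2 with hN
  have hNc : ContDiff ℝ 1 N := ((contDiff_norm_sq ℝ).sub contDiff_const).div_const 2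
  have hNd : ∀ x : Euc (m + 1), HasGradientAt N x x := by
    intro x
    rw [hasGradientAt_iff_hasFDerivAt]
    have h1 : HasFDerivAt (fun x : Euc (m + 1) => ‖x‖ ^ 2) (2 • innerSL ℝ x) x :=
      (hasStrictFDerivAt_norm_sq x).hasFDerivAt
    have h2 := (h1.sub_const 1).mul_const (2⁻¹ : ℝ)
    simp only [hN, div_eq_mul_inv]
    refine h2.congr_fderiv ?_
    ext z
    simp
  set φ' : Euc (m + 1) → ℝ := fun x => φ x + κ x * (N x - φ x) with hφ'
  have hφ'c : ContDiff ℝ 1 φ' := hφ.add (hκc.mul (hNc.sub hφ))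
  have hφ'd : ∀ x, gradient φ' x = f x + κ x • (x - f x) + (N x - φ x) • gradient κ x := by
    intro x
    apply HasGradientAt.gradient
    rw [hasGradientAt_iff_hasFDerivAt]
    have hκd := ((hκc.differentiable (by simp)) x).hasGradientAt.hasFDerivAt
    have h2 := (hfφ x).hasFDerivAt.add (hκd.mul ((hNd x).hasFDerivAt.sub (hfφ x).hasFDerivAt))
    refine h2.congr_fderiv ?_
    ext z
    simp [inner_add_left, inner_sub_left, inner_smul_left]
    ring
  have hκr : ∀ x : Euc (m + 1), ‖x‖ = 1 → ⟪gradient κ x, x⟫ = 0 := by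
    intro x hx
    have hκd : HasFDerivAt κ ((fderiv ℝ β (rr x)).comp (fderiv ℝ rr x)) x :=
      HasFDerivAt.comp (g := fun x => β x) (f := rr) x ((hβc.differentiable (by simp)) (rr x)).hasFDerivAt
        ((rr_contDiff.differentiable (by simp)) x).hasFDerivAt
    have := ((hκc.differentiable (by simp)) x).hasGradientAt.hasFDerivAt.unique hκd
    have := congrArg (fun L => L x) this
    simpa [rr_fderiv hx] using this
  refine ⟨φ', δ / 2, by linarith, hφ'c, Htp.linear hf.1 (isGradient_of_contDiff hφ'c) ?_, ?_⟩
  · intro t ht x hx h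
    rw [hφ'd x] at h
    by_cases hb : κ x = 0
    · have : gradient κ x = 0 := by
        have hmin : IsLocalMin κ x := Eventually.of_forall fun z => by
          rw [hb]; exact β.nonneg
        unfold gradient
        rw [hmin.fderiv_eq_zero]; simp
      rw [this, hb] at h
      apply hf.2 x hx
      rw [← h]; module
    · have hx2 : x ∈ ball (ee : Euc (m + 1)) δ := by
        have : rr x ∈ Function.support β := hb
        rw [β.support_eq, rr_S hx] at this
        exact this
      have hpos : 0 < ⟪f x, x⟫ := hsub hx2
      have h3 := congrArg (fun z => ⟪z, x⟫) h
      simp only [inner_add_left, inner_sub_left, inner_smul_left, hκr x hx, inner_zero_left,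
        real_inner_self_eq_norm_sq, hx] at h3
      simp at h3
      have k0 : 0 ≤ κ x := β.nonneg
      have k1 : κ x ≤ 1 := β.le_one
      have k2 : 0 < κ x := lt_of_le_of_ne k0 (Ne.symm hb)
      have e : (1 - t * κ x) * ⟪f x, x⟫ + t * κ x = 0 := by linarith
      have htk : t * κ x ≤ 1 := by nlinarith [ht.1, ht.2]
      have htk0 : 0 ≤ t * κ x := mul_nonneg ht.1 k0
      rcases eq_or_lt_of_le htk0 with h5 | h5
      · rw [← h5] at e; linarith
      · nlinarith [mul_nonneg (sub_nonneg.2 htk) hpos.le]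
  · intro x hx hx1
    have hb : κ x = 1 := β.one_of_mem_closedBall (by
      rw [rr_S hx1]; exact ball_subset_closedBall hx)
    have hN0 : N x = 0 := by simp [hN, hx1]
    have : gradient κ x = 0 := by
      have hmax : IsLocalMax κ x := Eventually.of_forall fun z => by
        rw [hb]; exact β.le_one
      unfold gradient
      rw [hmax.fderiv_eq_zero]; simp
    refine ⟨by simp [hφ', hb, hN0], ?_⟩
    rw [hφ'd, this, hb]; module

theorem sg_contDiff : ContDiff ℝ 1 (sg : Euc m → Euc (m + 1)) := by
  unfold sg
  have h1 : ContDiff ℝ 1 (fun y : Euc m => ‖y‖ ^ 2) := contDiff_norm_sq ℝ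
  refine ContDiff.smul (ContDiff.inv (h1.add contDiff_const) fun y => by positivity) ?_
  exact ((em.contDiff (n := 1)).const_smul (2:ℝ)).add ((h1.sub contDiff_const).smul contDiff_const)

theorem sg_dist (y : Euc m) : ‖sg y - ee‖ ^ 2 * (‖y‖ ^ 2 + 1) = 4 := by
  rw [norm_sub_sq_real, norm_sg, real_inner_comm, inner_ee, ht_sg, norm_ee]
  have : ‖y‖ ^ 2 + 1 ≠ 0 := by positivity
  field_simp
  ring

theorem to_chart {φ : Euc (m + 1) → ℝ} {δ : ℝ} (hδ : 0 < δ) (hφ : ContDiff ℝ 1 φ)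
    (hne : ∀ x, ‖x‖ = 1 → gradient φ x ≠ 0)
    (hp : ∀ x ∈ ball (ee : Euc (m + 1)) δ, ‖x‖ = 1 → φ x = 0 ∧ gradient φ x = x) :
    ∃ (R : ℝ) (u w : Euc m → ℝ), 0 < R ∧ ContDiff ℝ 1 u ∧ (∀ y, R ≤ ‖y‖ → u y = 0) ∧
      PF R (fun y => (gradient u y, w y)) ∧
      ∀ x, ‖x‖ = 1 → gradient φ x = YY (fun y => (gradient u y, w y)) x := by
  have hgc : Continuous (gradient φ) := (isGradient_of_contDiff hφ).continuous
  set u : Euc m → ℝ := fun y => φ (sg y) with hu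
  set w : Euc m → ℝ := fun y => ⟪gradient φ (sg y), sg y⟫ with hw
  have huc : ContDiff ℝ 1 u := hφ.comp sg_contDiff
  have hsgc : Continuous (sg : Euc m → Euc (m + 1)) := sg_contDiff.continuous
  have hwc : Continuous w := (hgc.comp hsgc).inner hsgc
  have hYY : ∀ x, ‖x‖ = 1 → gradient φ x = YY (fun y => (gradient u y, w y)) x := by
    intro x hx
    unfold YY
    split_ifs with hU
    · have h1 := comp_st_gradient hU ((huc.differentiable (by simp)) (st x)).hasGradientAt
      have hst : sg (st x) = x := by rw [sg_st hU, hx]; simp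
      have hev : (fun x => u (st x)) =ᶠ[𝓝 x] fun x => φ (‖x‖⁻¹ • x) := by
        filter_upwards [isOpen_U.mem_nhds hU] with z hz
        simp only [hu]; rw [sg_st hz]
      have hx0 : x ≠ 0 := U_ne hU
      have hnd : HasFDerivAt (fun x : Euc (m + 1) => ‖x‖) (innerSL ℝ x) x := by
        have h2 : HasFDerivAt (fun x : Euc (m + 1) => ‖x‖ ^ 2) (2 • innerSL ℝ x) x :=
          (hasStrictFDerivAt_norm_sq x).hasFDerivAt
        have h3 := h2.sqrt (by simp [hx])
        simp only [Real.sqrt_sq (norm_nonneg _), hx] at h3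
        refine h3.congr_fderiv ?_
        ext z; simp
      have hid : HasFDerivAt (fun x : Euc (m + 1) => ‖x‖⁻¹ • x)
          (ContinuousLinearMap.id ℝ _ - (innerSL ℝ x).smulRight x) x := by
        have h4 := ((hasDerivAt_inv (by simp [hx] : ‖x‖ ≠ 0)).comp_hasFDerivAt x hnd).smul (hasFDerivAt_id x)
        refine h4.congr_fderiv ?_
        ext z; simp [hx]; ring
      have hφd : HasFDerivAt φ (innerSL ℝ (gradient φ x)) (‖x‖⁻¹ • x) := by
        have := ((hφ.differentiable (by simp)) x).hasGradientAt.hasFDerivAt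
        rw [hx, inv_one, one_smul]; exact this
      have h5 := HasFDerivAt.comp (g := φ) (f := fun x : Euc (m + 1) => ‖x‖⁻¹ • x) x hφd hid
      have h6 := (h1.congr_of_eventuallyEq hev.symm).hasFDerivAt.unique h5
      have h7 : AA x (gradient u (st x)) = gradient φ x - ⟪gradient φ x, x⟫ • x := by
        refine ext_inner_right ℝ fun z => ?_
        have := congrArg (fun L => L z) h6
        simp at this
        rw [inner_sub_left, inner_smul_left, this]
        simp [inner_sub_right, inner_smul_right]; ring
      simp only [h7, hw, hst]
      module
    · have h1 : ht x = 1 := by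
        have := ht_le x
        rw [hx] at *; linarith
      have h2 : x = ee := by
        have h3 := norm_decomp x
        rw [hx, h1] at h3
        have h4 : pr x = 0 := by simpa using h3
        rw [decomp x, h4, h1]; simp
      subst h2
      exact (hp _ (mem_ball_self hδ) norm_ee).2
  have hfar : ∀ y : Euc m, 2 / δ < ‖y‖ → sg y ∈ ball (ee : Euc (m + 1)) δ := by
    intro y hy
    rw [mem_ball, dist_eq_norm]
    have h1 := sg_dist y
    rw [div_lt_iff₀ hδ] at hy
    by_contra hcon
    push Not at hcon
    have : δ ^ 2 ≤ ‖sg y - ee‖ ^ 2 := by gcongr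
    nlinarith [sq_nonneg ‖y‖, norm_nonneg y, sq_nonneg (‖y‖ * δ)]
  have hdp : 0 < 2 / δ := by positivity
  refine ⟨2 / δ + 1, u, w, by positivity, huc, fun y hy => ?_, ⟨?_, ?_, ?_⟩, hYY⟩
  · exact (hp _ (hfar y (by linarith)) (norm_sg y)).1
  · exact (isGradient_of_contDiff huc).continuous.prodMk hwc
  · intro y h0
    apply hne (sg y) (norm_sg y)
    have h01 : gradient u y = 0 := congrArg Prod.fst h0
    have h02 : w y = 0 := congrArg Prod.snd h0
    rw [hYY _ (norm_sg y), YY, if_pos (sg_U y), st_sg]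
    simp only [h01, h02, AA_zero]; simp
  · intro y hy
    have h1 : w y = 1 := by
      simp only [hw]
      rw [(hp _ (hfar y (by linarith)) (norm_sg y)).2, real_inner_self_eq_norm_sq, norm_sg]; norm_num
    have h2 : gradient u y = 0 := by
      have hev : u =ᶠ[𝓝 y] fun _ => 0 := by
        have : ∀ᶠ z : Euc m in 𝓝 y, 2 / δ < ‖z‖ :=
          (isOpen_lt (by fun_prop) (by fun_prop)).mem_nhds (show 2 / δ < ‖y‖ by linarith)
        filter_upwards [this] with z hz
        exact (hp _ (hfar z hz) (norm_sg z)).1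
      unfold gradient
      rw [hev.fderiv_eq]; simp
    simp only [h1, h2]

/-- every admissible field is homotopic to one given by chart data -/
theorem PG.chart {f : Euc (m + 2) → Euc (m + 2)} (hf : PG f) :
    ∃ (R : ℝ) (u w : Euc (m + 1) → ℝ) (g : Euc (m + 2) → Euc (m + 2)), 0 < R ∧ ContDiff ℝ 1 u ∧
      (∀ y, R ≤ ‖y‖ → u y = 0) ∧ PF R (fun y => (gradient u y, w y)) ∧ IsGradient g ∧
      (∀ x, ‖x‖ = 1 → g x = YY (fun y => (gradient u y, w y)) x) ∧ Htp PG f g := by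
  obtain ⟨f₁, h1, hp1⟩ := hf.tangent
  obtain ⟨f₂, h2, hp2⟩ := PG.pos h1.prop.2 hp1
  obtain ⟨φ, δ, hδ, hφ, h3, hp3⟩ := PG.normalize h2.prop.2 hp2
  obtain ⟨R, u, w, hR, hu, hu0, hPF, hY⟩ := to_chart hδ hφ h3.prop.2.2 hp3
  exact ⟨R, u, w, gradient φ, hR, hu, hu0, hPF, h3.prop.2.1, hY, (h1.trans h2).trans h3⟩

end pole
end GH

namespace GH
open scoped RealInnerProductSpace Topology

section bubbles
variable {m : ℕ}

/-- matrices acting on Euclidean space -/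
def mv (A : Matrix (Fin m) (Fin m) ℝ) (y : Euc m) : Euc m := WithLp.toLp 2 (A.mulVec y.ofLp)

theorem mv_cont {X : Type*} [TopologicalSpace X] {A : X → Matrix (Fin m) (Fin m) ℝ} {y : X → Euc m}
    (hA : Continuous A) (hy : Continuous y) : Continuous (fun x => mv (A x) (y x)) := by
  unfold mv
  exact (PiLp.continuous_toLp 2 _).comp (hA.matrix_mulVec ((PiLp.continuous_ofLp 2 _).comp hy))

theorem mv_ne {A : Matrix (Fin m) (Fin m) ℝ} (hA : A.det ≠ 0) {y : Euc m} (hy : y ≠ 0) : mv A y ≠ 0 := by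
  intro h
  apply hy
  have h1 : A.mulVec y.ofLp = 0 := by
    have := congrArg WithLp.ofLp h
    simpa [mv] using this
  have := Matrix.eq_zero_of_mulVec_eq_zero hA h1
  ext i
  exact congrFun this i

/-- tent function -/
def bet (r : ℝ) (y : Euc m) : ℝ := max 0 (1 - ‖y‖ / r)

theorem bet_nonneg (r : ℝ) (y : Euc m) : 0 ≤ bet r y := le_max_left _ _

theorem bet_far {r : ℝ} (hr : 0 < r) {y : Euc m} (hy : r ≤ ‖y‖) : bet r y = 0 := by
  unfold bet
  rw [max_eq_left]
  have := (one_le_div hr).2 hy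
  linarith

theorem bet_zero (r : ℝ) : bet r (0 : Euc m) = 1 := by simp [bet]

theorem bet_pos {r : ℝ} (hr : 0 < r) {y : Euc m} (hy : ‖y‖ < r) : 0 < bet r y := by
  unfold bet
  rw [lt_max_iff]; right
  have := (div_lt_one hr).2 hy
  linarith

theorem bet_cont {X : Type*} [TopologicalSpace X] {r : X → ℝ} {y : X → Euc m}
    (hr : Continuous r) (hr0 : ∀ x, r x ≠ 0) (hy : Continuous y) : Continuous (fun x => bet (r x) (y x)) := by
  unfold bet
  exact continuous_const.max (continuous_const.sub (hy.norm.div hr hr0))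

/-- an elementary bubble -/
def bub (r : ℝ) (z : Euc m) (A : Matrix (Fin m) (Fin m) ℝ) (y : Euc m) : Euc m × ℝ :=
  (bet r (y - z) • mv A (y - z), -2 * bet r (y - z))

theorem bub_cont {X : Type*} [TopologicalSpace X] {r : X → ℝ} {z y : X → Euc m}
    {A : X → Matrix (Fin m) (Fin m) ℝ} (hr : Continuous r) (hr0 : ∀ x, r x ≠ 0)
    (hz : Continuous z) (hA : Continuous A) (hy : Continuous y) :
    Continuous (fun x => bub (r x) (z x) (A x) (y x)) := by
  unfold bub
  have h1 := bet_cont hr hr0 (hy.sub hz)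
  exact (h1.smul (mv_cont hA (hy.sub hz))).prodMk (continuous_const.mul h1)

theorem bub_far {r : ℝ} (hr : 0 < r) {z y : Euc m} (A : Matrix (Fin m) (Fin m) ℝ)
    (h : r ≤ ‖y - z‖) : bub r z A y = 0 := by
  simp [bub, bet_far hr h]

theorem bub_ne {r : ℝ} {z y : Euc m} {A : Matrix (Fin m) (Fin m) ℝ} (hA : A.det ≠ 0) :
    (0, 1) + bub r z A y ≠ 0 := by
  intro h
  have h1 := congrArg Prod.fst h
  have h2 := congrArg Prod.snd h
  simp only [bub, Prod.fst_add, zero_add, Prod.fst_zero, Prod.snd_add, Prod.snd_zero] at h1 h2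
  have hb : bet r (y - z) = 1 / 2 := by linarith
  rw [hb] at h1
  by_cases hy : y - z = 0
  · rw [hy, bet_zero] at hb; norm_num at hb
  · exact mv_ne hA hy (by simpa using h1)

/-- configurations of bubbles -/
def cfg {ι : Type*} [Fintype ι] (r : ℝ) (z : ι → Euc m) (A : ι → Matrix (Fin m) (Fin m) ℝ) (y : Euc m) :
    Euc m × ℝ := (0, 1) + ∑ i, bub r (z i) (A i) y

theorem cfg_near {ι : Type*} [Fintype ι] {r : ℝ} (hr : 0 < r) {z : ι → Euc m}
    (A : ι → Matrix (Fin m) (Fin m) ℝ) (hz : ∀ i j, i ≠ j → 2 * r ≤ ‖z i - z j‖) {y : Euc m} {i : ι}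
    (hi : ‖y - z i‖ < r) : cfg r z A y = (0, 1) + bub r (z i) (A i) y := by
  unfold cfg
  rw [Finset.sum_eq_single i]
  · intro j _ hj
    apply bub_far hr
    have h1 := hz i j (Ne.symm hj)
    have h2 : ‖z i - z j‖ ≤ ‖y - z j‖ + ‖y - z i‖ := by
      have : z i - z j = (y - z j) - (y - z i) := by abel
      rw [this]; exact norm_sub_le _ _
    linarith
  · simp

theorem cfg_far {ι : Type*} [Fintype ι] {r : ℝ} (hr : 0 < r) {z : ι → Euc m}
    (A : ι → Matrix (Fin m) (Fin m) ℝ) {y : Euc m} (hy : ∀ i, r ≤ ‖y - z i‖) : cfg r z A y = (0, 1) := by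
  unfold cfg
  rw [Finset.sum_eq_zero fun i _ => bub_far hr _ (hy i), add_zero]

theorem cfg_PF {ι : Type*} [Fintype ι] {r R : ℝ} (hr : 0 < r) {z : ι → Euc m}
    {A : ι → Matrix (Fin m) (Fin m) ℝ} (hz : ∀ i j, i ≠ j → 2 * r ≤ ‖z i - z j‖)
    (hA : ∀ i, (A i).det ≠ 0) (hR : ∀ i, ‖z i‖ + r ≤ R) : PF R (cfg r z A) := by
  refine ⟨?_, fun y => ?_, fun y hy => ?_⟩
  · unfold cfg
    exact continuous_const.add (continuous_finsetSum _ fun i _ =>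
      bub_cont continuous_const (fun _ => hr.ne') continuous_const continuous_const continuous_id)
  · by_cases h : ∃ i, ‖y - z i‖ < r
    · obtain ⟨i, hi⟩ := h
      rw [cfg_near hr A hz hi]
      exact bub_ne (hA i)
    · push Not at h
      rw [cfg_far hr A h]
      simp
  · apply cfg_far hr
    intro i
    have := norm_sub_norm_le y (z i)
    linarith [hR i]

theorem cfg_htp {ι : Type*} [Fintype ι] {R : ℝ} {r : ℝ → ℝ} {z : ℝ → ι → Euc m}
    {A : ℝ → ι → Matrix (Fin m) (Fin m) ℝ} (hr : ∀ t, 0 < r t) (hrc : Continuous r)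
    (hzc : ∀ i, Continuous fun t => z t i) (hAc : ∀ i, Continuous fun t => A t i)
    (hz : ∀ t ∈ Icc (0:ℝ) 1, ∀ i j, i ≠ j → 2 * r t ≤ ‖z t i - z t j‖)
    (hA : ∀ t ∈ Icc (0:ℝ) 1, ∀ i, (A t i).det ≠ 0)
    (hR : ∀ t ∈ Icc (0:ℝ) 1, ∀ i, ‖z t i‖ + r t ≤ R) :
    Htp (PF R) (cfg (r 0) (z 0) (A 0)) (cfg (r 1) (z 1) (A 1)) := by
  refine Htp.of_cont (fun t => cfg (r t) (z t) (A t)) ?_ (fun t ht => cfg_PF (hr t) (hz t ht) (hA t ht) (hR t ht))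
    rfl rfl
  unfold cfg
  exact continuous_const.add (continuous_finsetSum _ fun i _ =>
    bub_cont (hrc.comp continuous_fst) (fun _ => (hr _).ne') ((hzc i).comp continuous_fst)
      ((hAc i).comp continuous_fst) continuous_snd)

/-- homotopy of formal data through some bounded support -/
def HF (v v' : Euc m → Euc m × ℝ) : Prop := ∃ R, 0 < R ∧ Htp (PF R) v v'

theorem HF.symm {v v' : Euc m → Euc m × ℝ} (h : HF v v') : HF v' v := by
  obtain ⟨R, hR, h⟩ := h; exact ⟨R, hR, h.symm⟩

theorem HF.trans {v v' v'' : Euc m → Euc m × ℝ} (h : HF v v') (h' : HF v' v'') : HF v v'' := by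
  obtain ⟨R, hR, h⟩ := h
  obtain ⟨R', hR', h'⟩ := h'
  exact ⟨max R R', by positivity, (h.mono fun _ => PF.mono (le_max_left _ _)).trans
    (h'.mono fun _ => PF.mono (le_max_right _ _))⟩

theorem HF.refl {v : Euc m → Euc m × ℝ} {R : ℝ} (h : PF R v) : HF v v :=
  ⟨max R 1, by positivity, Htp.refl h.1 (h.mono (le_max_left _ _))⟩

/-- linear homotopies -/
theorem HF.linear {v v' : Euc m → Euc m × ℝ} {R : ℝ} (hv : PF R v) (hv' : Continuous v')
    (hR' : ∀ y, R ≤ ‖y‖ → v' y = (0, 1))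
    (h : ∀ t ∈ Icc (0:ℝ) 1, ∀ y, (1 - t) • v y + t • v' y ≠ 0) : HF v v' := by
  have hvc := hv.1
  refine ⟨max R 1, by positivity, Htp.of_cont (fun t y => (1 - t) • v y + t • v' y) (by fun_prop) ?_
    (by simp) (by simp)⟩
  intro t ht
  refine ⟨by fun_prop, h t ht, fun y hy => ?_⟩
  beta_reduce
  rw [hv.2.2 y ((le_max_left _ _).trans hy), hR' y ((le_max_left _ _).trans hy), ← add_smul]
  simp

/-- sum relative to the base value `(0,1)` -/
def uu (v w : Euc m → Euc m × ℝ) (y : Euc m) : Euc m × ℝ := v y + w y - (0, 1)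

theorem PF.uu {R : ℝ} {v w : Euc m → Euc m × ℝ} (hv : PF R v) (hw : PF R w)
    (h : ∀ y, v y = (0, 1) ∨ w y = (0, 1)) : PF R (uu v w) := by
  have h1 := hv.1
  have h2 := hw.1
  refine ⟨by unfold GH.uu; fun_prop, fun y => ?_, fun y hy => ?_⟩
  · unfold GH.uu
    rcases h y with h | h
    · rw [h]; simpa using hw.2.1 y
    · rw [h]; simpa using hv.2.1 y
  · simp [GH.uu, hv.2.2 y hy, hw.2.2 y hy]

/-- local replacement -/
theorem HF.localize {R : ℝ} {X v v' : Euc m → Euc m × ℝ} (hX : PF R X) (c : Euc m)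
    (hXc : ∀ y, ‖y - c‖ ≤ 1 → X y = (0, 1)) (h : Htp (PF 1) v v') :
    HF (uu X fun y => v (y - c)) (uu X fun y => v' (y - c)) := by
  obtain ⟨h, hc, hP, rfl, rfl⟩ := h
  have hXcont := hX.1
  have hRR : 0 < max R (‖c‖ + 1) := lt_max_of_lt_right (by positivity)
  have hsh : ∀ t, PF (max R (‖c‖ + 1)) (fun y => h t (y - c)) := fun t => by
    refine ⟨(hP t).1.comp (by fun_prop), fun y => (hP t).2.1 _, fun y hy => (hP t).2.2 _ ?_⟩
    have := norm_sub_norm_le y c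
    have := (le_max_right R (‖c‖ + 1)).trans hy
    linarith
  refine ⟨_, hRR, Htp.of_cont (fun t => uu X fun y => h t (y - c)) ?_ (fun t _ => ?_) rfl rfl⟩
  · unfold uu
    have h3 := hc.comp (f := fun z : ℝ × Euc m => (z.1, z.2 - c)) (by fun_prop)
    exact ((hXcont.comp continuous_snd).add h3).sub continuous_const
  · refine (hX.mono (le_max_left _ _)).uu (hsh t) fun y => ?_
    rcases le_total ‖y - c‖ 1 with h1 | h1
    · exact Or.inl (hXc y h1)
    · exact Or.inr ((hP t).2.2 _ h1)

end bubbles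
end GH

namespace GH
open scoped RealInnerProductSpace Topology

section mats
variable {n : ℕ}

/-- path connectedness in invertible matrices -/
def JJ (A B : Matrix (Fin n) (Fin n) ℝ) : Prop :=
  ∃ γ : ℝ → Matrix (Fin n) (Fin n) ℝ, Continuous γ ∧ (∀ t ∈ Icc (0:ℝ) 1, (γ t).det ≠ 0) ∧ γ 0 = A ∧ γ 1 = B

theorem JJ.toHtp {A B : Matrix (Fin n) (Fin n) ℝ} (h : JJ A B) :
    Htp (X := Unit) (fun f => (f ()).det ≠ 0) (fun _ => A) (fun _ => B) := by
  obtain ⟨γ, hc, hd, h0, h1⟩ := h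
  exact Htp.of_cont (fun t _ => γ t) (hc.comp continuous_fst) hd (by rw [h0]) (by rw [h1])

theorem JJ.ofHtp {A B : Matrix (Fin n) (Fin n) ℝ}
    (h : Htp (X := Unit) (fun f => (f ()).det ≠ 0) (fun _ => A) (fun _ => B)) : JJ A B := by
  obtain ⟨h, hc, hd, h0, h1⟩ := h
  exact ⟨fun t => h t (), hc.comp (f := fun t => (t, ())) (by fun_prop), fun t _ => hd t,
    by beta_reduce; rw [h0], by beta_reduce; rw [h1]⟩

theorem JJ.trans {A B C : Matrix (Fin n) (Fin n) ℝ} (h : JJ A B) (h' : JJ B C) : JJ A C :=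
  JJ.ofHtp (h.toHtp.trans h'.toHtp)

theorem JJ.symm {A B : Matrix (Fin n) (Fin n) ℝ} (h : JJ A B) : JJ B A := JJ.ofHtp h.toHtp.symm

theorem JJ.mul {A B C D : Matrix (Fin n) (Fin n) ℝ} (h : JJ A B) (h' : JJ C D) : JJ (A * C) (B * D) := by
  obtain ⟨γ, hc, hd, h0, h1⟩ := h
  obtain ⟨γ', hc', hd', h0', h1'⟩ := h'
  refine ⟨fun t => γ t * γ' t, hc.matrix_mul hc', fun t ht => ?_, by beta_reduce; rw [h0, h0'], by beta_reduce; rw [h1, h1']⟩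
  rw [Matrix.det_mul]; exact mul_ne_zero (hd t ht) (hd' t ht)

theorem JJ.refl {A : Matrix (Fin n) (Fin n) ℝ} (h : A.det ≠ 0) : JJ A A :=
  ⟨fun _ => A, continuous_const, fun _ _ => h, rfl, rfl⟩

/-- single entry diagonal matrices -/
def SD (i : Fin n) (d : ℝ) : Matrix (Fin n) (Fin n) ℝ := Matrix.diagonal (Function.update 1 i d)

theorem SD_det (i : Fin n) (d : ℝ) : (SD i d).det = d := by
  rw [SD, Matrix.det_diagonal, Finset.prod_update_of_mem (Finset.mem_univ _)]
  simp

theorem SD_one (i : Fin n) : SD i 1 = 1 := by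
  rw [SD]
  have : Function.update (1 : Fin n → ℝ) i 1 = 1 := by
    simp
  rw [this]; exact Matrix.diagonal_one

theorem SD_mul (i : Fin n) (a b : ℝ) : SD i a * SD i b = SD i (a * b) := by
  rw [SD, SD, SD, Matrix.diagonal_mul_diagonal]
  congr 1
  funext j
  by_cases h : j = i
  · subst h; simp
  · simp [Function.update_of_ne h]

theorem SD_pos (i : Fin n) {a b : ℝ} (h : 0 < a * b) : JJ (SD i a) (SD i b) := by
  refine ⟨fun t => SD i ((1 - t) * a + t * b), ?_, fun t ht => ?_, by simp, by simp⟩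
  · unfold SD
    refine Continuous.matrix_diagonal ?_
    exact continuous_const.update i (by fun_prop)
  · rw [SD_det]
    intro h0
    have ha : a ≠ 0 := by rintro rfl; simp at h
    have h1 : ((1 - t) * a + t * b) * a = 0 := by rw [h0]; ring
    have h2 : 0 < a * a := mul_self_pos.2 ha
    rcases eq_or_lt_of_le ht.1 with h3 | h3
    · rw [← h3] at h1; nlinarith
    · nlinarith [mul_pos h3 h, mul_nonneg (sub_nonneg.2 ht.2) h2.le]

/-- reflections -/
def RF (a : Fin n → ℝ) : Matrix (Fin n) (Fin n) ℝ := 1 - (2 / (a ⬝ᵥ a)) • Matrix.vecMulVec a a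

theorem RF_sq {a : Fin n → ℝ} (h : a ⬝ᵥ a ≠ 0) : RF a * RF a = 1 := by
  have : Matrix.vecMulVec a a * Matrix.vecMulVec a a = (a ⬝ᵥ a) • Matrix.vecMulVec a a := by
    rw [Matrix.vecMulVec_mul_vecMulVec]
    ext i j
    simp [Matrix.vecMulVec_apply]; ring
  unfold RF
  rw [sub_mul, mul_sub, mul_sub, smul_mul_smul_comm, this, smul_smul]
  have e : 2 / a ⬝ᵥ a * (2 / a ⬝ᵥ a) * a ⬝ᵥ a = 2 / a ⬝ᵥ a + 2 / a ⬝ᵥ a := by field_simp; norm_num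
  rw [e, add_smul]
  simp

theorem RF_single (i : Fin n) : RF (Pi.single i 1) = SD i (-1) := by
  unfold RF SD
  ext j k
  by_cases h : j = k
  · subst h
    by_cases h' : j = i
    · subst h'; simp [Matrix.vecMulVec_apply]; norm_num
    · simp [Matrix.vecMulVec_apply, h']
  · have hk : (Pi.single i 1 : Fin n → ℝ) j * (Pi.single i 1 : Fin n → ℝ) k = 0 := by
      by_cases h' : j = i
      · subst h'; simp [Pi.single_apply, Ne.symm h]
      · simp [h']
    simp [Matrix.vecMulVec_apply, h, hk]

theorem SD_neg (i j : Fin n) : JJ (SD i (-1)) (SD j (-1)) := by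
  by_cases hij : i = j
  · subst hij; exact JJ.refl (by rw [SD_det]; norm_num)
  have hdot : ∀ t : ℝ, ((1 - t) • (Pi.single i 1 : Fin n → ℝ) + t • Pi.single j 1) ⬝ᵥ
      ((1 - t) • (Pi.single i 1 : Fin n → ℝ) + t • Pi.single j 1) = (1 - t) ^ 2 + t ^ 2 := by
    intro t
    simp [add_dotProduct, hij, Ne.symm hij]; ring
  have hpos : ∀ t : ℝ, (1 - t) ^ 2 + t ^ 2 ≠ 0 := fun t => by nlinarith [sq_nonneg (1 - 2 * t)]
  refine ⟨fun t => RF ((1 - t) • Pi.single i 1 + t • Pi.single j 1), ?_, fun t _ => ?_, ?_, ?_⟩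
  · unfold RF
    simp only [hdot]
    have c1 : Continuous fun t : ℝ => 2 / ((1 - t) ^ 2 + t ^ 2) :=
      continuous_const.div (by fun_prop) hpos
    have c2 : Continuous fun t : ℝ => ((1 - t) • (Pi.single i 1 : Fin n → ℝ) + t • Pi.single j 1) := by
      fun_prop
    have c3 := Continuous.matrix_vecMulVec c2 c2
    exact continuous_const.sub (c1.smul c3)
  · have h1 := RF_sq (by rw [hdot]; exact hpos t)
    have h2 := congrArg Matrix.det h1
    rw [Matrix.det_mul, Matrix.det_one] at h2
    intro h3; rw [h3] at h2; norm_num at h2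
  · simp [RF_single]
  · simp [RF_single]

/-- the two normal forms -/
def EB (b : Bool) : Matrix (Fin (n + 1)) (Fin (n + 1)) ℝ := SD 0 (if b then 1 else -1)

theorem EB_det (b : Bool) : (EB b : Matrix (Fin (n + 1)) (Fin (n + 1)) ℝ).det ≠ 0 := by
  rw [EB, SD_det]; split_ifs <;> norm_num

theorem SD_EB (i : Fin (n + 1)) {d : ℝ} (hd : d ≠ 0) : ∃ b, JJ (SD i d) (EB b) := by
  rcases lt_or_gt_of_ne hd with h | h
  · refine ⟨false, (SD_pos i (by linarith : 0 < d * (-1))).trans ?_⟩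
    simpa [EB] using SD_neg i 0
  · refine ⟨true, (SD_pos i (by linarith : 0 < d * 1)).trans ?_⟩
    rw [EB]; simp only [if_true]; rw [SD_one, SD_one]
    exact JJ.refl (by simp)

theorem EB_mul (b b' : Bool) : ∃ b'', (EB b * EB b' : Matrix (Fin (n + 1)) (Fin (n + 1)) ℝ) = EB b'' := by
  refine ⟨b == b', ?_⟩
  unfold EB
  rw [SD_mul]
  cases b <;> cases b' <;> simp

theorem mat_path (A : Matrix (Fin (n + 1)) (Fin (n + 1)) ℝ) (hA : A.det ≠ 0) : ∃ b, JJ A (EB b) := by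
  have hmul : ∀ A B : Matrix (Fin (n + 1)) (Fin (n + 1)) ℝ, (∃ b, JJ A (EB b)) → (∃ b, JJ B (EB b)) →
      ∃ b, JJ (A * B) (EB b) := by
    rintro A B ⟨b, hb⟩ ⟨b', hb'⟩
    obtain ⟨b'', h⟩ := EB_mul (n := n) b b'
    exact ⟨b'', h ▸ hb.mul hb'⟩
  have hone : ∃ b, JJ (1 : Matrix (Fin (n + 1)) (Fin (n + 1)) ℝ) (EB b) := by
    refine ⟨true, ?_⟩
    rw [EB]; simp only [if_true]; rw [SD_one]
    exact JJ.refl (by simp)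
  refine Matrix.diagonal_transvection_induction_of_det_ne_zero (fun A => ∃ b, JJ A (EB b)) A hA ?_ ?_ ?_
  · intro D hD
    have key : ∀ s : Finset (Fin (n + 1)), ∃ b,
        JJ (Matrix.diagonal (fun i => if i ∈ s then D i else 1)) (EB b) := by
      intro s
      induction s using Finset.induction_on with
      | empty => simpa using hone
      | insert a s ha ih =>
        have hDa : D a ≠ 0 := by
          rw [Matrix.det_diagonal] at hD
          exact (Finset.prod_ne_zero_iff.1 hD) a (Finset.mem_univ _)
        have := hmul _ _ (SD_EB a hDa) ih
        rw [SD, Matrix.diagonal_mul_diagonal] at this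
        have e : (fun i => if i ∈ insert a s then D i else 1) =
            fun i => Function.update (1 : Fin (n + 1) → ℝ) a (D a) i * if i ∈ s then D i else 1 := by
          funext i
          by_cases h : i = a
          · subst h; simp [ha]
          · simp [h]
        rw [e]; exact this
    simpa using key Finset.univ
  · intro T
    obtain ⟨b, hb⟩ := hone
    refine ⟨b, JJ.trans ?_ hb⟩
    refine ⟨fun t => Matrix.transvection T.i T.j ((1 - t) * T.c), ?_, fun t _ => ?_, ?_, ?_⟩
    · unfold Matrix.transvection
      refine continuous_const.add ?_
      have : (fun t : ℝ => Matrix.single T.i T.j ((1 - t) * T.c)) =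
          fun t : ℝ => ((1 - t) * T.c) • Matrix.single T.i T.j (1:ℝ) := by
        funext t; simp [Matrix.smul_single]
      rw [this]; fun_prop
    · rw [Matrix.det_transvection_of_ne _ _ T.hij]; norm_num
    · simp [Matrix.TransvectionStruct.toMatrix]
    · simp
  · intro A B _ _ h1 h2
    exact hmul A B h1 h2

end mats
end GH

namespace GH
open scoped RealInnerProductSpace Topology

section sard
variable {m : ℕ}

theorem PF.lower {R : ℝ} {v : Euc m → Euc m × ℝ} (hv : PF R v) : ∃ c, 0 < c ∧ ∀ y, c ≤ ‖v y‖ := by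
  rcases (closedBall (0 : Euc m) R).eq_empty_or_nonempty with h | h
  · refine ⟨1, one_pos, fun y => ?_⟩
    have : R ≤ ‖y‖ := by
      by_contra hc
      push Not at hc
      have : y ∈ closedBall (0 : Euc m) R := by simpa using hc.le
      simp [h] at this
    rw [hv.2.2 y this]
    simp [Prod.norm_def]
  · obtain ⟨x₀, hx₀, hm⟩ := (isCompact_closedBall (0 : Euc m) R).exists_isMinOn h
      (f := fun x => ‖v x‖) hv.1.norm.continuousOn
    refine ⟨min 1 ‖v x₀‖, lt_min one_pos (by simpa using hv.2.1 x₀), fun y => ?_⟩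
    rcases le_total R ‖y‖ with h1 | h1
    · rw [hv.2.2 y h1]
      refine (min_le_left _ _).trans ?_
      simp [Prod.norm_def]
    · exact (min_le_right _ _).trans (hm (by simpa using h1))

theorem HF.near {R R' c : ℝ} {v v' : Euc m → Euc m × ℝ} (hv : PF R v) (hR : R ≤ R') (hc : ∀ y, c ≤ ‖v y‖)
    (hv' : Continuous v') (hR' : ∀ y, R' ≤ ‖y‖ → v' y = (0, 1)) (h : ∀ y, ‖v' y - v y‖ < c) :
    PF R' v' ∧ HF v v' := by
  have key : ∀ t ∈ Icc (0:ℝ) 1, ∀ y, (1 - t) • v y + t • v' y ≠ 0 := by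
    intro t ht y h0
    have h1 : v y = - (t • (v' y - v y)) := by
      rw [eq_neg_iff_add_eq_zero, ← h0]; module
    have h2 := hc y
    have h3 := h y
    rw [h1, norm_neg, norm_smul, Real.norm_of_nonneg ht.1] at h2
    nlinarith [norm_nonneg (v' y - v y), ht.2]
  refine ⟨⟨hv', fun y => ?_, hR'⟩, HF.linear (hv.mono hR) hv' hR' key⟩
  simpa using key 1 (by simp) y

theorem exists_smooth' {p : Euc m → Euc m} (hp : Continuous p) {ε : ℝ} (hε : 0 < ε) :
    ∃ g : Euc m → Euc m, ContDiff ℝ 1 g ∧ (∀ y, ‖g y - p y‖ < ε) ∧ ∀ y, p y = 0 → g y = 0 := by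
  obtain ⟨g, hg, hgd, hgs⟩ := Continuous.exists_contDiff_approx (E := Euc m) (F := Euc m) 1
    (f := p) (ε := fun _ => ε) hp continuous_const (fun _ => hε)
  have hg' : ContDiff ℝ 1 g := by exact_mod_cast hg
  refine ⟨g, hg', fun y => ?_, fun y hy => ?_⟩
  · have := hgd y; rwa [dist_eq_norm] at this
  · by_contra h
    exact hgs h hy

theorem sard {g : Euc m → Euc m} (hg : ContDiff ℝ 1 g) {ε : ℝ} (hε : 0 < ε) :
    ∃ y₀, ‖y₀‖ < ε ∧ ∀ y, g y = y₀ → (fderiv ℝ g y).det ≠ 0 := by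
  have h0 := MeasureTheory.addHaar_image_eq_zero_of_det_fderivWithin_eq_zero
    (μ := (MeasureTheory.volume : MeasureTheory.Measure (Euc m))) (f := g) (f' := fderiv ℝ g)
    (s := {y | (fderiv ℝ g y).det = 0})
    (fun x _ => ((hg.differentiable (by simp)) x).hasFDerivAt.hasFDerivWithinAt) (fun x hx => hx)
  by_contra hcon
  push Not at hcon
  have hsub : ball (0 : Euc m) ε ⊆ g '' {y | (fderiv ℝ g y).det = 0} := by
    intro y₀ hy₀
    obtain ⟨y, h1, h2⟩ := hcon y₀ (by simpa using hy₀)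
    exact ⟨y, h2, h1⟩
  have h1 := MeasureTheory.measure_mono_null hsub h0
  exact (Metric.measure_ball_pos MeasureTheory.volume (0 : Euc m) hε).ne' h1

theorem local_form {P : Euc m → Euc m} {L : Euc m →L[ℝ] Euc m} {z : Euc m} (hP : HasFDerivAt P L z)
    (hz : P z = 0) (hL : L.det ≠ 0) :
    ∃ A : Matrix (Fin m) (Fin m) ℝ, A.det ≠ 0 ∧ ∃ c, 0 < c ∧ (∀ h, c * ‖h‖ ≤ ‖mv A h‖) ∧
      ∃ ρ, 0 < ρ ∧ ∀ y, ‖y - z‖ < ρ → ‖P y - mv A (y - z)‖ ≤ c / 4 * ‖y - z‖ := by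
  set A := Matrix.toEuclideanCLM (n := Fin m) (𝕜 := ℝ) |>.symm L with hA
  have hmv : ∀ h, mv A h = L h := by
    intro h
    have : Matrix.toEuclideanCLM (n := Fin m) (𝕜 := ℝ) A = L := by simp [hA]
    rw [← this]
    rfl
  have hinj : ∀ h, L h = 0 → h = 0 := by
    intro h hh
    have h1 : LinearMap.ker (L : Euc m →ₗ[ℝ] Euc m) = ⊥ :=
      LinearMap.ker_eq_bot_of_injective ((LinearMap.isUnit_iff_isUnit_det _).2
        (isUnit_iff_ne_zero.2 hL) |> (Module.End.isUnit_iff _).1).injective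
    exact (LinearMap.ker_eq_bot'.1 h1) h hh
  have hdet : A.det ≠ 0 := by
    intro h0
    obtain ⟨w, hw0, hw⟩ := Matrix.exists_mulVec_eq_zero_iff.2 h0
    apply hw0
    have h1 : mv A (WithLp.toLp 2 w) = 0 := by simp [mv, hw]
    rw [hmv] at h1
    have h2 := hinj _ h1
    simpa using h2
  obtain ⟨K, hK, hanti⟩ := (L : Euc m →ₗ[ℝ] Euc m).exists_antilipschitzWith
    (LinearMap.ker_eq_bot'.2 fun h hh => hinj h hh)
  have hK0 : (0:ℝ) < K := hK
  have hlow : ∀ h, (K:ℝ)⁻¹ * ‖h‖ ≤ ‖mv A h‖ := by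
    intro h
    have h1 := hanti.le_mul_dist h 0
    simp only [dist_zero_right, map_zero] at h1
    rw [hmv, inv_mul_le_iff₀ hK0]
    exact h1
  refine ⟨A, hdet, (K:ℝ)⁻¹, by positivity, hlow, ?_⟩
  have ho := hP.isLittleO.def (c := (K:ℝ)⁻¹ / 4) (by positivity)
  obtain ⟨ρ, hρ, hρ'⟩ := Metric.eventually_nhds_iff.1 ho
  refine ⟨ρ, hρ, fun y hy => ?_⟩
  have := hρ' (by rwa [dist_eq_norm])
  rw [hz, sub_zero] at this
  rw [hmv]; exact this

theorem reduce {R : ℝ} {v : Euc m → Euc m × ℝ} (hv : PF R v) :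
    ∃ (k : ℕ) (z : Fin k → Euc m) (A : Fin k → Matrix (Fin m) (Fin m) ℝ) (r₀ : ℝ), 0 < r₀ ∧
      Function.Injective z ∧ (∀ i, (A i).det ≠ 0) ∧ ∀ r, 0 < r → r ≤ r₀ →
        (∀ i j, i ≠ j → 2 * r ≤ ‖z i - z j‖) ∧ HF v (cfg r z A) := by
  obtain ⟨c, hc, hlow⟩ := hv.lower
  have hvc := hv.1
  obtain ⟨g, hg, hgp, hg0⟩ := exists_smooth' (p := fun y => (v y).1) (by fun_prop) (half_pos hc)
  obtain ⟨y₀, hy₀, hreg⟩ := sard hg (half_pos hc)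
  set χ : Euc m → ℝ := fun y => max 0 (min 1 (R + 2 - ‖y‖)) with hχ
  have hχ0 : ∀ y, 0 ≤ χ y := fun y => le_max_left _ _
  have hχ1 : ∀ y, χ y ≤ 1 := fun y => by simp [hχ]
  have hχn : ∀ y, ‖y‖ ≤ R + 1 → χ y = 1 := fun y hy => by
    simp only [hχ]; rw [min_eq_left (by linarith)]; simp
  have hχf : ∀ y, R + 2 ≤ ‖y‖ → χ y = 0 := fun y hy => by
    simp only [hχ]; rw [max_eq_left]; exact (min_le_right _ _).trans (by linarith)
  have hχc : Continuous χ := by fun_prop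
  set P : Euc m → Euc m := fun y => g y - χ y • y₀ with hP
  have hgc := hg.continuous
  have hPc : Continuous P := by fun_prop
  set q : Euc m → ℝ := fun y => (v y).2 with hq
  have hqc : Continuous q := by fun_prop
  have hPfar : ∀ y, R + 2 ≤ ‖y‖ → P y = 0 := fun y hy => by
    have : (v y).1 = 0 := by rw [hv.2.2 y (by linarith)]
    simp [hP, hχf y hy, hg0 y this]
  have hqfar : ∀ y, R ≤ ‖y‖ → q y = 1 := fun y hy => by simp only [hq]; rw [hv.2.2 y hy]
  obtain ⟨hv2, H12⟩ := HF.near (v' := fun y => (P y, q y)) hv (by linarith : R ≤ R + 2) hlow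
    (by fun_prop) (fun y hy => by rw [hPfar y hy, hqfar y (by linarith)]) (fun y => by
      have e : (P y, q y) - v y = (g y - (v y).1 - χ y • y₀, 0) := by
        ext1
        · simp [hP]; abel
        · simp [hq]
      rw [e, Prod.norm_def]
      simp only [norm_zero]
      rw [max_eq_left (norm_nonneg _)]
      refine (norm_sub_le _ _).trans_lt ?_
      rw [norm_smul, Real.norm_of_nonneg (hχ0 y)]
      have := hgp y
      nlinarith [norm_nonneg y₀, hχ1 y])
  set Z : Set (Euc m) := {y | P y = 0 ∧ q y ≤ 0} with hZ
  have hZR : ∀ y ∈ Z, ‖y‖ < R := by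
    intro y hy
    by_contra h
    push Not at h
    have := hy.2
    rw [hqfar y h] at this
    linarith
  have hZc : IsCompact Z := by
    refine (isCompact_closedBall (0 : Euc m) R).of_isClosed_subset ?_ ?_
    · exact (isClosed_eq hPc continuous_const).inter (isClosed_le hqc continuous_const)
    · intro y hy; simpa using (hZR y hy).le
  have hloc : ∀ z ∈ Z, ∃ A : Matrix (Fin m) (Fin m) ℝ, A.det ≠ 0 ∧ ∃ c, 0 < c ∧
      (∀ h, c * ‖h‖ ≤ ‖mv A h‖) ∧
      ∃ ρ, 0 < ρ ∧ ∀ y, ‖y - z‖ < ρ → ‖P y - mv A (y - z)‖ ≤ c / 4 * ‖y - z‖ := by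
    intro z hz
    have hzR := hZR z hz
    have hgz : g z = y₀ := by
      have := hz.1
      simp only [hP, hχn z (by linarith), one_smul] at this
      exact sub_eq_zero.1 this
    refine local_form (L := fderiv ℝ g z) ?_ hz.1 (hreg z hgz)
    have h1 : HasFDerivAt (fun y => g y - y₀) (fderiv ℝ g z) z :=
      ((hg.differentiable (by simp)) z).hasFDerivAt.sub_const _
    refine h1.congr_of_eventuallyEq ?_
    have : ∀ᶠ y : Euc m in 𝓝 z, ‖y‖ < R + 1 :=
      (isOpen_lt (by fun_prop) (by fun_prop)).mem_nhds (show ‖z‖ < R + 1 by linarith)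
    filter_upwards [this] with y hy
    simp [hP, hχn y hy.le]
  have hiso : ∀ {A : Matrix (Fin m) (Fin m) ℝ} {c : ℝ} {z y : Euc m}, 0 < c →
      (∀ h, c * ‖h‖ ≤ ‖mv A h‖) → ‖P y - mv A (y - z)‖ ≤ c / 4 * ‖y - z‖ → P y = 0 → y = z := by
    intro A c z y hc h1 h2 h3
    rw [h3, zero_sub, norm_neg] at h2
    have := h1 (y - z)
    have h4 : ‖y - z‖ = 0 := le_antisymm (by nlinarith) (norm_nonneg _)
    exact sub_eq_zero.1 (norm_eq_zero.1 h4)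
  have hZf : Z.Finite := by
    by_contra hinf
    obtain ⟨z, hz, hacc⟩ := Set.Infinite.exists_accPt_of_subset_isCompact hinf hZc Subset.rfl
    obtain ⟨A, -, c', hc', h1, ρ, hρ, h2⟩ := hloc z hz
    rw [accPt_iff_frequently] at hacc
    have hev : ∀ᶠ y in 𝓝 z, ‖y - z‖ < ρ := by
      have : ball z ρ ∈ 𝓝 z := ball_mem_nhds z hρ
      filter_upwards [this] with y hy
      rwa [mem_ball, dist_eq_norm] at hy
    obtain ⟨y, ⟨hyz, hyZ⟩, hy⟩ := (hacc.and_eventually hev).exists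
    exact hyz (hiso hc' h1 (h2 y hy) hyZ.1)
  haveI : Finite Z := hZf
  obtain ⟨k, ⟨e⟩⟩ := Finite.exists_equiv_fin Z
  set z : Fin k → Euc m := fun i => (e.symm i : Euc m) with hz
  have hzZ : ∀ i, z i ∈ Z := fun i => (e.symm i).2
  have hzsurj : ∀ y ∈ Z, ∃ i, z i = y := fun y hy => ⟨e ⟨y, hy⟩, by simp [hz]⟩
  have hzinj : Function.Injective z := Subtype.val_injective.comp e.symm.injective
  choose A hA c' hc' h1 ρ hρ h2 using fun i => hloc (z i) (hzZ i)
  have hr₀ : ∀ᶠ r in 𝓝[>] (0:ℝ), (r ≤ 1 ∧ ∀ i, r ≤ ρ i) ∧ ∀ i j, i ≠ j → 2 * r ≤ ‖z i - z j‖ := by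
    have key : ∀ a : ℝ, 0 < a → ∀ᶠ r in 𝓝[>] (0:ℝ), r ≤ a := fun a ha =>
      mem_nhdsWithin_of_mem_nhds (Iic_mem_nhds ha)
    refine ((key 1 one_pos).and (eventually_all.2 fun i => key _ (hρ i))).and
      (eventually_all.2 fun i => eventually_all.2 fun j => ?_)
    by_cases hij : i = j
    · exact Eventually.of_forall fun r h => absurd hij h
    · have : 0 < ‖z i - z j‖ := norm_pos_iff.2 (sub_ne_zero.2 (hzinj.ne hij))
      filter_upwards [key (‖z i - z j‖ / 2) (by positivity)] with r hr _
      linarith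
  obtain ⟨r₀, ⟨⟨hr1, hrρ⟩, hrz⟩, hr0⟩ := (hr₀.and self_mem_nhdsWithin).exists
  refine ⟨k, z, A, r₀, hr0, hzinj, hA, fun r hr hrr => ?_⟩
  have hd : ∀ i j, i ≠ j → 2 * r ≤ ‖z i - z j‖ := fun i j hij => by linarith [hrz i j hij]
  refine ⟨hd, H12.trans ?_⟩
  have hcfg : PF (R + 2) (cfg r z A) := cfg_PF hr hd hA fun i => by
    have := hZR _ (hzZ i); linarith
  have hcc := hcfg.1
  have key3 : ∀ t ∈ Icc (0:ℝ) 1, ∀ y, (1 - t) • (P y, q y) + t • (P y, (cfg r z A y).2) ≠ 0 := by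
    intro t ht y h0
    have a1 : (1 - t) • P y + t • P y = 0 := congrArg Prod.fst h0
    have a2 : (1 - t) * q y + t * (cfg r z A y).2 = 0 := congrArg Prod.snd h0
    rw [← add_smul, sub_add_cancel, one_smul] at a1
    by_cases hyZ : q y ≤ 0
    · obtain ⟨i, hi⟩ := hzsurj y ⟨a1, hyZ⟩
      have hq0 : q y ≠ 0 := fun h => hv2.2.1 y (by simp [a1, h])
      have hq1 : q y < 0 := lt_of_le_of_ne hyZ hq0
      have : (cfg r z A y).2 = -1 := by
        rw [cfg_near hr A hd (i := i) (by rw [hi]; simpa using hr)]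
        simp [bub, hi, bet_zero]; norm_num
      rw [this] at a2
      rcases eq_or_lt_of_le ht.1 with h | h
      · rw [← h] at a2; linarith
      · nlinarith [mul_nonneg (sub_nonneg.2 ht.2) (neg_nonneg.2 hq1.le)]
    · push Not at hyZ
      have : (cfg r z A y).2 = 1 := by
        rw [cfg_far hr A]
        intro i
        by_contra hcon
        push Not at hcon
        have := hiso (hc' i) (h1 i) (h2 i y (by linarith [hrρ i])) a1
        have h3 := (hzZ i).2
        rw [← this] at h3
        linarith
      rw [this] at a2
      rcases eq_or_lt_of_le ht.1 with h | h
      · rw [← h] at a2; linarith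
      · nlinarith [mul_nonneg (sub_nonneg.2 ht.2) hyZ.le]
  have hv3 : PF (R + 2) (fun y => (P y, (cfg r z A y).2)) := by
    refine ⟨hPc.prodMk (continuous_snd.comp hcfg.1), fun y => ?_, fun y hy => ?_⟩
    · simpa using key3 1 (by simp) y
    · beta_reduce
      rw [hPfar y hy, hcfg.2.2 y hy]
  refine (HF.linear hv2 hv3.1 hv3.2.2 key3).trans (HF.linear hv3 hcfg.1 hcfg.2.2 ?_)
  intro t ht y h0
  have a1 : (1 - t) • P y + t • (cfg r z A y).1 = 0 := congrArg Prod.fst h0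
  have a2 : (1 - t) * (cfg r z A y).2 + t * (cfg r z A y).2 = 0 := congrArg Prod.snd h0
  have a3 : (cfg r z A y).2 = 0 := by linarith
  by_cases h : ∃ i, ‖y - z i‖ < r
  · obtain ⟨i, hi⟩ := h
    rw [cfg_near hr A hd hi] at a1 a3
    simp only [bub, Prod.fst_add, zero_add, Prod.snd_add] at a1 a3
    have hb : bet r (y - z i) = 1 / 2 := by linarith
    rw [hb] at a1
    have h3 := h2 i y (by linarith [hrρ i])
    have h4 := h1 i (y - z i)
    have h5 : (1 - t / 2) • mv (A i) (y - z i) = -((1 - t) • (P y - mv (A i) (y - z i))) := by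
      rw [eq_neg_iff_add_eq_zero, ← a1]; module
    have h6 := congrArg norm h5
    rw [norm_neg, norm_smul, norm_smul, Real.norm_of_nonneg (by linarith [ht.2]),
      Real.norm_of_nonneg (by linarith [ht.2])] at h6
    have h7 : ‖y - z i‖ ≠ 0 := by
      intro h7
      rw [norm_eq_zero.1 h7, bet_zero] at hb
      norm_num at hb
    have h8 : 0 < ‖y - z i‖ := lt_of_le_of_ne (norm_nonneg _) (Ne.symm h7)
    have h9 : 0 < c' i * ‖y - z i‖ := mul_pos (hc' i) h8
    have h10 : 1 / 2 * (c' i * ‖y - z i‖) ≤ (1 - t / 2) * ‖mv (A i) (y - z i)‖ := by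
      have : 0 ≤ ‖mv (A i) (y - z i)‖ := norm_nonneg _
      nlinarith [ht.2]
    have h11 : (1 - t) * ‖P y - mv (A i) (y - z i)‖ ≤ c' i / 4 * ‖y - z i‖ := by
      nlinarith [ht.1, ht.2, norm_nonneg (P y - mv (A i) (y - z i))]
    nlinarith
  · push Not at h
    rw [cfg_far hr A h] at a3
    norm_num at a3

end sard
end GH

namespace GH
open scoped RealInnerProductSpace Topology

variable {m : ℕ}

/-- the first basis vector -/
def e0 : Euc (m + 1) := EuclideanSpace.single 0 1

theorem e0_zero : (e0 : Euc (m + 1)) 0 = 1 := by simp [e0]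

theorem norm_e0 : ‖(e0 : Euc (m + 1))‖ = 1 := by simp [e0]

theorem coord_le (y : Euc (m + 1)) (i : Fin (m + 1)) : |y i| ≤ ‖y‖ := by
  have := PiLp.norm_apply_le y i
  simpa using this

theorem coord_bub {y : Euc (m + 1)} {a r : ℝ} (h : ‖y - a • e0‖ < r) : |y 0 - a| < r := by
  have := coord_le (y - a • e0) 0
  simp [e0_zero] at this
  linarith

/-- a list of bubbles along the first axis -/
def WS : List Bool → ℝ → Euc (m + 1) → Euc (m + 1) × ℝ
  | [], _, _ => 0
  | b :: l, s, y => bub (1 / 4) (s • e0) (EB b) y + WS l (s + 1) y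

theorem WS_cont (l : List Bool) {X : Type*} [TopologicalSpace X] {s : X → ℝ} {y : X → Euc (m + 1)}
    (hs : Continuous s) (hy : Continuous y) : Continuous fun x => WS l (s x) (y x) := by
  induction l generalizing s with
  | nil => exact continuous_const
  | cons b l ih =>
    have h1 := bub_cont (m := m + 1) (r := fun _ : X => 1 / 4) (z := fun x => s x • e0)
      (A := fun _ => EB b) continuous_const (by norm_num) (hs.smul continuous_const) continuous_const hy
    exact h1.add (ih (hs.add continuous_const))

theorem WS_cases (l : List Bool) (s : ℝ) (y : Euc (m + 1)) :
    WS l s y = 0 ∨ ∃ (i : ℕ) (b : Bool), i < l.length ∧ ‖y - (s + i) • e0‖ < 1 / 4 ∧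
      WS l s y = bub (1 / 4) ((s + i) • e0) (EB b) y := by
  induction l generalizing s with
  | nil => left; rfl
  | cons b l ih =>
    by_cases h : ‖y - s • e0‖ < 1 / 4
    · right
      refine ⟨0, b, by simp, by simpa using h, ?_⟩
      rcases ih (s + 1) with h' | ⟨i, b', hi, hn, -⟩
      · simp [WS, h']
      · exfalso
        have h1 := abs_lt.1 (coord_bub h)
        have h2 := abs_lt.1 (coord_bub hn)
        have : (0:ℝ) ≤ i := Nat.cast_nonneg i
        linarith [h1.1, h1.2, h2.1, h2.2]
    · push Not at h
      have h0 := bub_far (by norm_num) (EB b) h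
      rcases ih (s + 1) with h' | ⟨i, b', hi, hn, he⟩
      · left; rw [WS, h0, h', add_zero]
      · right
        have e : s + 1 + (i : ℝ) = s + ((i + 1 : ℕ) : ℝ) := by push_cast; ring
        rw [e] at hn he
        exact ⟨i + 1, b', by simpa using hi, hn, by rw [WS, h0, zero_add, he]⟩

theorem WS_left (l : List Bool) {s : ℝ} {y : Euc (m + 1)} (h : y 0 ≤ s - 1 / 4) : WS l s y = 0 := by
  rcases WS_cases l s y with h' | ⟨i, b', hi, hn, -⟩
  · exact h'
  · exfalso
    have h2 := abs_lt.1 (coord_bub hn)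
    have : (0:ℝ) ≤ i := Nat.cast_nonneg i
    linarith [h2.1]

theorem WS_right (l : List Bool) {s : ℝ} {y : Euc (m + 1)} (h : s + l.length - 3 / 4 ≤ y 0) :
    WS l s y = 0 := by
  rcases WS_cases l s y with h' | ⟨i, b', hi, hn, -⟩
  · exact h'
  · exfalso
    have h2 := abs_lt.1 (coord_bub hn)
    have : (i:ℝ) + 1 ≤ l.length := by exact_mod_cast hi
    linarith [h2.2]

theorem WS_ne (l : List Bool) (s : ℝ) (y : Euc (m + 1)) : (0, 1) + WS l s y ≠ 0 := by
  rcases WS_cases l s y with h' | ⟨i, b', hi, hn, h'⟩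
  · rw [h']; simp
  · rw [h']; exact bub_ne (EB_det _)

theorem WS_far (l : List Bool) {s : ℝ} {y : Euc (m + 1)} (h : |s| + l.length + 1 ≤ ‖y‖) :
    WS l s y = 0 := by
  rcases WS_cases l s y with h' | ⟨i, b', hi, hn, -⟩
  · exact h'
  · exfalso
    have : (i:ℝ) + 1 ≤ l.length := by exact_mod_cast hi
    have h1 : ‖y‖ ≤ ‖y - (s + i) • e0‖ + ‖(s + i) • (e0 : Euc (m + 1))‖ := by
      have := norm_add_le (y - (s + i) • e0) ((s + i) • e0)
      rwa [sub_add_cancel] at this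
    rw [norm_smul, norm_e0, mul_one, Real.norm_eq_abs] at h1
    have h2 := abs_add_le s i
    rw [abs_of_nonneg (Nat.cast_nonneg i : (0:ℝ) ≤ i)] at h2
    linarith

theorem WS_append (l l' : List Bool) (s : ℝ) (y : Euc (m + 1)) :
    WS (l ++ l') s y = WS l s y + WS l' (s + l.length) y := by
  induction l generalizing s with
  | nil => simp [WS]
  | cons b l ih =>
    simp only [List.cons_append, WS, ih, List.length_cons]
    push_cast
    rw [show s + 1 + (l.length : ℝ) = s + (l.length + 1) by ring, add_assoc]

theorem WS_shift (l : List Bool) (s a : ℝ) (y : Euc (m + 1)) :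
    WS l s (y - a • e0) = WS l (s + a) y := by
  induction l generalizing s with
  | nil => rfl
  | cons b l ih =>
    simp only [WS, ih]
    have : y - a • e0 - s • e0 = y - (s + a) • (e0 : Euc (m + 1)) := by rw [add_smul]; abel
    rw [bub, bub, this, show s + 1 + a = s + a + 1 by ring]

/-- the normal form associated with a list of signs -/
def word (l : List Bool) (y : Euc (m + 1)) : Euc (m + 1) × ℝ := (0, 1) + WS l 0 y

/-- two lists -/
def word2 (l l' : List Bool) (s : ℝ) (y : Euc (m + 1)) : Euc (m + 1) × ℝ := (0, 1) + WS l 0 y + WS l' s y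

theorem word2_PF (l l' : List Bool) {s R : ℝ} (hs : l.length ≤ s) (hR : s + l'.length + 1 ≤ R) :
    PF R (word2 (m := m) l l' s) := by
  refine ⟨?_, fun y => ?_, fun y hy => ?_⟩
  · have h1 := WS_cont (m := m) l (continuous_const (y := (0:ℝ))) continuous_id
    have h2 := WS_cont (m := m) l' (continuous_const (y := s)) continuous_id
    exact (continuous_const.add h1).add h2
  · unfold word2
    rcases le_total (y 0) (s - 1 / 4) with h | h
    · rw [WS_left _ h, add_zero]; exact WS_ne _ _ _
    · rw [WS_right l (by linarith), add_zero]; exact WS_ne _ _ _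
  · have hs0 : 0 ≤ s := le_trans (Nat.cast_nonneg _) hs
    unfold word2
    rw [WS_far l (by rw [abs_zero]; have : (0:ℝ) ≤ l'.length := Nat.cast_nonneg _; linarith), WS_far l' (by rw [abs_of_nonneg hs0]; linarith)]
    simp

theorem word_PF (l : List Bool) : PF (l.length + 1) (word (m := m) l) := by
  have := word2_PF (m := m) l [] le_rfl (R := l.length + 1) (by simp)
  have e : word2 (m := m) l [] l.length = word l := by
    funext y; simp [word2, word, WS]
  rwa [e] at this

theorem cfg_word {k : ℕ} (b : Fin k → Bool) (s : ℝ) (y : Euc (m + 1)) :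
    ∑ i : Fin k, bub (1 / 4) ((s + (i : ℕ)) • e0) (EB (b i)) y = WS (List.ofFn b) s y := by
  induction k generalizing s with
  | zero => simp [WS]
  | succ k ih =>
    rw [Fin.sum_univ_succ, List.ofFn_succ, WS, ← ih]
    congr 1
    · simp
    · refine Finset.sum_congr rfl fun i _ => ?_
      simp only [Fin.val_succ]
      push_cast
      rw [show s + ((i:ℕ) + 1 : ℝ) = s + 1 + (i:ℕ) by ring]

theorem to_word {R : ℝ} {v : Euc (m + 1) → Euc (m + 1) × ℝ} (hv : PF R v) : ∃ l, HF v (word l) := by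
  obtain ⟨k, z₀, A₀, r₀, hr₀, hz₀, hA₀, H⟩ := reduce hv
  set σ := Tuple.sort (fun i => z₀ i 0) with hσ
  have hmono : Monotone ((fun i => z₀ i 0) ∘ σ) := Tuple.monotone_sort _
  choose b hb using fun i => mat_path (A₀ (σ i)) (hA₀ (σ i))
  choose γ hγc hγd hγ0 hγ1 using hb
  set zt : ℝ → Fin k → Euc (m + 1) := fun t i => (1 - t) • z₀ (σ i) + t • (((i : ℕ) : ℝ) • e0) with hzt
  have hztc : ∀ i, Continuous fun t => zt t i := fun i => by simp only [hzt]; fun_prop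
  have hlt : ∀ i j, i < j → ∀ t ∈ Icc (0:ℝ) 1, zt t i ≠ zt t j := by
    intro i j hij t ht heq
    have h1 := congrArg (fun y : Euc (m + 1) => y 0) heq
    simp [hzt, e0_zero] at h1
    have h2 : z₀ (σ i) 0 ≤ z₀ (σ j) 0 := hmono hij.le
    have h3 : ((i:ℕ):ℝ) < (j:ℕ) := by exact_mod_cast hij
    rcases eq_or_lt_of_le ht.1 with h | h
    · rw [← h] at heq
      simp [hzt] at heq
      exact hij.ne (σ.injective (hz₀ heq))
    · nlinarith [mul_nonneg (sub_nonneg.2 ht.2) (sub_nonneg.2 h2)]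
  have hne : ∀ i j, i ≠ j → ∀ t ∈ Icc (0:ℝ) 1, zt t i ≠ zt t j := by
    intro i j hij t ht
    rcases lt_or_gt_of_ne hij with h | h
    · exact hlt i j h t ht
    · exact (hlt j i h t ht).symm
  have hev : ∀ᶠ r in 𝓝[>] (0:ℝ), ∀ i j, i ≠ j → ∀ t ∈ Icc (0:ℝ) 1, 2 * r ≤ ‖zt t i - zt t j‖ := by
    rw [eventually_all]; intro i
    rw [eventually_all]; intro j
    by_cases hij : i = j
    · exact Eventually.of_forall fun r h => absurd hij h
    · obtain ⟨t₀, ht₀, hmin⟩ := isCompact_Icc.exists_isMinOn (nonempty_Icc.2 zero_le_one)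
        (f := fun t => ‖zt t i - zt t j‖) ((hztc i).sub (hztc j)).norm.continuousOn
      have hpos : 0 < ‖zt t₀ i - zt t₀ j‖ := norm_pos_iff.2 (sub_ne_zero.2 (hne i j hij t₀ ht₀))
      have : Ioo 0 (‖zt t₀ i - zt t₀ j‖ / 2) ∈ 𝓝[>] (0:ℝ) := Ioo_mem_nhdsGT (by positivity)
      filter_upwards [this] with r hr _ t ht
      have := hmin ht
      change ‖zt t₀ i - zt t₀ j‖ ≤ ‖zt t i - zt t j‖ at this
      linarith [hr.2]
  have h2 : Ioo 0 (min r₀ (1 / 4)) ∈ 𝓝[>] (0:ℝ) := Ioo_mem_nhdsGT (by positivity)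
  obtain ⟨r, hrz, hr⟩ := (hev.and h2).exists
  have hr1 : r < r₀ := lt_of_lt_of_le hr.2 (min_le_left _ _)
  have hr2 : r < 1 / 4 := lt_of_lt_of_le hr.2 (min_le_right _ _)
  have hbd : ∀ t ∈ Icc (0:ℝ) 1, ∀ i, ‖zt t i‖ ≤ ‖fun i => z₀ (σ i)‖ + k := by
    intro t ht i
    have a1 := norm_le_pi_norm (fun i => z₀ (σ i)) i
    have a2 : ((i:ℕ):ℝ) ≤ k := by exact_mod_cast i.2.le
    have a3 : (0:ℝ) ≤ (i:ℕ) := Nat.cast_nonneg _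
    have a4 := norm_nonneg (z₀ (σ i))
    calc ‖zt t i‖ ≤ ‖(1 - t) • z₀ (σ i)‖ + ‖t • (((i : ℕ) : ℝ) • (e0 : Euc (m + 1)))‖ := norm_add_le _ _
      _ = (1 - t) * ‖z₀ (σ i)‖ + t * (i:ℕ) := by
        rw [norm_smul, norm_smul, norm_smul, norm_e0, Real.norm_of_nonneg (sub_nonneg.2 ht.2),
          Real.norm_of_nonneg ht.1, Real.norm_of_nonneg a3, mul_one]
      _ ≤ _ := by nlinarith [ht.1, ht.2]
  have hk0 : (0:ℝ) ≤ k := Nat.cast_nonneg _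
  have s1 : HF v (cfg r (zt 0) fun i => γ i 0) := by
    have := (H r hr.1 hr1.le).2
    have e : cfg r (zt 0) (fun i => γ i 0) = cfg r z₀ A₀ := by
      funext y
      unfold cfg
      congr 1
      rw [← Equiv.sum_comp σ (fun i => bub r (z₀ i) (A₀ i) y)]
      refine Finset.sum_congr rfl fun i _ => ?_
      beta_reduce; rw [hγ0]; simp [hzt]
    rwa [e]
  have s2 : HF (cfg r (zt 0) fun i => γ i 0) (cfg r (zt 1) fun i => γ i 1) :=
    ⟨‖fun i => z₀ (σ i)‖ + k + 1, by positivity, cfg_htp (r := fun _ => r) (z := zt) (A := fun t i => γ i t)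
      (fun _ => hr.1) continuous_const hztc hγc (fun t ht i j hij => hrz i j hij t ht)
      (fun t ht i => hγd i t ht) (fun t ht i => by have := hbd t ht i; linarith)⟩
  have s3 : HF (cfg r (zt 1) fun i => γ i 1) (cfg (1 / 4) (zt 1) fun i => γ i 1) := by
    have h := cfg_htp (R := ‖fun i => z₀ (σ i)‖ + k + 1) (r := fun t => max r (min (1 / 4) ((1 - t) * r + t * (1 / 4))))
      (z := fun _ => zt 1) (A := fun _ i => γ i 1)
      (fun _ => lt_max_of_lt_left hr.1) (by fun_prop) (fun _ => continuous_const) (fun _ => continuous_const)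
      ?_ (fun t _ i => hγd i 1 (by simp)) ?_
    · refine ⟨‖fun i => z₀ (σ i)‖ + k + 1, by positivity, ?_⟩
      have e1 : max r (min (1 / 4) ((1 - 0) * r + 0 * (1 / 4))) = r := by
        rw [sub_zero, one_mul, zero_mul, add_zero, min_eq_right hr2.le, max_self]
      have e2 : max r (min (1 / 4) ((1 - 1) * r + 1 * (1 / 4))) = 1 / 4 := by
        rw [sub_self, zero_mul, one_mul, zero_add, min_self, max_eq_right hr2.le]
      beta_reduce at h
      rwa [e1, e2] at h
    · intro t ht i j hij
      have e : ‖zt 1 i - zt 1 j‖ = |((i:ℕ):ℝ) - (j:ℕ)| := by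
        simp only [hzt, sub_self, zero_smul, zero_add, one_smul]
        rw [← sub_smul, norm_smul, norm_e0, mul_one, Real.norm_eq_abs]
      have h3 : (1:ℝ) ≤ |((i:ℕ):ℝ) - (j:ℕ)| := by
        have : (1:ℤ) ≤ |((i:ℕ):ℤ) - (j:ℕ)| := Int.one_le_abs (sub_ne_zero.2 (by
          intro h; exact hij (Fin.ext (by exact_mod_cast h))))
        exact_mod_cast this
      have h4 : max r (min (1 / 4) ((1 - t) * r + t * (1 / 4))) ≤ 1 / 4 := max_le hr2.le (min_le_left _ _)
      beta_reduce
      rw [e]; linarith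
    · intro t ht i
      have h4 : max r (min (1 / 4) ((1 - t) * r + t * (1 / 4))) ≤ 1 / 4 := max_le hr2.le (min_le_left _ _)
      have := hbd 1 (by simp) i
      beta_reduce
      linarith
  refine ⟨List.ofFn b, ?_⟩
  have e : cfg (1 / 4) (zt 1) (fun i => γ i 1) = word (List.ofFn b) := by
    funext y
    unfold cfg word
    rw [← cfg_word]
    congr 1
    refine Finset.sum_congr rfl fun i _ => ?_
    beta_reduce; rw [hγ1]; simp [hzt]
  rw [← e]
  exact (s1.trans s2).trans s3

end GH

namespace GH
open scoped RealInnerProductSpace Topology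

variable {m : ℕ}

theorem PF.linear {v v' : Euc m → Euc m × ℝ} {R : ℝ} (hv : PF R v) (hv' : Continuous v')
    (hR' : ∀ y, R ≤ ‖y‖ → v' y = (0, 1))
    (h : ∀ t ∈ Icc (0:ℝ) 1, ∀ y, (1 - t) • v y + t • v' y ≠ 0) : Htp (PF R) v v' := by
  have hvc := hv.1
  refine Htp.of_cont (fun t y => (1 - t) • v y + t • v' y) (by fun_prop) ?_ (by simp) (by simp)
  intro t ht
  refine ⟨by fun_prop, h t ht, fun y hy => ?_⟩
  beta_reduce
  rw [hv.2.2 y hy, hR' y hy, ← add_smul]; simp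

/-- sign -/
def sgn (b : Bool) : ℝ := if b then 1 else -1

theorem sgn_not (b : Bool) : sgn (!b) = - sgn b := by cases b <;> simp [sgn]

theorem sgn_sq (b : Bool) : sgn b * sgn b = 1 := by cases b <;> simp [sgn]

theorem mv_EB (b : Bool) (y : Euc (m + 1)) (i : Fin (m + 1)) :
    mv (EB b) y i = if i = 0 then sgn b * y 0 else y i := by
  simp only [mv, EB, SD, Matrix.mulVec_diagonal, sgn]
  by_cases h : i = 0
  · subst h; simp
  · simp [h, Function.update_of_ne h]

/-- the model field of a cancelling pair -/
def GG (b : Bool) (c : ℝ) (y : Euc (m + 1)) : Euc (m + 1) :=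
  WithLp.toLp 2 (fun i => if i = 0 then - sgn b * ((y 0) ^ 2 - c) else y i)

theorem GG_zero (b : Bool) (c : ℝ) (y : Euc (m + 1)) : GG b c y 0 = - sgn b * ((y 0) ^ 2 - c) := by
  simp [GG]

theorem GG_succ (b : Bool) (c : ℝ) (y : Euc (m + 1)) {i : Fin (m + 1)} (hi : i ≠ 0) : GG b c y i = y i := by
  simp [GG, hi]

theorem GG_cont (b : Bool) (c : ℝ) : Continuous (GG (m := m) b c) := by
  unfold GG
  refine (PiLp.continuous_toLp 2 _).comp (continuous_pi fun i => ?_)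
  by_cases h : i = 0
  · simp only [h, if_true]; fun_prop
  · simp only [h, if_false]; fun_prop

theorem GG_comb (b : Bool) (c c' t : ℝ) (y : Euc (m + 1)) :
    (1 - t) • GG b c y + t • GG b c' y = GG b ((1 - t) * c + t * c') y := by
  ext i
  by_cases h : i = 0
  · subst h; simp [GG_zero]; ring
  · simp [GG_succ _ _ _ h]; ring

/-- vectors on the axis -/
theorem axis {y : Euc (m + 1)} (h : ∀ i, i ≠ 0 → y i = 0) : y = (y 0) • e0 := by
  ext i
  by_cases hi : i = 0
  · subst hi; simp [e0_zero]
  · rw [h i hi]; simp [e0, hi]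

theorem GG_eq_zero {b : Bool} {c : ℝ} {y : Euc (m + 1)} (h : GG b c y = 0) :
    y = (y 0) • e0 ∧ (y 0) ^ 2 = c := by
  constructor
  · apply axis
    intro i hi
    rw [← GG_succ b c y hi, h]; rfl
  · have h0 := GG_zero b c y
    rw [h] at h0
    have := sgn_sq b
    simp only [PiLp.zero_apply] at h0
    have h1 : sgn b * sgn b * ((y 0) ^ 2 - c) = 0 := by linear_combination (sgn b) * h0
    rw [this, one_mul] at h1; linarith

/-- cancelling pair -/
def pair (b : Bool) (y : Euc (m + 1)) : Euc (m + 1) × ℝ :=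
  (0, 1) + (bub (1 / 4) ((-(1 / 2) : ℝ) • e0) (EB b) y + bub (1 / 4) ((1 / 2 : ℝ) • e0) (EB !b) y)

theorem pair_cases (b : Bool) (y : Euc (m + 1)) : (pair b y = (0, 1) ∧ ∀ a : ℝ, a ^ 2 = 1 / 4 → y ≠ a • e0) ∨
    ∃ (a : ℝ) (b' : Bool), a ^ 2 = 1 / 4 ∧ sgn b' = -2 * a * sgn b ∧ ‖y - a • e0‖ < 1 / 4 ∧
      pair b y = (0, 1) + bub (1 / 4) (a • e0) (EB b') y := by
  by_cases h1 : ‖y - (-(1 / 2) : ℝ) • e0‖ < 1 / 4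
  · right
    refine ⟨-(1 / 2), b, by norm_num, by ring, h1, ?_⟩
    have h2 : 1 / 4 ≤ ‖y - (1 / 2 : ℝ) • e0‖ := by
      by_contra h; push Not at h
      have a1 := abs_lt.1 (coord_bub h1)
      have a2 := abs_lt.1 (coord_bub h)
      linarith [a1.2, a2.1]
    rw [pair, bub_far (by norm_num) _ h2, add_zero]
  push Not at h1
  by_cases h2 : ‖y - (1 / 2 : ℝ) • e0‖ < 1 / 4
  · right
    refine ⟨1 / 2, !b, by norm_num, by rw [sgn_not]; ring, h2, ?_⟩
    rw [pair, bub_far (by norm_num) _ h1, zero_add]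
  push Not at h2
  left
  constructor
  · rw [pair, bub_far (by norm_num) _ h1, bub_far (by norm_num) _ h2]; simp
  · rintro a ha rfl
    have : a = 1 / 2 ∨ a = -(1 / 2) := by
      rw [← sq_eq_sq_iff_eq_or_eq_neg, ha]; norm_num
    rcases this with rfl | rfl
    · norm_num at h2
    · norm_num at h1

theorem pair_PF (b : Bool) : PF 1 (pair (m := m) b) := by
  refine ⟨?_, fun y => ?_, fun y hy => ?_⟩
  · unfold pair
    have h : ∀ a : ℝ, ∀ b, Continuous (fun y => bub (m := m + 1) (1 / 4) (a • e0) (EB b) y) := fun a b =>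
      bub_cont continuous_const (by norm_num) continuous_const continuous_const continuous_id
    exact continuous_const.add ((h _ _).add (h _ _))
  · rcases pair_cases b y with ⟨h, -⟩ | ⟨a, b', -, -, -, h⟩
    · rw [h]; simp
    · rw [h]; exact bub_ne (EB_det _)
  · rcases pair_cases b y with ⟨h, -⟩ | ⟨a, b', ha, -, hn, h⟩
    · exact h
    · exfalso
      have h1 : ‖y‖ ≤ ‖y - a • e0‖ + ‖a • (e0 : Euc (m + 1))‖ := by
        have := norm_add_le (y - a • e0) (a • e0)
        rwa [sub_add_cancel] at this
      rw [norm_smul, norm_e0, mul_one, Real.norm_eq_abs] at h1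
      have : |a| ≤ 1 / 2 := abs_le_of_sq_le_sq (by rw [ha]; norm_num) (by norm_num)
      linarith

/-- cutoff -/
def ch (a c : ℝ) (y : Euc m) : ℝ := max 0 (min 1 (c * (a - ‖y‖)))

theorem ch_cont (a c : ℝ) : Continuous (ch (m := m) a c) := by unfold ch; fun_prop

theorem ch_zero {a c : ℝ} (hc : 0 ≤ c) {y : Euc m} (h : a ≤ ‖y‖) : ch a c y = 0 := by
  unfold ch
  apply max_eq_left
  apply (min_le_right _ _).trans
  nlinarith

theorem ch_one {a c : ℝ} {y : Euc m} (h : 1 ≤ c * (a - ‖y‖)) : ch a c y = 1 := by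
  unfold ch
  rw [min_eq_left h]; norm_num

theorem ch_ne {a c : ℝ} (hc : 0 ≤ c) {y : Euc m} (h : ch a c y ≠ 0) : ‖y‖ < a := by
  by_contra h'
  push Not at h'
  exact h (ch_zero hc h')

theorem pair_htp (b : Bool) : Htp (PF 1) (pair (m := m) b) (fun _ => (0, 1)) := by
  set χ : Euc (m + 1) → ℝ := ch 1 8 with hχ
  set q : Euc (m + 1) → ℝ := fun y => 1 - 2 * ch (3 / 4) 4 y with hq
  have hχc : Continuous χ := ch_cont _ _
  have hqc : Continuous q := continuous_const.sub (continuous_const.mul (ch_cont _ _))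
  have hχ0 : ∀ y, 1 ≤ ‖y‖ → χ y = 0 := fun y hy => ch_zero (by norm_num) hy
  have hq1 : ∀ y, 1 ≤ ‖y‖ → q y = 1 := fun y hy => by
    simp only [hq]; rw [ch_zero (by norm_num) (by linarith)]; norm_num
  have hqχ : ∀ y, χ y = 0 → q y = 1 := fun y hy => by
    by_contra h
    have h1 : ch (3 / 4) 4 y ≠ 0 := fun h' => h (by simp [hq, h'])
    have h2 := ch_ne (by norm_num) h1
    have : χ y = 1 := ch_one (by linarith)
    rw [this] at hy; norm_num at hy
  have hqn : ∀ y, ‖y‖ ≤ 1 / 2 → q y = -1 := fun y hy => by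
    simp only [hq]; rw [ch_one (by linarith)]; norm_num
  have hp := pair_PF (m := m) b
  have hpc := hp.1
  have hG := GG_cont (m := m) b
  have hpχ : ∀ y, χ y = 0 → (pair b y).2 = 1 := fun y hy => by
    have h1 : 1 ≤ ‖y‖ := by
      by_contra h
      push Not at h
      have : 0 < χ y := by
        simp only [hχ, ch]
        exact lt_max_of_lt_right (lt_min one_pos (by linarith))
      linarith
    rw [hp.2.2 y h1]
  -- step one
  have k1 : ∀ t ∈ Icc (0:ℝ) 1, ∀ y, (1 - t) • pair b y + t • (χ y • GG b (1 / 4) y, (pair b y).2) ≠ 0 := by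
    intro t ht y h0
    have a1 : (1 - t) • (pair b y).1 + t • χ y • GG b (1 / 4) y = 0 := congrArg Prod.fst h0
    have a2 : (1 - t) * (pair b y).2 + t * (pair b y).2 = 0 := congrArg Prod.snd h0
    have a3 : (pair b y).2 = 0 := by linarith
    rcases pair_cases b y with ⟨h, -⟩ | ⟨a, b', ha, hb', hn, h⟩
    · rw [h] at a3; norm_num at a3
    · rw [h] at a1 a3
      simp only [bub, Prod.fst_add, zero_add, Prod.snd_add] at a1 a3
      have hb : bet (1 / 4) (y - a • e0) = 1 / 2 := by linarith
      rw [hb] at a1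
      have h1 : ‖y‖ ≤ ‖y - a • e0‖ + ‖a • (e0 : Euc (m + 1))‖ := by
        have := norm_add_le (y - a • e0) (a • e0)
        rwa [sub_add_cancel] at this
      rw [norm_smul, norm_e0, mul_one, Real.norm_eq_abs] at h1
      have : |a| ≤ 1 / 2 := abs_le_of_sq_le_sq (by rw [ha]; norm_num) (by norm_num)
      have hχ1 : χ y = 1 := ch_one (by linarith)
      rw [hχ1, one_smul] at a1
      have hi : ∀ i, i ≠ 0 → y i = 0 := by
        intro i hi
        have := congrArg (fun y : Euc (m + 1) => y i) a1
        simp only [PiLp.add_apply, PiLp.smul_apply, PiLp.zero_apply, mv_EB, GG_succ _ _ _ hi, hi, if_false,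
          smul_eq_mul, PiLp.sub_apply] at this
        simp [e0, hi] at this
        have h3 : ((1 - t) / 2 + t) * y i = 0 := by linear_combination this
        rcases mul_eq_zero.1 h3 with h4 | h4
        · linarith [ht.1, ht.2]
        · exact h4
      have h0 := congrArg (fun y : Euc (m + 1) => y 0) a1
      simp only [PiLp.add_apply, PiLp.smul_apply, PiLp.zero_apply, mv_EB, GG_zero, if_true,
          smul_eq_mul, PiLp.sub_apply, e0_zero, hb'] at h0
      have hs := sgn_sq b
      have h5 : (y 0 - a) * ((1 - t) * a ^ 2 + t * (a * y 0 + a ^ 2)) = 0 := by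
        rw [← ha] at h0
        have : (sgn b * sgn b) * ((y 0 - a) * ((1 - t) * a ^ 2 + t * (a * y 0 + a ^ 2))) = 0 := by
          linear_combination (- sgn b * a) * h0
        rwa [hs, one_mul] at this
      have hy0 : y 0 - a = 0 := by
        rcases mul_eq_zero.1 h5 with h6 | h6
        · exact h6
        · exfalso
          have h7 := coord_bub hn
          have h8 : |a * (y 0 - a)| ≤ 1 / 2 * (1 / 4) := by
            rw [abs_mul]; exact mul_le_mul this h7.le (abs_nonneg _) (by norm_num)
          have h9 := (abs_le.1 h8).1
          nlinarith [ht.1, ht.2]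
      have hye : y - a • e0 = 0 := by
        have := axis hi
        rw [sub_eq_zero.1 hy0] at this
        rw [sub_eq_zero]; exact this
      rw [hye, bet_zero] at hb
      norm_num at hb
  have p1 := PF.linear hp (v' := fun y => (χ y • GG b (1 / 4) y, (pair b y).2))
    ((hχc.smul (hG _)).prodMk (continuous_snd.comp hpc))
    (fun y hy => by beta_reduce; rw [hχ0 y hy, hp.2.2 y hy, zero_smul]) k1
  have p2 := PF.linear (p1.prop.2) (v' := fun y => (χ y • GG b (1 / 4) y, q y))
    ((hχc.smul (hG _)).prodMk hqc)
    (fun y hy => by beta_reduce; rw [hχ0 y hy, hq1 y hy, zero_smul]) (by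
      intro t ht y h0
      have a1 : (1 - t) • χ y • GG b (1 / 4) y + t • χ y • GG b (1 / 4) y = 0 := congrArg Prod.fst h0
      have a2 : (1 - t) * (pair b y).2 + t * q y = 0 := congrArg Prod.snd h0
      rw [← add_smul, sub_add_cancel, one_smul] at a1
      rcases smul_eq_zero.1 a1 with h | h
      · rw [hpχ y h, hqχ y h] at a2; linarith
      · obtain ⟨hy, hy2⟩ := GG_eq_zero h
        have hny : ‖y‖ = |y 0| := by
          conv_lhs => rw [hy]
          rw [norm_smul, norm_e0, mul_one, Real.norm_eq_abs]
        have hn : ‖y‖ ≤ 1 / 2 := by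
          rw [hny]; exact abs_le_of_sq_le_sq (by rw [hy2]; norm_num) (by norm_num)
        rcases pair_cases b y with ⟨-, h⟩ | ⟨a, b', ha, hb', hn', h⟩
        · exact h _ hy2 hy
        · have h7 := abs_lt.1 (coord_bub hn')
          have hya : y 0 = a := by
            rcases sq_eq_sq_iff_eq_or_eq_neg.1 (hy2.trans ha.symm) with h | h
            · exact h
            · exfalso; nlinarith [h7.1, h7.2]
          have : (pair b y).2 = -1 := by
            rw [h]
            have : y - a • e0 = 0 := by rw [← hya, sub_eq_zero]; exact hy
            simp only [bub, Prod.snd_add, this, bet_zero]; norm_num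
          rw [this, hqn y hn] at a2; linarith)
  have p3 := PF.linear (p2.prop.2) (v' := fun y => (χ y • GG b (-3 / 4) y, q y))
    ((hχc.smul (hG _)).prodMk hqc)
    (fun y hy => by beta_reduce; rw [hχ0 y hy, hq1 y hy, zero_smul]) (by
      intro t ht y h0
      have a1 : (1 - t) • χ y • GG b (1 / 4) y + t • χ y • GG b (-3 / 4) y = 0 := congrArg Prod.fst h0
      have a2 : (1 - t) * q y + t * q y = 0 := congrArg Prod.snd h0
      rw [smul_comm (1 - t), smul_comm t, ← smul_add, GG_comb] at a1
      rcases smul_eq_zero.1 a1 with h | h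
      · rw [hqχ y h] at a2; linarith
      · obtain ⟨hy, hy2⟩ := GG_eq_zero h
        have hny : ‖y‖ = |y 0| := by
          conv_lhs => rw [hy]
          rw [norm_smul, norm_e0, mul_one, Real.norm_eq_abs]
        have hn : ‖y‖ ≤ 1 / 2 := by
          rw [hny]; exact abs_le_of_sq_le_sq (by rw [hy2]; linarith [ht.1]) (by norm_num)
        rw [hqn y hn] at a2; linarith)
  have p4 := PF.linear (p3.prop.2) (v' := fun y => (0, 1)) continuous_const (fun y hy => rfl) (by
      intro t ht y h0
      have a1 : (1 - t) • χ y • GG b (-3 / 4) y + t • 0 = 0 := congrArg Prod.fst h0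
      have a2 : (1 - t) * q y + t * 1 = 0 := congrArg Prod.snd h0
      rw [smul_zero, add_zero] at a1
      rcases smul_eq_zero.1 a1 with h | h
      · rw [h] at a2; linarith
      rcases smul_eq_zero.1 h with h | h
      · rw [hqχ y h] at a2; linarith
      · obtain ⟨hy, hy2⟩ := GG_eq_zero h
        nlinarith [sq_nonneg (y 0)])
  exact ((p1.trans p2).trans p3).trans p4

theorem word_cancel (l l' : List Bool) (b : Bool) :
    HF (word (m := m) (l ++ b :: (!b) :: l')) (word (l ++ l')) := by
  set N : ℝ := (l.length : ℝ) with hN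
  have hN0 : 0 ≤ N := Nat.cast_nonneg _
  have hL0 : (0:ℝ) ≤ l'.length := Nat.cast_nonneg _
  have e1 : word (m := m) (l ++ b :: (!b) :: l') =
      uu (word2 l l' (N + 2)) (fun y => pair b (y - (N + 1 / 2) • e0)) := by
    funext y
    have hb : ∀ a a' : ℝ, ∀ b, bub (1 / 4) (a • e0) (EB b) (y - a' • e0) =
        bub (1 / 4) ((a + a') • e0) (EB b) y := by
      intro a a' b
      have : y - a' • e0 - a • e0 = y - (a + a') • (e0 : Euc (m + 1)) := by rw [add_smul]; abel
      rw [bub, bub, this]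
    simp only [word, uu, word2, pair, WS_append, WS, hb, ← hN]
    rw [show (-(1 / 2) : ℝ) + (N + 1 / 2) = 0 + N by ring, show (1 / 2 : ℝ) + (N + 1 / 2) = 0 + N + 1 by ring,
      show 0 + N + 1 + 1 = N + 2 by ring]
    abel
  have e2 : word2 (m := m) l l' (N + 2) = uu (word2 l l' (N + 2)) (fun y => (0, 1)) := by
    funext y; simp [uu]
  have e3 : word2 (m := m) l l' N = word (l ++ l') := by
    funext y
    simp [word2, word, WS_append, hN, add_assoc]
  have s1 : HF (word (m := m) (l ++ b :: (!b) :: l')) (word2 l l' (N + 2)) := by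
    rw [e1]
    nth_rewrite 2 [e2]
    refine HF.localize (word2_PF l l' (by linarith) le_rfl) ((N + 1 / 2) • e0) (fun y hy => ?_) (pair_htp b)
    have h1 := coord_le (y - (N + 1 / 2) • e0) 0
    simp only [PiLp.sub_apply, PiLp.smul_apply, e0_zero, smul_eq_mul, mul_one] at h1
    have h2 := abs_le.1 (h1.trans hy)
    rw [word2, WS_right l (by linarith [h2.1]), WS_left l' (by linarith [h2.2])]
    simp
  refine s1.trans ⟨N + 2 + l'.length + 1, by positivity, ?_⟩
  rw [← e3]
  refine Htp.of_cont (fun t y => word2 l l' (N + 2 - 2 * t) y) ?_ (fun t ht => ?_) ?_ ?_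
  · unfold word2
    have h1 := WS_cont (m := m) l (X := ℝ × Euc (m + 1)) (continuous_const (y := (0:ℝ))) continuous_snd
    have h2 := WS_cont (m := m) l' (X := ℝ × Euc (m + 1)) (s := fun z => N + 2 - 2 * z.1)
      (by fun_prop) continuous_snd
    exact (continuous_const.add h1).add h2
  · exact word2_PF l l' (by linarith [ht.2]) (by linarith [ht.1])
  · simp
  · simp

theorem list_cases (l : List Bool) : (∃ j b, l = List.replicate j b) ∨
    ∃ (l₁ l₂ : List Bool) (b : Bool), l = l₁ ++ b :: (!b) :: l₂ := by
  induction l with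
  | nil => left; exact ⟨0, true, rfl⟩
  | cons a l ih =>
    rcases ih with ⟨j, b, rfl⟩ | ⟨l₁, l₂, b, rfl⟩
    · by_cases h : a = b
      · left; exact ⟨j + 1, b, by rw [h]; rfl⟩
      · cases j with
        | zero => left; exact ⟨1, a, rfl⟩
        | succ j =>
          right
          have : b = !a := by cases a <;> cases b <;> simp_all
          exact ⟨[], List.replicate j b, a, by rw [List.replicate_succ, ← this]; rfl⟩
    · right; exact ⟨a :: l₁, l₂, b, rfl⟩

theorem word_normal (k : ℕ) : ∀ l : List Bool, l.length ≤ k →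
    ∃ j b, HF (word (m := m) l) (word (List.replicate j b)) := by
  induction k with
  | zero =>
    intro l hl
    have : l = [] := List.length_eq_zero_iff.1 (by omega)
    subst this
    exact ⟨0, true, HF.refl (word_PF [])⟩
  | succ k ih =>
    intro l hl
    rcases list_cases l with ⟨j, b, rfl⟩ | ⟨l₁, l₂, b, rfl⟩
    · exact ⟨j, b, HF.refl (word_PF _)⟩
    · obtain ⟨j, b', h⟩ := ih (l₁ ++ l₂) (by simp at hl ⊢; omega)
      exact ⟨j, b', (word_cancel l₁ l₂ b).trans h⟩

theorem to_normal {R : ℝ} {v : Euc (m + 1) → Euc (m + 1) × ℝ} (hv : PF R v) :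
    ∃ j b, HF v (word (List.replicate j b)) := by
  obtain ⟨l, h⟩ := to_word hv
  obtain ⟨j, b, h'⟩ := word_normal _ l le_rfl
  exact ⟨j, b, h.trans h'⟩

end GH

namespace GH
open scoped RealInnerProductSpace Topology

section
variable {m : ℕ}

/-- radial cutoff -/
def kap (x : Euc m) : ℝ := max 0 (min 1 (2 * ‖x‖ - 1))

theorem kap_cont : Continuous (kap (m := m)) := by unfold kap; fun_prop

theorem kap_zero {x : Euc m} (h : ‖x‖ ≤ 1 / 2) : kap x = 0 := by
  unfold kap
  exact max_eq_left ((min_le_right _ _).trans (by linarith))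

theorem kap_one {x : Euc m} (h : 1 ≤ ‖x‖) : kap x = 1 := by
  unfold kap
  rw [min_eq_left (by linarith)]; norm_num

/-- the vector field on the ball associated with formal data -/
def FV (v : Euc m → Euc m × ℝ) (x : Euc (m + 1)) : Euc (m + 1) := x + kap x • (YY v x - x)

theorem FV_small (v : Euc m → Euc m × ℝ) {x : Euc (m + 1)} (h : ‖x‖ ≤ 1 / 2) : FV v x = x := by
  simp [FV, kap_zero h]

theorem FV_one (v : Euc m → Euc m × ℝ) {x : Euc (m + 1)} (h : 1 ≤ ‖x‖) : FV v x = YY v x := by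
  simp [FV, kap_one h]

theorem FV_cont {X : Type*} [TopologicalSpace X] {v : X → Euc m → Euc m × ℝ} {R : ℝ}
    (hc : Continuous (fun z : X × Euc m => v z.1 z.2)) (hv : ∀ t y, R ≤ ‖y‖ → v t y = (0, 1)) :
    Continuous (fun z : X × Euc (m + 1) => FV (v z.1) z.2) := by
  rw [continuous_iff_continuousAt]
  rintro ⟨t, x⟩
  by_cases hx : x = 0
  · have hev : ∀ᶠ z : X × Euc (m + 1) in 𝓝 (t, x), ‖z.2‖ < 1 / 2 :=
      (isOpen_lt (continuous_snd.norm) continuous_const).mem_nhds (by simp [hx])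
    refine (continuous_snd.continuousAt (x := (t, x))).congr ?_
    filter_upwards [hev] with z hz
    exact (FV_small _ hz.le).symm
  · have h1 := YY_contAt hc hv t hx
    have h2 : ContinuousAt (fun z : X × Euc (m + 1) => z.2) (t, x) := continuous_snd.continuousAt
    have h3 : ContinuousAt (fun z : X × Euc (m + 1) => kap z.2) (t, x) :=
      (kap_cont.comp continuous_snd).continuousAt
    exact h2.add (h3.smul (h1.sub h2))

theorem PF.FV_cont {v : Euc m → Euc m × ℝ} {R : ℝ} (hv : PF R v) : Continuous (FV v) := by
  have hvc := hv.1
  have := GH.FV_cont (X := Unit) (v := fun _ => v) (R := R) (hvc.comp continuous_snd) (fun _ => hv.2.2)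
  exact this.comp (f := fun x => ((), x)) (by fun_prop)

theorem FV_congr {v v' : Euc m → Euc m × ℝ} {x : Euc (m + 1)} (h : ht x < ‖x‖ → v (st x) = v' (st x)) :
    FV v x = FV v' x := by
  unfold FV YY
  split_ifs with h'
  · rw [h h']
  · rfl

theorem FV_triv {v : Euc m → Euc m × ℝ} {x : Euc (m + 1)} (h : ht x < ‖x‖ → v (st x) = (0, 1)) :
    FV v x = x := by
  unfold FV YY
  split_ifs with h'
  · rw [h h']; simp [AA_zero]
  · simp
end

section
variable {m : ℕ} (D : DegreeTheory (m + 1 + 1))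

/-- the degree of formal data, normalized to vanish on trivial data -/
def dg (v : Euc (m + 1) → Euc (m + 1) × ℝ) : ℤ := D.deg (FV v) (ball 0 1) - 1

theorem dg_HF {v v' : Euc (m + 1) → Euc (m + 1) × ℝ} (h : HF v v') : dg D v = dg D v' := by
  obtain ⟨R, hR, h, hc, hP, rfl, rfl⟩ := h
  unfold dg
  congr 1
  refine deg_htp_ball D (h := fun t => FV (h t)) one_pos (FV_cont hc fun t => (hP t).2.2) fun t _ x hx => ?_
  beta_reduce
  rw [FV_one _ hx.ge]
  exact YY_ne (hP t).2.1 (by rintro rfl; simp at hx)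

theorem deg_YY {v : Euc (m + 1) → Euc (m + 1) × ℝ} {R : ℝ} (hv : PF R v)
    {f : Euc (m + 1 + 1) → Euc (m + 1 + 1)} (hf : Continuous f) (h : ∀ x, ‖x‖ = 1 → f x = YY v x) :
    D.deg f (ball 0 1) = 1 + dg D v := by
  have hc := hv.FV_cont
  have := deg_htp_ball D (h := fun t x => (1 - t) • f x + t • FV v x) one_pos (by fun_prop) (fun t _ x hx => by
    beta_reduce
    rw [h x hx, FV_one _ hx.ge, ← add_smul, sub_add_cancel, one_smul]
    exact YY_ne hv.2.1 (by rintro rfl; simp at hx))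
  simp at this
  unfold dg
  rw [this]; ring

/-- the separating function -/
def gs (c : ℝ) (x : Euc (m + 1 + 1)) : ℝ := pr x 0 - c * (‖x‖ - ht x)

theorem gs_cont (c : ℝ) : Continuous (gs (m := m) c) := by unfold gs; fun_prop

theorem st_zero {c : ℝ} {x : Euc (m + 1 + 1)} (hx : ht x < ‖x‖) : gs c x = (‖x‖ - ht x) * (st x 0 - c) := by
  have : ‖x‖ - ht x ≠ 0 := by linarith
  simp only [gs, st, PiLp.smul_apply, smul_eq_mul]
  field_simp

/-- the left part -/
def OL (c : ℝ) : Set (Euc (m + 1 + 1)) := {x | 1 / 4 < ‖x‖ ∧ ‖x‖ < 1 ∧ gs c x < 0}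
/-- the right part -/
def OR (c : ℝ) : Set (Euc (m + 1 + 1)) := {x | 1 / 4 < ‖x‖ ∧ ‖x‖ < 1 ∧ 0 < gs c x}

theorem OL_open (c : ℝ) : IsOpen (OL (m := m) c) :=
  (isOpen_lt continuous_const continuous_norm).inter ((isOpen_lt continuous_norm continuous_const).inter
    (isOpen_lt (gs_cont c) continuous_const))
theorem OR_open (c : ℝ) : IsOpen (OR (m := m) c) :=
  (isOpen_lt continuous_const continuous_norm).inter ((isOpen_lt continuous_norm continuous_const).inter
    (isOpen_lt continuous_const (gs_cont c)))

theorem OL_closure (c : ℝ) : closure (OL (m := m) c) ⊆ {x | 1 / 4 ≤ ‖x‖ ∧ ‖x‖ ≤ 1 ∧ gs c x ≤ 0} :=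
  closure_minimal (fun _ hx => ⟨hx.1.le, hx.2.1.le, hx.2.2.le⟩)
    ((isClosed_le continuous_const continuous_norm).inter ((isClosed_le continuous_norm continuous_const).inter
    (isClosed_le (gs_cont c) continuous_const)))
theorem OR_closure (c : ℝ) : closure (OR (m := m) c) ⊆ {x | 1 / 4 ≤ ‖x‖ ∧ ‖x‖ ≤ 1 ∧ 0 ≤ gs c x} :=
  closure_minimal (fun _ hx => ⟨hx.1.le, hx.2.1.le, hx.2.2.le⟩)
    ((isClosed_le continuous_const continuous_norm).inter ((isClosed_le continuous_norm continuous_const).inter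
    (isClosed_le continuous_const (gs_cont c))))

theorem OL_sub (c : ℝ) : OL (m := m) c ⊆ ball 0 1 := fun x hx => by simpa using hx.2.1
theorem OR_sub (c : ℝ) : OR (m := m) c ⊆ ball 0 1 := fun x hx => by simpa using hx.2.1

/-- no zeros outside -/
theorem FV_ne {v : Euc (m + 1) → Euc (m + 1) × ℝ} {R c : ℝ} (hv : PF R v) (hvc : ∀ y, y 0 = c → v y = (0, 1))
    {x : Euc (m + 1 + 1)} (h1 : 1 / 4 ≤ ‖x‖) (h2 : ‖x‖ ≤ 1) (hL : x ∉ OL c) (hR : x ∉ OR c) : FV v x ≠ 0 := by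
  have hx0 : x ≠ 0 := by rintro rfl; norm_num at h1
  rcases eq_or_lt_of_le h2 with h | h
  · rw [FV_one _ h.ge]; exact YY_ne hv.2.1 hx0
  rcases eq_or_lt_of_le h1 with h' | h'
  · rw [FV_small _ (by linarith)]; exact hx0
  have hg : gs c x = 0 := by
    rcases lt_trichotomy (gs c x) 0 with h3 | h3 | h3
    · exact absurd ⟨h', h, h3⟩ hL
    · exact h3
    · exact absurd ⟨h', h, h3⟩ hR
  rw [FV_triv]
  · exact hx0
  · intro hU
    apply hvc
    rw [st_zero hU] at hg
    rcases mul_eq_zero.1 hg with h3 | h3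
    · linarith
    · linarith

theorem dg_split {v : Euc (m + 1) → Euc (m + 1) × ℝ} {R c : ℝ} (hv : PF R v)
    (hvc : ∀ y, y 0 = c → v y = (0, 1)) : dg D v = D.deg (FV v) (OL c) + D.deg (FV v) (OR c) := by
  have hc := hv.FV_cont
  have hLRo := (OL_open (m := m) c).union (OR_open c)
  have hLRs : OL (m := m) c ∪ OR c ⊆ ball 0 1 := union_subset (OL_sub c) (OR_sub c)
  have h1 := D.additive (FV v) (ball 0 1) (ball 0 (1 / 4)) (OL c ∪ OR c) isOpen_ball isBounded_ball isOpen_ball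
    hLRo (ball_subset_ball (by norm_num)) hLRs
    (by
      rw [Set.disjoint_left]
      intro x hx hx'
      have : ‖x‖ < 1 / 4 := by simpa using hx
      rcases hx' with h | h <;> linarith [h.1])
    hc.continuousOn (by
      intro x hx
      rw [closure_ball _ one_ne_zero] at hx
      have h3 : ‖x‖ ≤ 1 := by simpa using hx.1
      have h4 := hx.2
      simp only [mem_union, not_or] at h4
      exact FV_ne hv hvc (by simpa using h4.1) h3 h4.2.1 h4.2.2)
  have h2 := D.additive (FV v) (OL c ∪ OR c) (OL c) (OR c) hLRo (isBounded_ball.subset hLRs) (OL_open c)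
    (OR_open c) subset_union_left subset_union_right
    (by
      rw [Set.disjoint_left]
      intro x hx hx'
      linarith [hx.2.2, hx'.2.2])
    hc.continuousOn (by
      intro x hx
      rw [closure_union] at hx
      have h4 := hx.2
      simp only [mem_union, not_or] at h4
      rcases hx.1 with h | h
      · exact FV_ne hv hvc (OL_closure c h).1 (OL_closure c h).2.1 h4.1 h4.2
      · exact FV_ne hv hvc (OR_closure c h).1 (OR_closure c h).2.1 h4.1 h4.2)
  have h3 : D.deg (FV v) (ball 0 (1 / 4)) = 1 := by
    rw [deg_congr_ball D (g := id) (by norm_num) hc, D.normalized _ isOpen_ball isBounded_ball (by simp)]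
    · intro x hx
      rw [FV_small _ (by linarith)]; rintro rfl; norm_num at hx
    · intro x hx
      rw [FV_small _ (by linarith)]; rfl
  unfold dg
  rw [h1, h2, h3]; ring

theorem dg_uu {v v' : Euc (m + 1) → Euc (m + 1) × ℝ} {R c : ℝ} (hv : PF R v) (hv' : PF R v')
    (h : ∀ y, c ≤ y 0 → v y = (0, 1)) (h' : ∀ y, y 0 ≤ c → v' y = (0, 1)) :
    dg D (uu v v') = dg D v + dg D v' := by
  have hw : PF R (uu v v') := hv.uu hv' fun y => by
    rcases le_total c (y 0) with h1 | h1
    · left; exact h y h1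
    · right; exact h' y h1
  have hvc : ∀ y, y 0 = c → v y = (0, 1) := fun y hy => h y hy.ge
  have hvc' : ∀ y, y 0 = c → v' y = (0, 1) := fun y hy => h' y hy.le
  have hwc : ∀ y, y 0 = c → uu v v' y = (0, 1) := fun y hy => by
    rw [uu, hvc y hy, hvc' y hy]; simp
  rw [dg_split D hw hwc, dg_split D hv hvc, dg_split D hv' hvc']
  have hstL : ∀ x : Euc (m + 1 + 1), x ∈ closure (OL c) → ht x < ‖x‖ → st x 0 ≤ c := by
    intro x hx hU
    have := (OL_closure c hx).2.2
    rw [st_zero hU] at this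
    by_contra hcon
    push Not at hcon
    nlinarith [mul_pos (sub_pos.2 hU) (sub_pos.2 hcon)]
  have hstR : ∀ x : Euc (m + 1 + 1), x ∈ closure (OR c) → ht x < ‖x‖ → c ≤ st x 0 := by
    intro x hx hU
    have := (OR_closure c hx).2.2
    rw [st_zero hU] at this
    by_contra hcon
    push Not at hcon
    nlinarith [mul_pos (sub_pos.2 hU) (sub_pos.2 hcon)]
  have hneL : ∀ {x : Euc (m + 1 + 1)}, x ∈ closure (OL c) → x ≠ 0 := by
    rintro x hx rfl
    have := (OL_closure c hx).1
    norm_num at this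
  have hneR : ∀ {x : Euc (m + 1 + 1)}, x ∈ closure (OR c) → x ≠ 0 := by
    rintro x hx rfl
    have := (OR_closure c hx).1
    norm_num at this
  have bL : Bornology.IsBounded (OL (m := m) c) := isBounded_ball.subset (OL_sub c)
  have bR : Bornology.IsBounded (OR (m := m) c) := isBounded_ball.subset (OR_sub c)
  have e1 : D.deg (FV v) (OR c) = 0 := deg_eq_zero D (OR_open c) bR hv.FV_cont.continuousOn fun x hx => by
    rw [FV_triv fun hU => h _ (hstR x hx hU)]; exact hneR hx
  have e2 : D.deg (FV v') (OL c) = 0 := deg_eq_zero D (OL_open c) bL hv'.FV_cont.continuousOn fun x hx => by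
    rw [FV_triv fun hU => h' _ (hstL x hx hU)]; exact hneL hx
  have e3 : D.deg (FV (uu v v')) (OL c) = D.deg (FV v) (OL c) := by
    refine deg_congr D (OL_open c) bL hw.FV_cont.continuousOn (fun x hx => ?_) fun x hx => ?_
    · rw [(OL_open c).frontier_eq] at hx
      have h3 := OL_closure c hx.1
      refine FV_ne hw hwc h3.1 h3.2.1 hx.2 fun h4 => ?_
      linarith [h4.2.2, h3.2.2]
    · refine FV_congr fun hU => ?_
      rw [uu, h' _ (hstL x hx hU)]; simp
  have e4 : D.deg (FV (uu v v')) (OR c) = D.deg (FV v') (OR c) := by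
    refine deg_congr D (OR_open c) bR hw.FV_cont.continuousOn (fun x hx => ?_) fun x hx => ?_
    · rw [(OR_open c).frontier_eq] at hx
      have h3 := OR_closure c hx.1
      refine FV_ne hw hwc h3.1 h3.2.1 (fun h4 => ?_) hx.2
      linarith [h4.2.2, h3.2.2]
    · refine FV_congr fun hU => ?_
      rw [uu, h _ (hstR x hx hU)]; simp
  rw [e1, e2, e3, e4]; ring

theorem dg_nil : dg D (word []) = 0 := by
  have : FV (word (m := m) []) = id := by
    funext x
    exact FV_triv fun _ => by simp [word, WS]
  unfold dg
  rw [this, D.normalized _ isOpen_ball isBounded_ball (by simp)]; simp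

theorem dg_cons (b : Bool) (l : List Bool) : dg D (word (b :: l)) = dg D (word [b]) + dg D (word l) := by
  have hL0 : (0:ℝ) ≤ l.length := Nat.cast_nonneg _
  have hs : HF (word (m := m) l) (word2 [] l 1) := by
    refine ⟨l.length + 2, by positivity, ?_⟩
    refine Htp.of_cont (fun t y => word2 [] l t y) ?_ (fun t ht => ?_) ?_ rfl
    · unfold word2
      have h2 := WS_cont (m := m) l (X := ℝ × Euc (m + 1)) (s := fun z => z.1) (by fun_prop) continuous_snd
      exact (continuous_const.add (continuous_const (y := (0 : Euc (m + 1) × ℝ)))).add h2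
    · exact word2_PF [] l (by simpa using ht.1) (by linarith [ht.2])
    · funext y; simp [word2, word, WS]
  rw [dg_HF D hs, ← dg_uu D (c := 1 / 2) (R := l.length + 2)]
  · congr 1
    funext y
    simp [uu, word, word2, WS]
    abel
  · exact (word_PF [b]).mono (by simp; linarith)
  · exact word2_PF [] l (by simp) (by linarith)
  · intro y hy
    rw [word, WS_right [b] (by simp; linarith)]; simp
  · intro y hy
    rw [word2, WS_left l (by linarith)]; simp [WS]

theorem dg_replicate (j : ℕ) (b : Bool) : dg D (word (List.replicate j b)) = j * dg D (word [b]) := by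
  induction j with
  | zero => simp [dg_nil]
  | succ j ih => rw [List.replicate_succ, dg_cons, ih]; push_cast; ring

theorem dg_not (b : Bool) : dg D (word [!b]) = - dg D (word [b]) := by
  have h := dg_HF D (word_cancel (m := m) [] [] b)
  simp only [List.nil_append] at h
  rw [dg_cons, dg_nil] at h
  omega

theorem dg_unit : ∃ b, dg D (word [b]) = -1 := by
  have hP : PG (fun _ : Euc (m + 2) => (ee : Euc (m + 2))) := by
    refine ⟨isGradient_iff.2 ⟨continuous_const, fun x => ⟪ee, x⟫, fun x => ?_⟩, fun x _ => ?_⟩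
    · rw [hasGradientAt_iff_hasFDerivAt]
      exact (InnerProductSpace.toDual ℝ (Euc (m + 2)) ee).hasFDerivAt
    · intro h
      beta_reduce at h
      have := norm_ee (m := m + 1)
      rw [h] at this; simp at this
  obtain ⟨R, u, w, g, hR, hu, huR, hPF, hg, hgY, hH⟩ := hP.chart
  have h1 := deg_PG D hH
  rw [deg_YY D hPF hg.continuous hgY, deg_eq_zero D isOpen_ball isBounded_ball continuousOn_const
    (fun x _ => hP.2 ee norm_ee)] at h1
  obtain ⟨j, b, hj⟩ := to_normal hPF
  rw [dg_HF D hj, dg_replicate] at h1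
  have h2 : (j : ℤ) * dg D (word [b]) = -1 := by linarith
  have h3 : IsUnit (dg D (word [b])) := IsUnit.of_mul_eq_one (-(j:ℤ)) (by linarith)
  rcases Int.isUnit_iff.1 h3 with h | h
  · exact ⟨!b, by rw [dg_not, h]⟩
  · exact ⟨b, h⟩
end
end GH

namespace GH
open scoped RealInnerProductSpace Topology

variable {m : ℕ}

theorem word_unique (D : DegreeTheory (m + 1 + 1)) {j j' : ℕ} {b b' : Bool}
    (h : dg D (word (List.replicate j b)) = dg D (word (List.replicate j' b'))) :
    List.replicate j b = List.replicate j' b' := by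
  obtain ⟨c, hc⟩ := dg_unit D
  have hd : ∀ b, dg D (word [b]) = if b = c then -1 else 1 := by
    intro b
    split_ifs with hb
    · rw [hb, hc]
    · have : b = !c := by cases b <;> cases c <;> simp_all
      rw [this, dg_not, hc]; rfl
  rw [dg_replicate, dg_replicate, hd, hd] at h
  by_cases hb : b = b'
  · subst hb
    have : j = j' := by split_ifs at h <;> omega
    rw [this]
  · have h1 : j = 0 ∧ j' = 0 := by
      by_cases h2 : b = c <;> by_cases h3 : b' = c
      · exact absurd (h2.trans h3.symm) hb
      · simp only [h2, h3, if_true, if_false] at h; omega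
      · simp only [h2, h3, if_true, if_false] at h; omega
      · exfalso; cases b <;> cases b' <;> cases c <;> simp_all
    rw [h1.1, h1.2]; rfl

theorem PG_unique (D : DegreeTheory (m + 1 + 1)) {f g : Euc (m + 1 + 1) → Euc (m + 1 + 1)} (hf : PG f) (hg : PG g)
    (h : D.deg f (ball 0 1) = D.deg g (ball 0 1)) : Htp PG f g := by
  obtain ⟨R, u, w, f', hR, hu, huR, hPF, hf', hfY, hH⟩ := PG.chart (m := m) hf
  obtain ⟨R₁, u₁, w₁, g', hR₁, hu₁, huR₁, hPF₁, hg', hgY, hH₁⟩ := PG.chart (m := m) hg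
  rw [deg_PG D hH, deg_PG D hH₁, deg_YY D hPF hf'.continuous hfY, deg_YY D hPF₁ hg'.continuous hgY] at h
  obtain ⟨j, b, hj⟩ := to_normal hPF
  obtain ⟨j₁, b₁, hj₁⟩ := to_normal hPF₁
  rw [dg_HF D hj, dg_HF D hj₁] at h
  have h' := word_unique D (add_left_cancel h)
  rw [← h'] at hj₁
  obtain ⟨R₂, hR₂, h2⟩ := hj.trans hj₁.symm
  refine hH.trans (Htp.trans ?_ hH₁.symm)
  refine CI_inj (R := max R₂ (max R R₁)) (lt_max_of_lt_left hR₂) hu hu₁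
    (fun y hy => huR y ?_) (fun y hy => huR₁ y ?_)
    (h2.mono fun _ hP => hP.mono (le_max_left _ _)) hf' hg' hfY hgY
  · exact (le_max_left _ _).trans ((le_max_right _ _).trans hy)
  · exact (le_max_right _ _).trans ((le_max_right _ _).trans hy)

theorem PG_exists (D : DegreeTheory (m + 1 + 1)) (k : ℤ) :
    ∃ f : Euc (m + 1 + 1) → Euc (m + 1 + 1), PG f ∧ D.deg f (ball 0 1) = k := by
  obtain ⟨c, hc⟩ := dg_unit D
  have : ∃ (j : ℕ) (b : Bool), 1 + dg D (word (List.replicate j b)) = k := by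
    rcases le_total k 1 with h | h
    · refine ⟨(1 - k).toNat, c, ?_⟩
      rw [dg_replicate, hc, Int.toNat_of_nonneg (by linarith)]; ring
    · refine ⟨(k - 1).toNat, !c, ?_⟩
      rw [dg_replicate, dg_not, hc, Int.toNat_of_nonneg (by linarith)]; ring
  obtain ⟨j, b, hjb⟩ := this
  have hR : (0:ℝ) < (List.replicate j b).length + 1 := by positivity
  obtain ⟨u, w, hu, hw, hu0, hw1, hH⟩ := CI_surj hR (word_PF (m := m) (List.replicate j b))
  obtain ⟨F, hFc, hFg, hFY⟩ := exists_field (u := fun z => u z.2) (w := fun z => w z.2)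
    (hu.comp contDiff_snd) (hw.comp contDiff_snd) (fun _ y h => hu0 y h) (fun _ y h => hw1 y h)
  refine ⟨F 0, ⟨hFg 0, fun x hx => ?_⟩, ?_⟩
  · rw [hFY 0 x hx]
    exact YY_of_far hH.prop.2 hx
  · rw [deg_YY D hH.prop.2 (hFg 0).continuous (hFY 0), ← dg_HF D ⟨_, by positivity, hH⟩, hjb]

theorem main (k : ℤ) (D : DegreeTheory (m + 1 + 1)) :
    (∃ f : Euc (m + 1 + 1) → Euc (m + 1 + 1), IsGradient f ∧ IsCompact (f ⁻¹' {0}) ∧ HasDeg D f k) ∧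
    (∀ f g : Euc (m + 1 + 1) → Euc (m + 1 + 1),
      IsGradient f → IsCompact (f ⁻¹' {0}) → HasDeg D f k →
      IsGradient g → IsCompact (g ⁻¹' {0}) → HasDeg D g k →
      GradientHomotopic f g) := by
  constructor
  · obtain ⟨f, hf, hk⟩ := PG_exists D k
    obtain ⟨R, hR⟩ := htp_rho (Htp.refl hf.1.continuous hf)
    have hP := hR.prop.1
    refine ⟨rho f, hP.1, ?_, ?_⟩
    · refine (isCompact_closedBall (0 : Euc (m + 1 + 1)) R).of_isClosed_subset
        (isClosed_singleton.preimage hP.1.continuous) fun x hx => ?_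
      simpa using hP.2 x hx
    · rw [← hk]; exact hasDeg_rho D hf
  · intro f g hf hfK hfk hg hgK hgk
    have key : ∀ f : Euc (m + 1 + 1) → Euc (m + 1 + 1), IsGradient f → IsCompact (f ⁻¹' {0}) → HasDeg D f k →
        ∃ f', PG f' ∧ D.deg f' (ball 0 1) = k ∧ ∃ M, Htp (PZ M) f (rho f') := by
      intro f hf hK hk
      obtain ⟨r, hr⟩ := hK.isBounded.subset_closedBall 0
      set R0 := max r 0 with hR0
      have hz : ∀ x, f x = 0 → ‖x‖ ≤ R0 := fun x hx => by
        have := hr (show x ∈ f ⁻¹' {0} from hx)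
        exact (by simpa using this : ‖x‖ ≤ r).trans (le_max_left _ _)
      have h0 : 0 ≤ R0 := le_max_right _ _
      refine ⟨fun x => (R0 + 1) • f ((R0 + 1) • x), ⟨?_, ?_⟩, ?_, ?_⟩
      · exact scale_isGradient hf _
      · intro x hx h
        rcases smul_eq_zero.1 h with h | h
        · linarith
        · have := hz _ h
          rw [norm_smul, hx, mul_one, Real.norm_of_nonneg (by linarith)] at this
          linarith
      · rw [← deg_scale D hf.continuous (lt_add_one R0) (by linarith) hz]
        refine hk _ (by linarith) fun x hx => ?_
        have := hz x hx
        simp; linarith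
      · exact htp_scale hf h0 (lt_add_one R0) (by linarith) hz
    obtain ⟨f', hf', hdf, M, hM⟩ := key f hf hfK hfk
    obtain ⟨g', hg', hdg, M', hM'⟩ := key g hg hgK hgk
    obtain ⟨M₂, hM₂⟩ := htp_rho (PG_unique D hf' hg' (hdf.trans hdg.symm))
    have mono : ∀ {a b : ℝ} {f g : Euc (m + 1 + 1) → Euc (m + 1 + 1)}, a ≤ b → Htp (PZ a) f g → Htp (PZ b) f g :=
      fun hab h => h.mono fun _ hP => ⟨hP.1, fun x hx => (hP.2 x hx).trans hab⟩
    have l1 : M ≤ max M (max M' M₂) := le_max_left _ _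
    have l2 : M' ≤ max M (max M' M₂) := (le_max_left _ _).trans (le_max_right _ _)
    have l3 : M₂ ≤ max M (max M' M₂) := (le_max_right _ _).trans (le_max_right _ _)
    exact (((mono l1 hM).trans (mono l3 hM₂)).trans (mono l2 hM').symm).gradientHomotopic

end GH

/-- For `n ≥ 2` and `k ∈ ℤ`, the set of gradient homotopy classes of gradient
maps `ℝⁿ → ℝⁿ` with compact zero set and Brouwer degree `k` is a singleton: such a map exists,
and any two of them are gradient homotopic. -/
theorem gradient_homotopy_classification (n : ℕ) (hn : 2 ≤ n) (k : ℤ) (D : DegreeTheory n) :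
    (∃ f : Euc n → Euc n, IsGradient f ∧ IsCompact (f ⁻¹' {0}) ∧ HasDeg D f k) ∧
    (∀ f g : Euc n → Euc n,
      IsGradient f → IsCompact (f ⁻¹' {0}) → HasDeg D f k →
      IsGradient g → IsCompact (g ⁻¹' {0}) → HasDeg D g k →
      GradientHomotopic f g) := by
  obtain ⟨m, rfl⟩ : ∃ m, n = m + 1 + 1 := ⟨n - 2, by omega⟩
  exact GH.main k D
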